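/- Under Assumptions 1, 2 and 3, the rescaled empirical p-U-quantile √n·(U_n⁻¹(p) − U⁻¹(p)) converges in distribution, as n → ∞, to the centered normal law with variance σ_p² = (4/u²(U⁻¹(p))) Σ_{r∈ℤ} Cov(h₁(X_0,U⁻¹(p)), h₁(X_r,U⁻¹(p))) (the one-dimensional marginal at s = 1 of the functional limit theorem for the U-quantile process). -/

import Mathlib

open MeasureTheory Filter Set
open scoped ENNReal NNReal Topology BigOperators

noncomputable section

namespace UQuantile

variable {Ω : Type*} [MeasurableSpace Ω]

/-- Strict stationarity of the pair process `((X_i, Z_i))_{i ∈ ℤ}`. -/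
def IsPairStationary (P : Measure Ω) (X Z : ℤ → Ω → ℝ) : Prop :=
  ∀ (k : ℤ) (n : ℕ) (idx : Fin n → ℤ),
    P.map (fun ω i => (X (idx i) ω, Z (idx i) ω)) =
      P.map (fun ω i => (X (idx i + k) ω, Z (idx i + k) ω))

/-- Near epoch dependence in probability (PNED) of `X` on `Z` with approximation
constants `a` and gauge function `φ`. -/
def PNED (P : Measure Ω) (X Z : ℤ → Ω → ℝ) (a : ℕ → ℝ) (φ : ℝ → ℝ) : Prop :=
  ∃ f : (l : ℕ) → ((Fin (2 * l + 1) → ℝ) → ℝ),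
    (∀ l, Measurable (f l)) ∧
      ∀ (l : ℕ), ∀ ε > (0 : ℝ),
        (P {ω | ε < |X 0 ω - f l fun i => Z (((i : ℕ) : ℤ) - (l : ℤ)) ω|}).toReal ≤ a l * φ ε

/-- The σ-field generated by `..., Z_{-1}, Z_0`. -/
def pastSigma (Z : ℤ → Ω → ℝ) : MeasurableSpace Ω :=
  ⨆ i : {i : ℤ // i ≤ 0}, MeasurableSpace.comap (Z i) Real.measurableSpace

/-- The σ-field generated by `Z_k, Z_{k+1}, ...`. -/
def futureSigma (Z : ℤ → Ω → ℝ) (k : ℕ) : MeasurableSpace Ω :=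
  ⨆ i : {i : ℤ // (k : ℤ) ≤ i}, MeasurableSpace.comap (Z i) Real.measurableSpace

/-- The σ-field generated by `Z_{-l}, ..., Z_l`. -/
def rangeSigma (Z : ℤ → Ω → ℝ) (l : ℕ) : MeasurableSpace Ω :=
  ⨆ i : {i : ℤ // -(l : ℤ) ≤ i ∧ i ≤ l}, MeasurableSpace.comap (Z i) Real.measurableSpace

/-- `β` bounds the absolute regularity coefficients of `Z`: for every `k` and every pair of
finite measurable partitions of `Ω` into past, resp. future measurable sets,
`(1/2) Σ_{i,j} |P(A_i ∩ B_j) - P(A_i) P(B_j)| ≤ β k`. -/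
def IsBetaBound (P : Measure Ω) (Z : ℤ → Ω → ℝ) (β : ℕ → ℝ) : Prop :=
  ∀ (k m m' : ℕ) (A : Fin m → Set Ω) (B : Fin m' → Set Ω),
    (∀ i, MeasurableSet[pastSigma Z] (A i)) →
    (∀ j, MeasurableSet[futureSigma Z k] (B j)) →
    Pairwise (Function.onFun Disjoint A) → Pairwise (Function.onFun Disjoint B) →
    (⋃ i, A i) = univ → (⋃ j, B j) = univ →
    (1 / 2 : ℝ) * ∑ i, ∑ j,
        |(P (A i ∩ B j)).toReal - (P (A i)).toReal * (P (B j)).toReal| ≤ β k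

/-- Assumption 1: `((X_i, Z_i))` is strictly stationary, `X` is PNED on `Z` with
`a_l φ(l^{-6}) = O(l^{-6})`, and `Z` is absolutely regular with `Σ k β_k < ∞`. -/
structure Assumption1 (P : Measure Ω) (X Z : ℤ → Ω → ℝ) : Prop where
  stationary : IsPairStationary P X Z
  pned : ∃ (a : ℕ → ℝ) (φ : ℝ → ℝ),
    Tendsto a atTop (𝓝 0) ∧ AntitoneOn φ (Ioi 0) ∧ (∀ x > (0 : ℝ), 0 < φ x) ∧
      PNED P X Z a φ ∧
      (fun l : ℕ => a l * φ ((l : ℝ) ^ (-6 : ℤ))) =O[atTop] fun l : ℕ => (l : ℝ) ^ (-6 : ℤ)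
  mixing : ∃ β : ℕ → ℝ, (∀ k, 0 ≤ β k) ∧ IsBetaBound P Z β ∧
      Summable fun k : ℕ => (k : ℝ) * β k

/-- A U-quantile kernel function: nonnegative, bounded, measurable, symmetric in the first
two arguments and non-decreasing in the third. -/
structure IsUQKernel (h : ℝ → ℝ → ℝ → ℝ) : Prop where
  nonneg : ∀ x y t, 0 ≤ h x y t
  bounded : ∃ M, ∀ x y t, h x y t ≤ M
  measurable : Measurable fun q : ℝ × ℝ × ℝ => h q.1 q.2.1 q.2.2
  symm : ∀ x y t, h x y t = h y x t
  mono : ∀ x y, Monotone (h x y)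

/-- The empirical U-distribution function `U_n(t)`. -/
def Ustat (X : ℤ → Ω → ℝ) (h : ℝ → ℝ → ℝ → ℝ) (n : ℕ) (t : ℝ) (ω : Ω) : ℝ :=
  (2 / ((n : ℝ) * ((n : ℝ) - 1))) *
    ∑ i ∈ Finset.Icc (1 : ℤ) (n : ℤ), ∑ j ∈ Finset.Ioc i (n : ℤ), h (X i ω) (X j ω) t

/-- The population U-distribution function `U(t) = E h(X, Y, t)` for `X, Y` independent
with law `μ`. -/
def Udist (μ : Measure ℝ) (h : ℝ → ℝ → ℝ → ℝ) (t : ℝ) : ℝ := ∫ x, ∫ y, h x y t ∂μ ∂μ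

/-- The linear part of the Hoeffding decomposition, `h₁(x, t) = E h(x, X₀, t) - U(t)`. -/
def h1 (μ : Measure ℝ) (h : ℝ → ℝ → ℝ → ℝ) (x t : ℝ) : ℝ := (∫ y, h x y t ∂μ) - Udist μ h t

/-- The degenerate part of the Hoeffding decomposition. -/
def h2 (μ : Measure ℝ) (h : ℝ → ℝ → ℝ → ℝ) (x y t : ℝ) : ℝ :=
  h x y t - h1 μ h x t - h1 μ h y t - Udist μ h t

/-- The population `p`-U-quantile `U⁻¹(p)`. -/
def Uinv (μ : Measure ℝ) (h : ℝ → ℝ → ℝ → ℝ) (p : ℝ) : ℝ := sInf {t | p ≤ Udist μ h t}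

/-- The empirical `p`-U-quantile `U_n⁻¹(p)`. -/
def UinvEmp (X : ℤ → Ω → ℝ) (h : ℝ → ℝ → ℝ → ℝ) (n : ℕ) (p : ℝ) (ω : Ω) : ℝ :=
  sInf {t | p ≤ Ustat X h n t ω}

/-- The variation condition for `h(·,·,t)` with constant `L`, with respect to the law `μ`. -/
def VariationAt (μ : Measure ℝ) (h : ℝ → ℝ → ℝ → ℝ) (L t : ℝ) : Prop :=
  ∀ ε > (0 : ℝ),
    ∫⁻ q : ℝ × ℝ, ENNReal.ofReal
        ((⨆ r ∈ Metric.closedBall q ε, |h r.1 r.2 t - h q.1 q.2 t|) ^ 2) ∂(μ.prod μ)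
      ≤ ENNReal.ofReal (L * ε)

/-- Assumption 2: the variation condition holds for all `t` in a neighborhood of `U⁻¹(p)`. -/
def Assumption2 (μ : Measure ℝ) (h : ℝ → ℝ → ℝ → ℝ) (p : ℝ) : Prop :=
  ∃ L δ : ℝ, 0 < δ ∧ ∀ t, |t - Uinv μ h p| < δ → VariationAt μ h L t

/-- Assumption 3: `U` is differentiable near `U⁻¹(p)` with derivative `u`,
`u(U⁻¹(p)) > 0`, and a `3/2`-order Taylor-type expansion holds at `U⁻¹(p)`. -/
def Assumption3 (μ : Measure ℝ) (h : ℝ → ℝ → ℝ → ℝ) (p : ℝ) (u : ℝ → ℝ) : Prop :=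
  (∀ᶠ t in 𝓝 (Uinv μ h p), HasDerivAt (Udist μ h) (u t) t) ∧
    0 < u (Uinv μ h p) ∧
    (fun t => Udist μ h t - p - u (Uinv μ h p) * (t - Uinv μ h p)) =o[𝓝 (Uinv μ h p)]
      fun t => |t - Uinv μ h p| ^ ((3 : ℝ) / 2)

/-- The lag-`r` autocovariance `Cov(f(X_0), f(X_r))`. -/
def covShift (P : Measure Ω) (X : ℤ → Ω → ℝ) (f : ℝ → ℝ) (r : ℤ) : ℝ :=
  (∫ ω, f (X 0 ω) * f (X r ω) ∂P) - (∫ ω, f (X 0 ω) ∂P) * ∫ ω, f (X r ω) ∂P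

/-- The long-run variance `σ_p²` of the `p`-U-quantile. -/
def lrv (P : Measure Ω) (X : ℤ → Ω → ℝ) (h : ℝ → ℝ → ℝ → ℝ) (p : ℝ) (u : ℝ → ℝ) : ℝ :=
  (4 / u (Uinv (P.map (X 0)) h p) ^ 2) *
    ∑' r : ℤ, covShift P X (fun x => h1 (P.map (X 0)) h x (Uinv (P.map (X 0)) h p)) r

end UQuantile

set_option linter.unusedSectionVars false

namespace UQuantile

variable {Ω : Type*} [MeasurableSpace Ω]

/-- The shifted path of the pair process. -/
def path (X Z : ℤ → Ω → ℝ) (k : ℤ) (ω : Ω) : ℤ → ℝ × ℝ := fun i => (X (i + k) ω, Z (i + k) ω)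

lemma measurable_path {X Z : ℤ → Ω → ℝ} (hX : ∀ i, Measurable (X i)) (hZ : ∀ i, Measurable (Z i))
    (k : ℤ) : Measurable (path X Z k) := by
  unfold path
  exact measurable_pi_lambda _ fun i => (hX _).prodMk (hZ _)

lemma path_law {P : Measure Ω} [IsProbabilityMeasure P] {X Z : ℤ → Ω → ℝ}
    (hX : ∀ i, Measurable (X i)) (hZ : ∀ i, Measurable (Z i))
    (hs : IsPairStationary P X Z) (k : ℤ) : P.map (path X Z k) = P.map (path X Z 0) := by
  have key : ∀ k, IsProjectiveLimit (P.map (path X Z k))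
      (fun I => (P.map (path X Z 0)).map I.restrict) := by
    intro k I
    have hr : Measurable (I.restrict : (ℤ → ℝ × ℝ) → _) := Finset.measurable_restrict _
    show _ = (P.map (path X Z 0)).map I.restrict
    rw [Measure.map_map hr (measurable_path hX hZ k), Measure.map_map hr (measurable_path hX hZ 0)]
    let e := I.equivFin
    let idx : Fin I.card → ℤ := fun j => (e.symm j : ℤ)
    have h1 := hs k I.card idx
    let R : (Fin I.card → ℝ × ℝ) → (I → ℝ × ℝ) := fun x i => x (e i)
    have hR : Measurable R := measurable_pi_lambda _ fun i => measurable_pi_apply _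
    have hm : ∀ k, Measurable (fun ω i => (X (idx i + k) ω, Z (idx i + k) ω)) := fun k =>
      measurable_pi_lambda _ fun i => (hX _).prodMk (hZ _)
    have h2 := congrArg (Measure.map R) h1
    have hm0 := hm 0
    simp only [add_zero] at hm0
    rw [Measure.map_map hR hm0, Measure.map_map hR (hm k)] at h2
    have e1 : (I.restrict : (ℤ → ℝ × ℝ) → _) ∘ path X Z k
        = R ∘ (fun ω i => (X (idx i + k) ω, Z (idx i + k) ω)) := by
      funext ω i; simp [R, path, idx]
    have e2 : (I.restrict : (ℤ → ℝ × ℝ) → _) ∘ path X Z 0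
        = R ∘ (fun ω i => (X (idx i) ω, Z (idx i) ω)) := by
      funext ω i; simp [R, path, idx]
    rw [e1, e2, h2]
  have : IsProbabilityMeasure (P.map (path X Z 0)) :=
    Measure.isProbabilityMeasure_map (measurable_path hX hZ 0).aemeasurable
  have : ∀ I : Finset ℤ, IsFiniteMeasure ((P.map (path X Z 0)).map I.restrict) := by
    intro I; infer_instance
  exact (key k).unique (key 0)

lemma integral_path {P : Measure Ω} [IsProbabilityMeasure P] {X Z : ℤ → Ω → ℝ}
    (hX : ∀ i, Measurable (X i)) (hZ : ∀ i, Measurable (Z i))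
    (hs : IsPairStationary P X Z) (k : ℤ) {F : (ℤ → ℝ × ℝ) → ℝ} (hF : Measurable F) :
    ∫ ω, F (path X Z k ω) ∂P = ∫ ω, F (path X Z 0 ω) ∂P := by
  rw [← integral_map (measurable_path hX hZ k).aemeasurable hF.aestronglyMeasurable,
    ← integral_map (measurable_path hX hZ 0).aemeasurable hF.aestronglyMeasurable,
    path_law hX hZ hs k]

lemma pastSigma_le {Z : ℤ → Ω → ℝ} (hZ : ∀ i, Measurable (Z i)) :
    pastSigma Z ≤ ‹MeasurableSpace Ω› :=
  iSup_le fun i => (hZ i).comap_le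

lemma futureSigma_le {Z : ℤ → Ω → ℝ} (hZ : ∀ i, Measurable (Z i)) (k : ℕ) :
    futureSigma Z k ≤ ‹MeasurableSpace Ω› :=
  iSup_le fun i => (hZ i).comap_le

lemma measurable_past {Z : ℤ → Ω → ℝ} {i : ℤ} (hi : i ≤ 0) : Measurable[pastSigma Z] (Z i) := by
  have : MeasurableSpace.comap (Z i) Real.measurableSpace ≤ pastSigma Z :=
    le_iSup (fun i : {i : ℤ // i ≤ 0} => MeasurableSpace.comap (Z i) Real.measurableSpace) ⟨i, hi⟩
  exact measurable_iff_comap_le.2 this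

lemma measurable_future {Z : ℤ → Ω → ℝ} {i : ℤ} {k : ℕ} (hi : (k : ℤ) ≤ i) :
    Measurable[futureSigma Z k] (Z i) := by
  have : MeasurableSpace.comap (Z i) Real.measurableSpace ≤ futureSigma Z k :=
    le_iSup (fun i : {i : ℤ // (k : ℤ) ≤ i} => MeasurableSpace.comap (Z i) Real.measurableSpace)
      ⟨i, hi⟩
  exact measurable_iff_comap_le.2 this

lemma futureSigma_anti {Z : ℤ → Ω → ℝ} {j k : ℕ} (h : j ≤ k) : futureSigma Z k ≤ futureSigma Z j :=
  iSup_le fun i => measurable_iff_comap_le.1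
    (measurable_future (le_trans (by exact_mod_cast h) i.2))

/-- The beta bound for partitions indexed by arbitrary finite types. -/
lemma beta_fintype {P : Measure Ω} {Z : ℤ → Ω → ℝ} {β : ℕ → ℝ} (hβ : IsBetaBound P Z β) (k : ℕ)
    {ι κ : Type*} [Fintype ι] [Fintype κ] (A : ι → Set Ω) (B : κ → Set Ω)
    (hA : ∀ i, MeasurableSet[pastSigma Z] (A i)) (hB : ∀ j, MeasurableSet[futureSigma Z k] (B j))
    (dA : Pairwise (Function.onFun Disjoint A)) (dB : Pairwise (Function.onFun Disjoint B))
    (uA : (⋃ i, A i) = univ) (uB : (⋃ j, B j) = univ) :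
    ∑ i, ∑ j, |(P (A i ∩ B j)).toReal - (P (A i)).toReal * (P (B j)).toReal| ≤ 2 * β k := by
  let e := (Fintype.equivFin ι).symm
  let e' := (Fintype.equivFin κ).symm
  have := hβ k _ _ (A ∘ e) (B ∘ e') (fun i => hA _) (fun i => hB _)
    (fun i j hij => dA (e.injective.ne hij)) (fun i j hij => dB (e'.injective.ne hij))
    (by rw [← uA]; exact e.surjective.iUnion_comp A) (by rw [← uB]; exact e'.surjective.iUnion_comp B)
  have h2 : ∑ i, ∑ j, |(P (A i ∩ B j)).toReal - (P (A i)).toReal * (P (B j)).toReal|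
      = ∑ i, ∑ j, |(P ((A ∘ e) i ∩ (B ∘ e') j)).toReal
        - (P ((A ∘ e) i)).toReal * (P ((B ∘ e') j)).toReal| := by
    rw [← e.sum_comp]
    refine Finset.sum_congr rfl fun i _ => ?_
    rw [← e'.sum_comp]; rfl
  rw [h2]; linarith

/-- partition of `Ω` into the level sets of `V` on a finset and the rest -/
def cell {S : Type*} (V : Ω → S) (A : Finset S) : Option A → Set Ω
  | none => {ω | V ω ∉ A}
  | some a => {ω | V ω = a}

lemma cell_disj {S : Type*} (V : Ω → S) (A : Finset S) :
    Pairwise (Function.onFun Disjoint (cell V A)) := by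
  rintro (_ | a) (_ | b) hab
  · exact absurd rfl hab
  · refine Set.disjoint_left.2 fun ω h1 h2 => h1 ?_
    have : V ω = b := h2
    rw [this]; exact b.2
  · refine Set.disjoint_left.2 fun ω h2 h1 => h1 ?_
    have : V ω = a := h2
    rw [this]; exact a.2
  · refine Set.disjoint_left.2 fun ω h1 h2 => hab ?_
    have e1 : V ω = a := h1
    have e2 : V ω = b := h2
    congr 1; exact Subtype.ext (e1.symm.trans e2)

lemma cell_union {S : Type*} (V : Ω → S) (A : Finset S) : (⋃ i, cell V A i) = univ := by
  refine Set.eq_univ_of_forall fun ω => ?_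
  by_cases h : V ω ∈ A
  · exact Set.mem_iUnion.2 ⟨some ⟨V ω, h⟩, rfl⟩
  · exact Set.mem_iUnion.2 ⟨none, h⟩

lemma cell_meas {m : MeasurableSpace Ω} {S : Type*} [MeasurableSpace S] [MeasurableSingletonClass S]
    {V : Ω → S} (hV : Measurable V) (A : Finset S) (i) : MeasurableSet (cell V A i) := by
  rcases i with _ | a
  · exact (hV A.measurableSet).compl
  · exact hV (measurableSet_singleton (a : S))

lemma tv_finset {P : Measure Ω} {Z : ℤ → Ω → ℝ} {β : ℕ → ℝ} (hβ : IsBetaBound P Z β) (k : ℕ)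
    {S T : Type*} [MeasurableSpace S] [MeasurableSingletonClass S] [MeasurableSpace T]
    [MeasurableSingletonClass T] {V : Ω → S} {W : Ω → T} (hV : Measurable[pastSigma Z] V)
    (hW : Measurable[futureSigma Z k] W) (A : Finset S) (B : Finset T) :
    ∑ s ∈ A, ∑ t ∈ B, |P.real {ω | V ω = s ∧ W ω = t} - P.real {ω | V ω = s} * P.real {ω | W ω = t}|
      ≤ 2 * β k := by
  have h := beta_fintype hβ k (cell V A) (cell W B) (fun i => cell_meas hV A i)
    (fun i => cell_meas hW B i) (cell_disj V A) (cell_disj W B) (cell_union V A) (cell_union W B)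
  refine le_trans ?_ h
  rw [Fintype.sum_option]
  refine le_trans ?_ (le_add_of_nonneg_left (Finset.sum_nonneg fun _ _ => abs_nonneg _))
  rw [← Finset.sum_coe_sort]
  refine Finset.sum_le_sum fun s _ => ?_
  rw [Fintype.sum_option]
  refine le_trans ?_ (le_add_of_nonneg_left (abs_nonneg _))
  rw [← Finset.sum_coe_sort]
  exact le_rfl

lemma hasSum_integral_countable {S : Type*} [Countable S] [MeasurableSpace S]
    [MeasurableSingletonClass S] {μ : Measure S} {G : S → ℝ} (hG : Integrable G μ) :
    HasSum (fun x => μ.real {x} • G x) (∫ x, G x ∂μ) := by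
  have h := hasSum_integral_iUnion (μ := μ) (f := G) (s := fun x : S => ({x} : Set S))
    (fun x => measurableSet_singleton x)
    (fun x y hxy => by simpa [Function.onFun] using hxy) hG.integrableOn
  rw [Set.iUnion_of_singleton, setIntegral_univ] at h
  simpa [integral_singleton, Measure.real] using h

lemma tv_core {P : Measure Ω} [IsProbabilityMeasure P] {Z : ℤ → Ω → ℝ} (hZ : ∀ i, Measurable (Z i))
    {β : ℕ → ℝ} (hβ : IsBetaBound P Z β) (k : ℕ)
    {S T : Type*} [Countable S] [MeasurableSpace S] [MeasurableSingletonClass S] [Countable T]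
    [MeasurableSpace T]
    [MeasurableSingletonClass T] {V : Ω → S} {W : Ω → T} (hV : Measurable[pastSigma Z] V)
    (hW : Measurable[futureSigma Z k] W) (F : S → T → ℝ) {M : ℝ} (hF : ∀ s t, |F s t| ≤ M) :
    |∫ ω, F (V ω) (W ω) ∂P - ∫ ω, ∫ ω', F (V ω) (W ω') ∂P ∂P| ≤ 2 * M * β k := by
  have hV' : Measurable V := hV.mono (pastSigma_le hZ) le_rfl
  have hW' : Measurable W := hW.mono (futureSigma_le hZ k) le_rfl
  let G : S × T → ℝ := fun x => F x.1 x.2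
  have hG : Measurable G := measurable_of_countable _
  have hGb : ∀ x, ‖G x‖ ≤ M := fun x => hF _ _
  have iG : ∀ (ν : Measure (S × T)) [IsProbabilityMeasure ν], Integrable G ν := fun ν _ =>
    (integrable_const M).mono' hG.aestronglyMeasurable (Eventually.of_forall hGb)
  have : IsProbabilityMeasure (P.map V) := Measure.isProbabilityMeasure_map hV'.aemeasurable
  have : IsProbabilityMeasure (P.map W) := Measure.isProbabilityMeasure_map hW'.aemeasurable
  have : IsProbabilityMeasure (P.map fun ω => (V ω, W ω)) :=
    Measure.isProbabilityMeasure_map (hV'.prodMk hW').aemeasurable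
  have e1 : ∫ ω, F (V ω) (W ω) ∂P = ∫ x, G x ∂(P.map fun ω => (V ω, W ω)) := by
    rw [integral_map (hV'.prodMk hW').aemeasurable hG.aestronglyMeasurable]
  have e2 : ∫ ω, ∫ ω', F (V ω) (W ω') ∂P ∂P = ∫ x, G x ∂((P.map V).prod (P.map W)) := by
    rw [integral_prod _ (iG _), integral_map hV'.aemeasurable
      (measurable_of_countable _).aestronglyMeasurable]
    refine integral_congr_ae (Eventually.of_forall fun ω => ?_)
    simp only
    rw [integral_map hW'.aemeasurable (measurable_of_countable _).aestronglyMeasurable]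
  have s1 := (hasSum_integral_countable (iG (P.map fun ω => (V ω, W ω))))
  have s2 := (hasSum_integral_countable (iG ((P.map V).prod (P.map W))))
  rw [e1, e2, ← (s1.sub s2).tsum_eq]
  have p1 : ∀ x : S × T, (P.map fun ω => (V ω, W ω)).real {x} = P.real {ω | V ω = x.1 ∧ W ω = x.2} := by
    intro x
    rw [Measure.real, Measure.map_apply (hV'.prodMk hW') (measurableSet_singleton x), Measure.real]
    congr 2; ext ω; simp [Prod.ext_iff]
  have p2 : ∀ x : S × T, ((P.map V).prod (P.map W)).real {x}
      = P.real {ω | V ω = x.1} * P.real {ω | W ω = x.2} := by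
    rintro ⟨s, t⟩
    rw [← Set.singleton_prod_singleton, Measure.real, Measure.prod_prod,
      Measure.map_apply hV' (measurableSet_singleton s),
      Measure.map_apply hW' (measurableSet_singleton t), ENNReal.toReal_mul]
    rfl
  let D : S × T → ℝ := fun x => |P.real {ω | V ω = x.1 ∧ W ω = x.2}
    - P.real {ω | V ω = x.1} * P.real {ω | W ω = x.2}|
  have hD : ∀ u : Finset (S × T), ∑ x ∈ u, D x ≤ 2 * β k := by
    classical
    intro u
    refine le_trans ?_ (tv_finset hβ k hV hW (u.image Prod.fst) (u.image Prod.snd))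
    rw [← Finset.sum_product']
    refine Finset.sum_le_sum_of_subset_of_nonneg Finset.subset_product (fun _ _ _ => abs_nonneg _)
  have hM : 0 ≤ M := by
    obtain ⟨ω⟩ : Nonempty Ω := by
      by_contra hne
      rw [not_nonempty_iff] at hne
      have := measure_univ (μ := P)
      rw [Set.univ_eq_empty_iff.2 hne] at this
      simp at this
    exact (abs_nonneg _).trans (hF (V ω) (W ω))
  have hDs : Summable D := summable_of_sum_le (fun _ => abs_nonneg _) hD
  have hb : ∀ x, ‖(P.map fun ω => (V ω, W ω)).real {x} • G x
      - ((P.map V).prod (P.map W)).real {x} • G x‖ ≤ M * D x := by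
    intro x
    rw [← sub_smul, norm_smul, p1, p2, mul_comm]
    exact mul_le_mul_of_nonneg_right (hGb x) (abs_nonneg _)
  have := tsum_of_norm_bounded (hDs.mul_left M).hasSum hb
  rw [← Real.norm_eq_abs]
  refine this.trans ?_
  rw [tsum_mul_left]
  have := hDs.tsum_le_of_sum_le hD
  nlinarith

end UQuantile

namespace UQuantile

variable {Ω : Type*} [MeasurableSpace Ω]

/-- From the mixing assumption: a beta bound with `b k ≤ C / (k+1)^2`. -/
lemma exists_beta {P : Measure Ω} [IsProbabilityMeasure P] {Z : ℤ → Ω → ℝ} {β : ℕ → ℝ}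
    (h0 : ∀ k, 0 ≤ β k) (hβ : IsBetaBound P Z β) (hs : Summable fun k : ℕ => (k : ℝ) * β k) :
    ∃ (b : ℕ → ℝ) (C : ℝ), 0 ≤ C ∧ IsBetaBound P Z b ∧ (∀ k, 0 ≤ b k) ∧
      ∀ k, b k ≤ C / ((k : ℝ) + 1) ^ 2 := by
  let b : ℕ → ℝ := fun k => (Finset.range (k + 1)).inf' ⟨0, by simp⟩ β
  have hb0 : ∀ k, 0 ≤ b k := fun k => Finset.le_inf' _ _ fun j _ => h0 j
  have hbj : ∀ k j, j ≤ k → b k ≤ β j := fun k j hj => Finset.inf'_le _ (by simp; omega)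
  let B := ∑' k : ℕ, (k : ℝ) * β k
  have hB : 0 ≤ B := tsum_nonneg fun k => mul_nonneg (by positivity) (h0 k)
  refine ⟨b, 8 * B + 4 * β 0, by have := h0 0; positivity, ?_, hb0, ?_⟩
  · intro k m m' A D hA hD dA dD uA uD
    obtain ⟨j, hj, e⟩ := Finset.exists_mem_eq_inf' (s := Finset.range (k + 1)) ⟨0, by simp⟩ β
    have : b k = β j := e
    rw [this]
    simp only [Finset.mem_range] at hj
    exact hβ j m m' A D hA (fun i => futureSigma_anti (by omega) _ (hD i)) dA dD uA uD
  · intro k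
    rw [le_div_iff₀ (by positivity)]
    have h1 : ∑ j ∈ Finset.range (k + 1), (j : ℝ) * b k ≤ B := by
      refine le_trans (Finset.sum_le_sum fun j hj => ?_)
        (hs.sum_le_tsum (Finset.range (k + 1)) fun j _ => mul_nonneg (by positivity) (h0 j))
      exact mul_le_mul_of_nonneg_left (hbj k j (by simp at hj; omega)) (by positivity)
    have h2 : ∑ j ∈ Finset.range (k + 1), (j : ℝ) * b k = (k : ℝ) * (k + 1) / 2 * b k := by
      rw [← Finset.sum_mul]
      congr 1
      have := Finset.sum_range_id_mul_two (k + 1)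
      have h3 : ((∑ i ∈ Finset.range (k + 1), i : ℕ) : ℝ) * 2 = (k + 1) * k := by
        have := congrArg (Nat.cast (R := ℝ)) this
        push_cast at this ⊢
        simpa using this
      push_cast at h3
      linarith
    rw [h2] at h1
    have h4 := hbj k 0 (by omega)
    have := hb0 k
    have hk : (0 : ℝ) ≤ k := by positivity
    rcases Nat.eq_zero_or_pos k with rfl | hk1
    · norm_num; nlinarith [h0 0]
    · have hk2 : (1 : ℝ) ≤ k := by exact_mod_cast hk1
      have : (k + 1 : ℝ) ^ 2 ≤ 4 * (k * (k + 1) / 2) := by nlinarith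
      nlinarith [h0 0]

/-- Functional of the window of `Z` around `i` with values in `ℤ`. -/
def Nw (Z : ℤ → Ω → ℝ) {l : ℕ} (G : (Fin (2 * l + 1) → ℝ) → ℤ) (i : ℤ) (ω : Ω) : ℤ :=
  G fun j => Z (i + (((j : ℕ) : ℤ) - (l : ℤ))) ω

lemma measurable_Nw {Z : ℤ → Ω → ℝ} (hZ : ∀ i, Measurable (Z i)) {l : ℕ}
    {G : (Fin (2 * l + 1) → ℝ) → ℤ} (hG : Measurable G) (i : ℤ) : Measurable (Nw Z G i) :=
  hG.comp (measurable_pi_lambda _ fun _ => hZ _)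

/-- stationarity for joint functionals of `X` and `N` -/
lemma stat_XN {P : Measure Ω} [IsProbabilityMeasure P] {X Z : ℤ → Ω → ℝ}
    (hX : ∀ i, Measurable (X i)) (hZ : ∀ i, Measurable (Z i))
    (hs : IsPairStationary P X Z) {l : ℕ} {G : (Fin (2 * l + 1) → ℝ) → ℤ} (hG : Measurable G)
    {ι : Type*} [Countable ι] (idx : ι → ℤ) (k : ℤ) {F : (ι → ℝ) → (ι → ℤ) → ℝ}
    (hF : Measurable (Function.uncurry F)) :
    ∫ ω, F (fun i => X (idx i + k) ω) (fun i => Nw Z G (idx i + k) ω) ∂P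
      = ∫ ω, F (fun i => X (idx i) ω) (fun i => Nw Z G (idx i) ω) ∂P := by
  let Φ : (ℤ → ℝ × ℝ) → ℝ := fun x =>
    F (fun i => (x (idx i)).1) (fun i => G fun j => (x (idx i + (((j : ℕ) : ℤ) - (l : ℤ)))).2)
  have hΦ : Measurable Φ := by
    refine hF.comp (Measurable.prodMk ?_ ?_)
    · exact measurable_pi_lambda _ fun i => measurable_fst.comp (measurable_pi_apply _)
    · refine measurable_pi_lambda _ fun i => hG.comp (measurable_pi_lambda _ fun j => ?_)
      exact measurable_snd.comp (measurable_pi_apply _)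
  have := integral_path hX hZ hs k hΦ
  convert this using 4
  · simp [path]
  · funext i
    simp only [path, Nw]
    congr 1
    funext j
    rw [show idx i + k + (((j : ℕ) : ℤ) - l) = idx i + (((j : ℕ) : ℤ) - l) + k by ring]
  · simp [path]
  · simp [path, Nw]

lemma stat_N {P : Measure Ω} [IsProbabilityMeasure P] {X Z : ℤ → Ω → ℝ}
    (hX : ∀ i, Measurable (X i)) (hZ : ∀ i, Measurable (Z i))
    (hs : IsPairStationary P X Z) {l : ℕ} {G : (Fin (2 * l + 1) → ℝ) → ℤ} (hG : Measurable G)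
    {ι : Type*} [Finite ι] (idx : ι → ℤ) (k : ℤ) (F : (ι → ℤ) → ℝ) :
    ∫ ω, F (fun i => Nw Z G (idx i + k) ω) ∂P = ∫ ω, F (fun i => Nw Z G (idx i) ω) ∂P :=
  stat_XN hX hZ hs hG idx k (F := fun _ n => F n) ((measurable_of_countable F).comp measurable_snd)

/-- stationarity for one index -/
lemma stat_XN1 {P : Measure Ω} [IsProbabilityMeasure P] {X Z : ℤ → Ω → ℝ}
    (hX : ∀ i, Measurable (X i)) (hZ : ∀ i, Measurable (Z i))
    (hs : IsPairStationary P X Z) {l : ℕ} {G : (Fin (2 * l + 1) → ℝ) → ℤ} (hG : Measurable G)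
    (i : ℤ) {F : ℝ → ℤ → ℝ} (hF : Measurable (Function.uncurry F)) :
    ∫ ω, F (X i ω) (Nw Z G i ω) ∂P = ∫ ω, F (X 0 ω) (Nw Z G 0 ω) ∂P := by
  have := stat_XN hX hZ hs hG (fun _ : Unit => 0) i (F := fun x n => F (x ()) (n ()))
    (hF.comp (by fun_prop : Measurable fun q : (Unit → ℝ) × (Unit → ℤ) => (q.1 (), q.2 ())))
  simpa using this

/-- stationarity for one index -/
lemma stat_X1 {P : Measure Ω} [IsProbabilityMeasure P] {X Z : ℤ → Ω → ℝ}
    (hX : ∀ i, Measurable (X i)) (hZ : ∀ i, Measurable (Z i))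
    (hs : IsPairStationary P X Z) (i : ℤ) {F : ℝ → ℝ} (hF : Measurable F) :
    ∫ ω, F (X i ω) ∂P = ∫ ω, F (X 0 ω) ∂P :=
  stat_XN1 hX hZ hs (l := 0) (G := fun _ => 0) measurable_const i (F := fun x _ => F x)
    (hF.comp measurable_fst)

/-- stationarity for two indices -/
lemma stat_X2 {P : Measure Ω} [IsProbabilityMeasure P] {X Z : ℤ → Ω → ℝ}
    (hX : ∀ i, Measurable (X i)) (hZ : ∀ i, Measurable (Z i))
    (hs : IsPairStationary P X Z) (i j k : ℤ) {F : ℝ → ℝ → ℝ} (hF : Measurable (Function.uncurry F)) :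
    ∫ ω, F (X (i + k) ω) (X (j + k) ω) ∂P = ∫ ω, F (X i ω) (X j ω) ∂P := by
  have := stat_XN hX hZ hs (l := 0) (G := fun _ => 0) measurable_const
    (fun b : Bool => if b then i else j) k (F := fun x _ => F (x true) (x false))
    (hF.comp (by fun_prop : Measurable fun q : (Bool → ℝ) × (Bool → ℤ) => (q.1 true, q.1 false)))
  simpa using this

/-- Decoupling of past and future for window functionals. -/
lemma decouple {P : Measure Ω} [IsProbabilityMeasure P] {X Z : ℤ → Ω → ℝ}
    (hX : ∀ i, Measurable (X i)) (hZ : ∀ i, Measurable (Z i))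
    (hs : IsPairStationary P X Z) {β : ℕ → ℝ} (hβ : IsBetaBound P Z β)
    {l : ℕ} {G : (Fin (2 * l + 1) → ℝ) → ℤ} (hG : Measurable G)
    {ι : Type*} [Finite ι] (idx : ι → ℤ) (pr : ι → Prop) [DecidablePred pr] (c : ℤ) (g : ℕ)
    (h1 : ∀ i, pr i → idx i + l ≤ c) (h2 : ∀ i, ¬ pr i → c + g ≤ idx i - l)
    (F : (ι → ℤ) → ℝ) {M : ℝ} (hF : ∀ x, |F x| ≤ M) :
    |∫ ω, F (fun i => Nw Z G (idx i) ω) ∂P -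
      ∫ ω, ∫ ω', F (fun i => if pr i then Nw Z G (idx i) ω else Nw Z G (idx i) ω') ∂P ∂P|
      ≤ 2 * M * β g := by
  let V : Ω → (ι → ℤ) := fun ω i => if pr i then Nw Z G (idx i - c) ω else 0
  let W : Ω → (ι → ℤ) := fun ω i => if pr i then 0 else Nw Z G (idx i - c) ω
  have hV : Measurable[pastSigma Z] V := by
    refine @measurable_pi_lambda _ _ _ (pastSigma Z) _ _ fun i => ?_
    by_cases hi : pr i
    · simp only [V, hi, if_true]
      refine hG.comp (@measurable_pi_lambda _ _ _ (pastSigma Z) _ _ fun j => ?_)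
      refine measurable_past ?_
      have := h1 i hi
      have := j.2
      omega
    · simp only [V, hi, if_false]
      exact @measurable_const _ _ _ (pastSigma Z) _
  have hW : Measurable[futureSigma Z g] W := by
    refine @measurable_pi_lambda _ _ _ (futureSigma Z g) _ _ fun i => ?_
    by_cases hi : pr i
    · simp only [W, hi, if_true]
      exact @measurable_const _ _ _ (futureSigma Z g) _
    · simp only [W, hi, if_false]
      refine hG.comp (@measurable_pi_lambda _ _ _ (futureSigma Z g) _ _ fun j => ?_)
      refine measurable_future ?_
      have := h2 i hi
      have := j.2
      omega
  have key := tv_core hZ hβ g hV hW (fun v w => F fun i => if pr i then v i else w i)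
    (M := M) (fun _ _ => hF _)
  have e1 : ∫ ω, F (fun i => if pr i then V ω i else W ω i) ∂P
      = ∫ ω, F (fun i => Nw Z G (idx i) ω) ∂P := by
    rw [← stat_N hX hZ hs hG idx (-c) F]
    refine integral_congr_ae (Eventually.of_forall fun ω => ?_)
    simp only
    congr 1
    funext i
    by_cases hi : pr i <;> simp [V, W, hi, sub_eq_add_neg]
  have e2 : ∫ ω, ∫ ω', F (fun i => if pr i then V ω i else W ω' i) ∂P ∂P
      = ∫ ω, ∫ ω', F (fun i => if pr i then Nw Z G (idx i) ω else Nw Z G (idx i) ω') ∂P ∂P := by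
    let ψ : (ι → ℤ) → ℝ := fun v => ∫ ω', F (fun i => if pr i then v i else Nw Z G (idx i) ω') ∂P
    have a1 : ∀ v : ι → ℤ, ∫ ω', F (fun i => if pr i then v i else W ω' i) ∂P = ψ v := by
      intro v
      have := stat_N hX hZ hs hG idx (-c) (fun w => F fun i => if pr i then v i else w i)
      simp only [ψ]
      rw [← this]
      refine integral_congr_ae (Eventually.of_forall fun ω => ?_)
      simp only
      congr 1
      funext i
      by_cases hi : pr i <;> simp [W, hi, sub_eq_add_neg]
    simp_rw [fun ω => a1 (V ω)]
    have := stat_N hX hZ hs hG idx (-c) (fun v => ψ v)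
    have hψ : ∀ v w : ι → ℤ, (∀ i, pr i → v i = w i) → ψ v = ψ w := by
      intro v w hvw
      simp only [ψ]
      refine integral_congr_ae (Eventually.of_forall fun ω => ?_)
      simp only
      congr 1
      funext i
      by_cases hi : pr i <;> simp [hi, hvw]
    rw [show (∫ ω, ∫ ω', F (fun i => if pr i then Nw Z G (idx i) ω else Nw Z G (idx i) ω') ∂P ∂P)
      = ∫ ω, ψ (fun i => Nw Z G (idx i) ω) ∂P from rfl, ← this]
    refine integral_congr_ae (Eventually.of_forall fun ω => ?_)
    refine hψ _ _ fun i hi => ?_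
    simp [V, hi, sub_eq_add_neg]
  rw [e1, e2] at key
  exact key

end UQuantile

namespace UQuantile

variable {Ω : Type*} [MeasurableSpace Ω]

/-- The working form of Assumption 1. -/
structure Std (P : Measure Ω) (X Z : ℤ → Ω → ℝ) (b : ℕ → ℝ) (Cb : ℝ)
    (G : (l : ℕ) → (Fin (2 * l + 1) → ℝ) → ℤ) (l0 : ℕ) (Ca : ℝ) : Prop where
  hX : ∀ i, Measurable (X i)
  hZ : ∀ i, Measurable (Z i)
  hs : IsPairStationary P X Z
  hβ : IsBetaBound P Z b
  b0 : ∀ k, 0 ≤ b k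
  Cb0 : 0 ≤ Cb
  bC : ∀ k, b k ≤ Cb / ((k : ℝ) + 1) ^ 2
  hG : ∀ l, Measurable (G l)
  l01 : 1 ≤ l0
  Ca0 : 0 ≤ Ca
  app : ∀ l ≥ l0, P.real {ω | 2 < |X 0 ω * (l : ℝ) ^ 6 - Nw Z (G l) 0 ω|} ≤ Ca / (l : ℝ) ^ 6

lemma exists_std {P : Measure Ω} [IsProbabilityMeasure P] {X Z : ℤ → Ω → ℝ}
    (hX : ∀ i, Measurable (X i)) (hZ : ∀ i, Measurable (Z i)) (hA1 : Assumption1 P X Z) :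
    ∃ b Cb G l0 Ca, Std P X Z b Cb G l0 Ca := by
  obtain ⟨β, h0, hβ, hsum⟩ := hA1.mixing
  obtain ⟨b, Cb, hCb, hb, hb0, hbC⟩ := exists_beta h0 hβ hsum
  obtain ⟨a, φ, -, -, -, ⟨f, hf, hfa⟩, hO⟩ := hA1.pned
  obtain ⟨C, hC0, hC⟩ := hO.exists_pos
  rw [Asymptotics.isBigOWith_iff, eventually_atTop] at hC
  obtain ⟨l1, hl1⟩ := hC
  refine ⟨b, Cb, fun l z => ⌊f l z * (l : ℝ) ^ 6⌋, max l1 1, C, hX, hZ, hA1.stationary, hb, hb0, hCb, hbC,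
    fun l => ?_, le_max_right _ _, hC0.le, ?_⟩
  · exact Int.measurable_floor.comp ((hf l).mul_const _)
  · intro l hl
    have hl' : 1 ≤ l := le_trans (le_max_right _ _) hl
    have hl2 : l1 ≤ l := le_trans (le_max_left _ _) hl
    have hlp : (0 : ℝ) < (l : ℝ) ^ 6 := by positivity
    have h1 := hl1 l hl2
    have e6 : (l : ℝ) ^ (-6 : ℤ) = ((l : ℝ) ^ 6)⁻¹ := by
      rw [zpow_neg]; rfl
    rw [e6] at h1
    have h2 := hfa l (((l : ℝ) ^ 6)⁻¹) (by positivity)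
    have h3 : a l * φ (((l : ℝ) ^ 6)⁻¹) ≤ C / (l : ℝ) ^ 6 := by
      refine (le_abs_self _).trans ?_
      rw [Real.norm_eq_abs, Real.norm_eq_abs, abs_of_pos (inv_pos.2 hlp)] at h1
      rwa [div_eq_mul_inv]
    refine le_trans ?_ (h2.trans h3)
    rw [Measure.real]
    refine ENNReal.toReal_mono (measure_ne_top _ _) (measure_mono ?_)
    intro ω hω
    simp only [mem_setOf_eq, Nw, zero_add] at hω ⊢
    by_contra hcon
    push Not at hcon
    set F := f l fun i => Z (((i : ℕ) : ℤ) - (l : ℤ)) ω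
    have k1 : |X 0 ω * (l : ℝ) ^ 6 - F * (l : ℝ) ^ 6| ≤ 1 := by
      rw [← sub_mul, abs_mul, abs_of_pos hlp]
      calc _ ≤ ((l : ℝ) ^ 6)⁻¹ * (l : ℝ) ^ 6 := mul_le_mul_of_nonneg_right hcon hlp.le
        _ = 1 := inv_mul_cancel₀ hlp.ne'
    have k2 := Int.floor_le (F * (l : ℝ) ^ 6)
    have k3 := Int.lt_floor_add_one (F * (l : ℝ) ^ 6)
    rw [abs_le] at k1
    have : |X 0 ω * (l : ℝ) ^ 6 - (⌊F * (l : ℝ) ^ 6⌋ : ℤ)| ≤ 2 := by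
      rw [abs_le]; constructor <;> linarith
    linarith

lemma abs_h_sub {h : ℝ → ℝ → ℝ → ℝ} (hker : IsUQKernel h) {M : ℝ} (hM : ∀ x y t, h x y t ≤ M)
    (x y x' y' t : ℝ) : |h x y t - h x' y' t| ≤ M := by
  have := hker.nonneg x y t
  have := hker.nonneg x' y' t
  have := hM x y t
  have := hM x' y' t
  rw [abs_le]; constructor <;> linarith

/-- oscillation of `h` over the ball -/
def osc (h : ℝ → ℝ → ℝ → ℝ) (t ε : ℝ) (q : ℝ × ℝ) : ℝ :=
  ⨆ r ∈ Metric.closedBall q ε, |h r.1 r.2 t - h q.1 q.2 t|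

lemma osc_aux {h : ℝ → ℝ → ℝ → ℝ} (hker : IsUQKernel h) {M : ℝ} (hM : ∀ x y t, h x y t ≤ M)
    (t ε : ℝ) (q r : ℝ × ℝ) :
    (⨆ (_ : r ∈ Metric.closedBall q ε), |h r.1 r.2 t - h q.1 q.2 t|) ≤ M := by
  by_cases hr : r ∈ Metric.closedBall q ε
  · rw [ciSup_pos hr]; exact abs_h_sub hker hM _ _ _ _ _
  · have : IsEmpty (r ∈ Metric.closedBall q ε) := ⟨hr⟩
    rw [Real.iSup_of_isEmpty]
    exact (abs_nonneg _).trans (abs_h_sub hker hM 0 0 0 0 0)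

lemma osc_le {h : ℝ → ℝ → ℝ → ℝ} (hker : IsUQKernel h) {M : ℝ} (hM : ∀ x y t, h x y t ≤ M)
    (t ε : ℝ) (q : ℝ × ℝ) : osc h t ε q ≤ M :=
  ciSup_le fun r => osc_aux hker hM t ε q r

lemma osc_nonneg (h : ℝ → ℝ → ℝ → ℝ)
    (t ε : ℝ) (q : ℝ × ℝ) : 0 ≤ osc h t ε q :=
  Real.iSup_nonneg fun _ => Real.iSup_nonneg fun _ => abs_nonneg _

lemma le_osc {h : ℝ → ℝ → ℝ → ℝ} (hker : IsUQKernel h) {M : ℝ} (hM : ∀ x y t, h x y t ≤ M)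
    (t ε : ℝ) (q r : ℝ × ℝ) (hr : r ∈ Metric.closedBall q ε) :
    |h r.1 r.2 t - h q.1 q.2 t| ≤ osc h t ε q := by
  have h1 : BddAbove (range fun r : ℝ × ℝ =>
      ⨆ (_ : r ∈ Metric.closedBall q ε), |h r.1 r.2 t - h q.1 q.2 t|) :=
    ⟨M, by rintro _ ⟨r, rfl⟩; exact osc_aux hker hM t ε q r⟩
  refine le_trans ?_ (le_ciSup h1 r)
  rw [ciSup_pos hr]

lemma osc_le_osc {h : ℝ → ℝ → ℝ → ℝ} (hker : IsUQKernel h) {M : ℝ} (hM : ∀ x y t, h x y t ≤ M)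
    (t ε ε' : ℝ) (hε : 0 ≤ ε) (q q' : ℝ × ℝ) (hq : dist q' q + ε ≤ ε') :
    osc h t ε q' ≤ 2 * osc h t ε' q := by
  have h0 := osc_nonneg h t ε' q
  refine ciSup_le fun r => ?_
  by_cases hr : r ∈ Metric.closedBall q' ε
  · rw [ciSup_pos hr]
    have k1 := le_osc hker hM t ε' q r (by
      rw [Metric.mem_closedBall] at *
      linarith [dist_triangle r q' q])
    have k2 := le_osc hker hM t ε' q q' (by rw [Metric.mem_closedBall]; linarith)
    rw [abs_le] at *
    constructor <;> linarith [k1.1, k1.2, k2.1, k2.2]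
  · have : IsEmpty (r ∈ Metric.closedBall q' ε) := ⟨hr⟩
    rw [Real.iSup_of_isEmpty]; positivity

/-- grid point -/
def gp (l : ℕ) (a c : ℤ) : ℝ × ℝ := ((a : ℝ) / (l : ℝ) ^ 6, (c : ℝ) / (l : ℝ) ^ 6)

/-- oscillation at grid points -/
def Sg (h : ℝ → ℝ → ℝ → ℝ) (t : ℝ) (l : ℕ) (a c : ℤ) : ℝ := osc h t (2 / (l : ℝ) ^ 6) (gp l a c)

/-- kernel at grid points -/
def HN (h : ℝ → ℝ → ℝ → ℝ) (t : ℝ) (l : ℕ) (a c : ℤ) : ℝ :=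
  h ((a : ℝ) / (l : ℝ) ^ 6) ((c : ℝ) / (l : ℝ) ^ 6) t

lemma near_grid {l : ℕ} (hl : 1 ≤ l) {x k : ℝ} {a : ℤ} (hx : |x * (l : ℝ) ^ 6 - a| ≤ k) :
    |x - (a : ℝ) / (l : ℝ) ^ 6| ≤ k / (l : ℝ) ^ 6 := by
  have hlp : (0 : ℝ) < (l : ℝ) ^ 6 := by positivity
  rw [le_div_iff₀ hlp, ← abs_of_pos hlp, ← abs_mul, abs_of_pos hlp, sub_mul,
    div_mul_cancel₀ _ hlp.ne']
  exact hx

lemma h_sub_HN {h : ℝ → ℝ → ℝ → ℝ} (hker : IsUQKernel h) {M : ℝ} (hM : ∀ x y t, h x y t ≤ M)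
    (t : ℝ) {l : ℕ} (hl : 1 ≤ l) {x y : ℝ} {a c : ℤ} (hx : |x * (l : ℝ) ^ 6 - a| ≤ 2)
    (hy : |y * (l : ℝ) ^ 6 - c| ≤ 2) : |h x y t - HN h t l a c| ≤ Sg h t l a c := by
  refine le_osc hker hM t _ (gp l a c) (x, y) ?_
  rw [Metric.mem_closedBall, Prod.dist_eq, max_le_iff, Real.dist_eq, Real.dist_eq]
  exact ⟨near_grid hl hx, near_grid hl hy⟩

/-- shifted rounding functional -/
def Sr (h : ℝ → ℝ → ℝ → ℝ) (t : ℝ) (l : ℕ) (i j : ℤ) (q : ℝ × ℝ) : ℝ :=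
  Sg h t l (⌊q.1 * (l : ℝ) ^ 6⌋ + i) (⌊q.2 * (l : ℝ) ^ 6⌋ + j)

lemma measurable_Sr (h : ℝ → ℝ → ℝ → ℝ) (t : ℝ) (l : ℕ) (i j : ℤ) : Measurable (Sr h t l i j) := by
  let φ : ℝ × ℝ → ℤ × ℤ := fun q => (⌊q.1 * (l : ℝ) ^ 6⌋, ⌊q.2 * (l : ℝ) ^ 6⌋)
  have hφ : Measurable φ := by
    refine Measurable.prodMk ?_ ?_
    · exact Int.measurable_floor.comp (measurable_fst.mul_const _)
    · exact Int.measurable_floor.comp (measurable_snd.mul_const _)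
  let ψ : ℤ × ℤ → ℝ := fun n => Sg h t l (n.1 + i) (n.2 + j)
  have hψ : Measurable ψ := measurable_of_countable _
  have e : Sr h t l i j = ψ ∘ φ := by
    funext q
    simp only [Function.comp, Sr, ψ, φ]
  rw [e]
  exact hψ.comp hφ

lemma floor_near {x : ℝ} {i : ℤ} (hi : |i| ≤ 2) : |x - ((⌊x⌋ + i : ℤ) : ℝ)| ≤ 3 := by
  have k2 := Int.floor_le x
  have k3 := Int.lt_floor_add_one x
  have hi' : |(i : ℝ)| ≤ 2 := by exact_mod_cast hi
  rw [abs_le] at *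
  push_cast
  constructor <;> linarith [hi'.1, hi'.2]

lemma Sr_le {h : ℝ → ℝ → ℝ → ℝ} (hker : IsUQKernel h) {M : ℝ} (hM : ∀ x y t, h x y t ≤ M)
    (t : ℝ) {l : ℕ} (hl : 1 ≤ l) {i j : ℤ} (hi : |i| ≤ 2) (hj : |j| ≤ 2) (q : ℝ × ℝ) :
    Sr h t l i j q ≤ 2 * osc h t (5 / (l : ℝ) ^ 6) q := by
  refine osc_le_osc hker hM t _ _ (by positivity) q _ ?_
  have hlp : (0 : ℝ) < (l : ℝ) ^ 6 := by positivity
  have : dist (gp l (⌊q.1 * (l : ℝ) ^ 6⌋ + i) (⌊q.2 * (l : ℝ) ^ 6⌋ + j)) q ≤ 3 / (l : ℝ) ^ 6 := by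
    rw [dist_comm, Prod.dist_eq, max_le_iff, Real.dist_eq, Real.dist_eq]
    exact ⟨near_grid hl (floor_near hi), near_grid hl (floor_near hj)⟩
  calc _ ≤ 3 / (l : ℝ) ^ 6 + 2 / (l : ℝ) ^ 6 := by gcongr
    _ = _ := by ring

lemma integral_Sr_sq {μ : Measure ℝ} [IsProbabilityMeasure μ]
    {h : ℝ → ℝ → ℝ → ℝ} (hker : IsUQKernel h) {M : ℝ} (hM : ∀ x y t, h x y t ≤ M)
    {L t : ℝ} (hL : 0 ≤ L) (hv : VariationAt μ h L t) {l : ℕ} (hl : 1 ≤ l) {i j : ℤ} (hi : |i| ≤ 2)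
    (hj : |j| ≤ 2) : ∫ q, Sr h t l i j q ^ 2 ∂(μ.prod μ) ≤ 20 * L / (l : ℝ) ^ 6 := by
  have hlp : (0 : ℝ) < (l : ℝ) ^ 6 := by positivity
  rw [integral_eq_lintegral_of_nonneg_ae (Eventually.of_forall fun _ => sq_nonneg _)
    ((measurable_Sr h t l i j).pow_const 2).aestronglyMeasurable]
  refine ENNReal.toReal_le_of_le_ofReal (by positivity) ?_
  calc ∫⁻ q, ENNReal.ofReal (Sr h t l i j q ^ 2) ∂(μ.prod μ)
      ≤ ∫⁻ q, ENNReal.ofReal 4 * ENNReal.ofReal (osc h t (5 / (l : ℝ) ^ 6) q ^ 2) ∂(μ.prod μ) := by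
        refine lintegral_mono fun q => ?_
        rw [← ENNReal.ofReal_mul (by norm_num)]
        refine ENNReal.ofReal_le_ofReal ?_
        have h1 := Sr_le hker hM t hl hi hj q
        have h2 : 0 ≤ Sr h t l i j q := osc_nonneg _ _ _ _
        nlinarith
    _ = ENNReal.ofReal 4 * ∫⁻ q, ENNReal.ofReal (osc h t (5 / (l : ℝ) ^ 6) q ^ 2) ∂(μ.prod μ) :=
        lintegral_const_mul' _ _ ENNReal.ofReal_ne_top
    _ ≤ ENNReal.ofReal 4 * ENNReal.ofReal (L * (5 / (l : ℝ) ^ 6)) := by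
        gcongr
        exact hv _ (by positivity)
    _ = ENNReal.ofReal (20 * L / (l : ℝ) ^ 6) := by
        rw [← ENNReal.ofReal_mul (by norm_num)]; congr 1; ring

end UQuantile

namespace UQuantile

variable {Ω : Type*} [MeasurableSpace Ω]

lemma int_bdd {α : Type*} [MeasurableSpace α] {μ : Measure α} [IsFiniteMeasure μ] {f : α → ℝ}
    (hf : Measurable f) {M : ℝ} (hM : ∀ x, |f x| ≤ M) : Integrable f μ :=
  Integrable.of_bound hf.aestronglyMeasurable M (Eventually.of_forall hM)

lemma abs_int_le {α : Type*} [MeasurableSpace α] {μ : Measure α} [IsProbabilityMeasure μ] {f : α → ℝ}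
    {M : ℝ} (hM : ∀ x, |f x| ≤ M) : |∫ x, f x ∂μ| ≤ M := by
  have := norm_integral_le_of_norm_le_const (μ := μ) (f := f) (C := M) (Eventually.of_forall hM)
  simpa using this

lemma meas_ZZ {α : Type*} [MeasurableSpace α] (F : ℤ → ℤ → ℝ) {f g : α → ℤ}
    (hf : Measurable f) (hg : Measurable g) : Measurable fun q => F (f q) (g q) := by
  let ψ : ℤ × ℤ → ℝ := fun n => F n.1 n.2
  have hψ : Measurable ψ := measurable_of_countable _
  exact hψ.comp (hf.prodMk hg)

/-- the bad event -/
def bad (X Z : ℤ → Ω → ℝ) {l : ℕ} (G : (Fin (2 * l + 1) → ℝ) → ℤ) (i : ℤ) : Set Ω :=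
  {ω | 2 < |X i ω * (l : ℝ) ^ 6 - Nw Z G i ω|}

section
variable {P : Measure Ω} [IsProbabilityMeasure P] {X Z : ℤ → Ω → ℝ} {b : ℕ → ℝ} {Cb : ℝ}
    {G : (l : ℕ) → (Fin (2 * l + 1) → ℝ) → ℤ} {l0 : ℕ} {Ca : ℝ}

lemma Std.hN (S : Std P X Z b Cb G l0 Ca) (l : ℕ) (i : ℤ) : Measurable (Nw Z (G l) i) :=
  measurable_Nw S.hZ (S.hG l) i

lemma Std.hbad (S : Std P X Z b Cb G l0 Ca) (l : ℕ) (i : ℤ) : MeasurableSet (bad X Z (G l) i) := by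
  have h1 : Measurable fun ω => ((Nw Z (G l) i ω : ℤ) : ℝ) :=
    (measurable_of_countable (fun n : ℤ => (n : ℝ))).comp (S.hN l i)
  exact measurableSet_lt measurable_const (((S.hX i).mul_const _).sub h1).abs

lemma Std.bad_le (S : Std P X Z b Cb G l0 Ca) {l : ℕ} (hl : l0 ≤ l) (i : ℤ) :
    P.real (bad X Z (G l) i) ≤ Ca / (l : ℝ) ^ 6 := by
  have key : ∀ i, P.real (bad X Z (G l) i) = ∫ ω, (fun (x : ℝ) (n : ℤ) =>
      ({q : ℝ × ℤ | 2 < |q.1 * (l : ℝ) ^ 6 - q.2|}.indicator (fun _ => (1 : ℝ)) (x, n)))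
        (X i ω) (Nw Z (G l) i ω) ∂P := by
    intro i
    rw [← integral_indicator_one (S.hbad l i)]
    rfl
  have hm : Measurable (Function.uncurry fun (x : ℝ) (n : ℤ) =>
      ({q : ℝ × ℤ | 2 < |q.1 * (l : ℝ) ^ 6 - q.2|}.indicator (fun _ => (1 : ℝ)) (x, n))) := by
    have hs : MeasurableSet {q : ℝ × ℤ | 2 < |q.1 * (l : ℝ) ^ 6 - q.2|} := by
      have h1 : Measurable fun q : ℝ × ℤ => (q.2 : ℝ) :=
        (measurable_of_countable (fun n : ℤ => (n : ℝ))).comp measurable_snd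
      exact measurableSet_lt measurable_const ((measurable_fst.mul_const _).sub h1).abs
    exact (measurable_const.indicator hs)
  rw [key i, stat_XN1 S.hX S.hZ S.hs (S.hG l) i hm, ← key 0]
  exact S.app l hl

lemma Std.stat_NN (S : Std P X Z b Cb G l0 Ca) (l : ℕ) (i j : ℤ) (F : ℤ → ℤ → ℝ) :
    ∫ ω, ∫ ω', F (Nw Z (G l) i ω) (Nw Z (G l) j ω') ∂P ∂P
      = ∫ ω, ∫ ω', F (Nw Z (G l) 0 ω) (Nw Z (G l) 0 ω') ∂P ∂P := by
  have h1 : ∀ a, ∫ ω', F a (Nw Z (G l) j ω') ∂P = ∫ ω', F a (Nw Z (G l) 0 ω') ∂P := fun a =>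
    stat_XN1 S.hX S.hZ S.hs (S.hG l) j (F := fun _ n => F a n)
      ((measurable_of_countable (F a)).comp measurable_snd)
  simp only [h1]
  exact stat_XN1 S.hX S.hZ S.hs (S.hG l) i (F := fun _ n => ∫ ω', F n (Nw Z (G l) 0 ω') ∂P)
      ((measurable_of_countable (fun n => ∫ ω', F n (Nw Z (G l) 0 ω') ∂P)).comp measurable_snd)

/-- pair decoupling -/
lemma Std.decouple2 (S : Std P X Z b Cb G l0 Ca) (l : ℕ) {i j : ℤ} (hij : i + 2 * l < j)
    (F : ℤ → ℤ → ℝ) {M : ℝ} (hF : ∀ a c, |F a c| ≤ M) :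
    |∫ ω, F (Nw Z (G l) i ω) (Nw Z (G l) j ω) ∂P
      - ∫ ω, ∫ ω', F (Nw Z (G l) 0 ω) (Nw Z (G l) 0 ω') ∂P ∂P| ≤ 2 * M * b (j - i - 2 * l).toNat := by
  have := decouple S.hX S.hZ S.hs S.hβ (S.hG l) (fun b : Bool => if b then i else j)
    (fun b => b = true) (i + l) (j - i - 2 * l).toNat (by intro b hb; simp [hb])
    (by intro b hb; simp at hb; subst hb; simp; omega) (fun x => F (x true) (x false)) (fun x => hF _ _)
  simp only [if_true, Bool.false_eq_true, if_false] at this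
  rwa [S.stat_NN l i j F] at this

lemma Std.integral_prod_X (S : Std P X Z b Cb G l0 Ca) {F : ℝ × ℝ → ℝ} (hF : Measurable F) :
    ∫ q : Ω × Ω, F (X 0 q.1, X 0 q.2) ∂(P.prod P) = ∫ q, F q ∂((P.map (X 0)).prod (P.map (X 0))) := by
  rw [Measure.map_prod_map _ _ (S.hX 0) (S.hX 0), integral_map]
  · rfl
  · exact ((S.hX 0).prodMap (S.hX 0)).aemeasurable
  · exact hF.aestronglyMeasurable

lemma Std.isProb (S : Std P X Z b Cb G l0 Ca) : IsProbabilityMeasure (P.map (X 0)) :=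
  Measure.isProbabilityMeasure_map (S.hX 0).aemeasurable

lemma Sg_nonneg (h : ℝ → ℝ → ℝ → ℝ) (t : ℝ) (l : ℕ) (a c : ℤ) : 0 ≤ Sg h t l a c := osc_nonneg _ _ _ _

lemma Sg_le {h : ℝ → ℝ → ℝ → ℝ} (hker : IsUQKernel h) {M : ℝ} (hM : ∀ x y t, h x y t ≤ M)
    (t : ℝ) (l : ℕ) (a c : ℤ) : Sg h t l a c ≤ M := osc_le hker hM _ _ _

lemma grid_round {x : ℝ} {n : ℤ} (hx : |x - n| ≤ 2) : n - ⌊x⌋ ∈ Finset.Icc (-2 : ℤ) 2 := by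
  rw [abs_le] at hx
  have h1 : n - 2 ≤ ⌊x⌋ := Int.le_floor.2 (by push_cast; linarith [hx.1])
  have h2 : ⌊x⌋ < n + 3 := Int.floor_lt.2 (by push_cast; linarith [hx.2])
  simp only [Finset.mem_Icc]; omega

lemma Std.Sg_sq (S : Std P X Z b Cb G l0 Ca) {h : ℝ → ℝ → ℝ → ℝ} (hker : IsUQKernel h) {M : ℝ}
    (hM : ∀ x y t, h x y t ≤ M) {L t : ℝ} (hL : 0 ≤ L) (hv : VariationAt (P.map (X 0)) h L t)
    {l : ℕ} (hl : l0 ≤ l) :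
    ∫ q : Ω × Ω, Sg h t l (Nw Z (G l) 0 q.1) (Nw Z (G l) 0 q.2) ^ 2 ∂(P.prod P)
      ≤ (500 * L + 2 * M ^ 2 * Ca) / (l : ℝ) ^ 6 := by
  have hl1 : 1 ≤ l := S.l01.trans hl
  have hp := S.isProb
  have M0 : 0 ≤ M := (hker.nonneg 0 0 0).trans (hM 0 0 0)
  have SM := Sg_le hker hM t l
  have S0 := Sg_nonneg h t l
  have mS : ∀ i j : ℤ, Measurable fun q : Ω × Ω => Sr h t l i j (X 0 q.1, X 0 q.2) ^ 2 := fun i j =>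
    ((measurable_Sr h t l i j).comp (((S.hX 0).comp measurable_fst).prodMk
      ((S.hX 0).comp measurable_snd))).pow_const 2
  have iS : ∀ i j : ℤ, Integrable (fun q : Ω × Ω => Sr h t l i j (X 0 q.1, X 0 q.2) ^ 2) (P.prod P) :=
    fun i j => int_bdd (mS i j) (M := M ^ 2) fun q => by
      rw [abs_of_nonneg (sq_nonneg _)]; exact pow_le_pow_left₀ (S0 _ _) (SM _ _) 2
  have mI : ∀ k : Ω × Ω → Ω, Measurable k → Measurable fun q : Ω × Ω =>
      (bad X Z (G l) 0).indicator (1 : Ω → ℝ) (k q) := fun k hk =>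
    (measurable_one.indicator (S.hbad l 0)).comp hk
  have iI : ∀ k : Ω × Ω → Ω, Measurable k → Integrable (fun q : Ω × Ω =>
      M ^ 2 * (bad X Z (G l) 0).indicator (1 : Ω → ℝ) (k q)) (P.prod P) := fun k hk =>
    (int_bdd (mI k hk) (M := 1) fun q => by
      by_cases hq : k q ∈ bad X Z (G l) 0 <;> simp [hq]).const_mul _
  have hpt : ∀ q : Ω × Ω, Sg h t l (Nw Z (G l) 0 q.1) (Nw Z (G l) 0 q.2) ^ 2 ≤
      (∑ i ∈ Finset.Icc (-2 : ℤ) 2, ∑ j ∈ Finset.Icc (-2 : ℤ) 2, Sr h t l i j (X 0 q.1, X 0 q.2) ^ 2)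
      + (M ^ 2 * (bad X Z (G l) 0).indicator (1 : Ω → ℝ) q.1
        + M ^ 2 * (bad X Z (G l) 0).indicator (1 : Ω → ℝ) q.2) := by
    intro q
    have n1 : 0 ≤ ∑ i ∈ Finset.Icc (-2 : ℤ) 2, ∑ j ∈ Finset.Icc (-2 : ℤ) 2,
        Sr h t l i j (X 0 q.1, X 0 q.2) ^ 2 :=
      Finset.sum_nonneg fun _ _ => Finset.sum_nonneg fun _ _ => sq_nonneg _
    have n2 : ∀ ω, 0 ≤ M ^ 2 * (bad X Z (G l) 0).indicator (1 : Ω → ℝ) ω := fun ω =>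
      mul_nonneg (sq_nonneg _) (indicator_nonneg (fun _ _ => zero_le_one) _)
    have n3 : Sg h t l (Nw Z (G l) 0 q.1) (Nw Z (G l) 0 q.2) ^ 2 ≤ M ^ 2 :=
      pow_le_pow_left₀ (S0 _ _) (SM _ _) 2
    by_cases h1 : q.1 ∈ bad X Z (G l) 0
    · have := n2 q.2
      simp only [h1, indicator_of_mem, Pi.one_apply] at *
      linarith
    by_cases h2 : q.2 ∈ bad X Z (G l) 0
    · have := n2 q.1
      simp only [h2, indicator_of_mem, Pi.one_apply] at *
      linarith
    have g1 : |X 0 q.1 * (l : ℝ) ^ 6 - Nw Z (G l) 0 q.1| ≤ 2 := not_lt.1 h1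
    have g2 : |X 0 q.2 * (l : ℝ) ^ 6 - Nw Z (G l) 0 q.2| ≤ 2 := not_lt.1 h2
    have e : Sg h t l (Nw Z (G l) 0 q.1) (Nw Z (G l) 0 q.2) =
      Sr h t l (Nw Z (G l) 0 q.1 - ⌊X 0 q.1 * (l : ℝ) ^ 6⌋)
        (Nw Z (G l) 0 q.2 - ⌊X 0 q.2 * (l : ℝ) ^ 6⌋) (X 0 q.1, X 0 q.2) := by
      simp only [Sr, add_sub_cancel]
    have := n2 q.1
    have := n2 q.2
    refine le_trans ?_ (le_add_of_nonneg_right (by linarith))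
    rw [e]
    refine le_trans ?_ (Finset.single_le_sum (f := fun i => ∑ j ∈ Finset.Icc (-2 : ℤ) 2,
      Sr h t l i j (X 0 q.1, X 0 q.2) ^ 2)
      (fun _ _ => Finset.sum_nonneg fun _ _ => sq_nonneg _) (grid_round g1))
    exact Finset.single_le_sum (f := fun j => Sr h t l (Nw Z (G l) 0 q.1 - ⌊X 0 q.1 * (l : ℝ) ^ 6⌋) j
      (X 0 q.1, X 0 q.2) ^ 2) (fun _ _ => sq_nonneg _) (grid_round g2)
  have eI : ∀ k : Ω × Ω → Ω, (k = Prod.fst ∨ k = Prod.snd) → ∫ q : Ω × Ω,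
      M ^ 2 * (bad X Z (G l) 0).indicator (1 : Ω → ℝ) (k q) ∂(P.prod P) ≤ M ^ 2 * (Ca / (l : ℝ) ^ 6) := by
    intro k hk
    rw [integral_const_mul]
    refine mul_le_mul_of_nonneg_left ?_ (sq_nonneg _)
    have hmp : MeasurePreserving k (P.prod P) P := by
      rcases hk with rfl | rfl
      · exact measurePreserving_fst
      · exact measurePreserving_snd
    have : ∫ q : Ω × Ω, (bad X Z (G l) 0).indicator (1 : Ω → ℝ) (k q) ∂(P.prod P)
        = ∫ ω, (bad X Z (G l) 0).indicator (1 : Ω → ℝ) ω ∂P := by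
      rw [← hmp.map_eq, integral_map hmp.measurable.aemeasurable
        (measurable_one.indicator (S.hbad l 0)).aestronglyMeasurable, hmp.map_eq]
    rw [this, integral_indicator_one (S.hbad l 0)]
    exact S.bad_le hl 0
  have mSg : Measurable fun q : Ω × Ω => Sg h t l (Nw Z (G l) 0 q.1) (Nw Z (G l) 0 q.2) :=
    meas_ZZ (Sg h t l) ((S.hN l 0).comp measurable_fst) ((S.hN l 0).comp measurable_snd)
  calc _ ≤ ∫ q : Ω × Ω, ((∑ i ∈ Finset.Icc (-2 : ℤ) 2, ∑ j ∈ Finset.Icc (-2 : ℤ) 2,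
        Sr h t l i j (X 0 q.1, X 0 q.2) ^ 2) + (M ^ 2 * (bad X Z (G l) 0).indicator (1 : Ω → ℝ) q.1
        + M ^ 2 * (bad X Z (G l) 0).indicator (1 : Ω → ℝ) q.2)) ∂(P.prod P) := by
        refine integral_mono ?_ ?_ hpt
        · exact int_bdd (mSg.pow_const 2) (M := M ^ 2) fun q => by
            rw [abs_of_nonneg (sq_nonneg _)]; exact pow_le_pow_left₀ (S0 _ _) (SM _ _) 2
        · exact (integrable_finsetSum _ fun i _ => integrable_finsetSum _ fun j _ => iS i j).add
            ((iI _ measurable_fst).add (iI _ measurable_snd))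
    _ = (∑ i ∈ Finset.Icc (-2 : ℤ) 2, ∑ j ∈ Finset.Icc (-2 : ℤ) 2,
          ∫ q : Ω × Ω, Sr h t l i j (X 0 q.1, X 0 q.2) ^ 2 ∂(P.prod P))
        + (∫ q : Ω × Ω, M ^ 2 * (bad X Z (G l) 0).indicator (1 : Ω → ℝ) q.1 ∂(P.prod P)
          + ∫ q : Ω × Ω, M ^ 2 * (bad X Z (G l) 0).indicator (1 : Ω → ℝ) q.2 ∂(P.prod P)) := by
        have i3 : Integrable (fun q : Ω × Ω => M ^ 2 * (bad X Z (G l) 0).indicator (1 : Ω → ℝ) q.1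
          + M ^ 2 * (bad X Z (G l) 0).indicator (1 : Ω → ℝ) q.2) (P.prod P) :=
          (iI _ measurable_fst).add (iI _ measurable_snd)
        rw [integral_add (integrable_finsetSum _ fun i _ => integrable_finsetSum _ fun j _ => iS i j) i3,
          integral_add (iI _ measurable_fst) (iI _ measurable_snd),
          integral_finsetSum _ fun i _ => integrable_finsetSum _ fun j _ => iS i j]
        congr 1
        refine Finset.sum_congr rfl fun i _ => ?_
        rw [integral_finsetSum _ fun j _ => iS i j]
    _ ≤ (∑ i ∈ Finset.Icc (-2 : ℤ) 2, ∑ j ∈ Finset.Icc (-2 : ℤ) 2, 20 * L / (l : ℝ) ^ 6)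
        + (M ^ 2 * (Ca / (l : ℝ) ^ 6) + M ^ 2 * (Ca / (l : ℝ) ^ 6)) := by
        refine add_le_add (Finset.sum_le_sum fun i hi => Finset.sum_le_sum fun j hj => ?_)
          (add_le_add (eI _ (Or.inl rfl)) (eI _ (Or.inr rfl)))
        rw [S.integral_prod_X (F := fun q => Sr h t l i j q ^ 2) ((measurable_Sr h t l i j).pow_const 2)]
        rw [Finset.mem_Icc, ← abs_le] at hi hj
        exact integral_Sr_sq hker hM hL hv hl1 hi hj
    _ = _ := by
        have : (((2 : ℤ) + 1 - (-2)).toNat : ℝ) = 5 := by norm_num; rfl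
        simp only [Finset.sum_const, Int.card_Icc, nsmul_eq_mul, this]
        ring

lemma Std.Sg_int (S : Std P X Z b Cb G l0 Ca) {h : ℝ → ℝ → ℝ → ℝ} (hker : IsUQKernel h) {M : ℝ}
    (hM : ∀ x y t, h x y t ≤ M) {L t : ℝ} (hL : 0 ≤ L) (hv : VariationAt (P.map (X 0)) h L t)
    {l : ℕ} (hl : l0 ≤ l) :
    ∫ q : Ω × Ω, Sg h t l (Nw Z (G l) 0 q.1) (Nw Z (G l) 0 q.2) ∂(P.prod P)
      ≤ (500 * L + 2 * M ^ 2 * Ca + 1) / (l : ℝ) ^ 3 := by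
  have hl1 : 1 ≤ l := S.l01.trans hl
  have hlp : (0 : ℝ) < (l : ℝ) ^ 3 := by positivity
  have SM := Sg_le hker hM t l
  have S0 := Sg_nonneg h t l
  have mSg : Measurable fun q : Ω × Ω => Sg h t l (Nw Z (G l) 0 q.1) (Nw Z (G l) 0 q.2) :=
    meas_ZZ (Sg h t l) ((S.hN l 0).comp measurable_fst) ((S.hN l 0).comp measurable_snd)
  have i2 : Integrable (fun q : Ω × Ω => Sg h t l (Nw Z (G l) 0 q.1) (Nw Z (G l) 0 q.2) ^ 2) (P.prod P) :=
    int_bdd (mSg.pow_const 2) (M := M ^ 2) fun q => by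
            rw [abs_of_nonneg (sq_nonneg _)]; exact pow_le_pow_left₀ (S0 _ _) (SM _ _) 2
  calc _ ≤ ∫ q : Ω × Ω, ((l : ℝ) ^ 3 * Sg h t l (Nw Z (G l) 0 q.1) (Nw Z (G l) 0 q.2) ^ 2
          + 1 / (l : ℝ) ^ 3) ∂(P.prod P) := by
        refine integral_mono ?_ ((i2.const_mul _).add (integrable_const _)) fun q => ?_
        · exact int_bdd mSg (M := M) fun q => by rw [abs_of_nonneg (S0 _ _)]; exact SM _ _
        · generalize Sg h t l (Nw Z (G l) 0 q.1) (Nw Z (G l) 0 q.2) = s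
          have : 0 ≤ (l : ℝ) ^ 3 * s ^ 2 + 1 / (l : ℝ) ^ 3 - s := by
            have e : (l : ℝ) ^ 3 * s ^ 2 + 1 / (l : ℝ) ^ 3 - s
              = ((((l : ℝ) ^ 3) * s - 1 / 2) ^ 2 + 3 / 4) / (l : ℝ) ^ 3 := by
              field_simp; ring
            rw [e]; positivity
          show s ≤ (l : ℝ) ^ 3 * s ^ 2 + 1 / (l : ℝ) ^ 3
          linarith
    _ = (l : ℝ) ^ 3 * (∫ q : Ω × Ω, Sg h t l (Nw Z (G l) 0 q.1) (Nw Z (G l) 0 q.2) ^ 2 ∂(P.prod P))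
          + 1 / (l : ℝ) ^ 3 := by
        rw [integral_add (i2.const_mul _) (integrable_const _), integral_const_mul]
        simp
    _ ≤ (l : ℝ) ^ 3 * ((500 * L + 2 * M ^ 2 * Ca) / (l : ℝ) ^ 6) + 1 / (l : ℝ) ^ 3 := by
        gcongr
        exact S.Sg_sq hker hM hL hv hl
    _ = _ := by field_simp

end
end UQuantile

namespace UQuantile

variable {Ω : Type*} [MeasurableSpace Ω]

/-- projected mean of a grid kernel -/
def UN (P : Measure Ω) (N : Ω → ℤ) (F : ℤ → ℤ → ℝ) : ℝ := ∫ ω, ∫ ω', F (N ω) (N ω') ∂P ∂P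

/-- linear part of a grid kernel -/
def FN1 (P : Measure Ω) (N : Ω → ℤ) (F : ℤ → ℤ → ℝ) (a : ℤ) : ℝ := (∫ ω', F a (N ω') ∂P) - UN P N F

/-- degenerate part of a grid kernel -/
def KN (P : Measure Ω) (N : Ω → ℤ) (F : ℤ → ℤ → ℝ) (a c : ℤ) : ℝ :=
  F a c - FN1 P N F a - FN1 P N F c - UN P N F

lemma diff_le {a c M : ℝ} (ha : 0 ≤ a) (ha' : a ≤ M) (hc : 0 ≤ c) (hc' : c ≤ M) : |a - c| ≤ M := by
  rw [abs_le]; constructor <;> linarith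

lemma int_mem {P : Measure Ω} [IsProbabilityMeasure P] {f : Ω → ℝ} {M : ℝ} (hf : Measurable f)
    (h0 : ∀ ω, 0 ≤ f ω) (h1 : ∀ ω, f ω ≤ M) : 0 ≤ ∫ ω, f ω ∂P ∧ ∫ ω, f ω ∂P ≤ M := by
  refine ⟨integral_nonneg h0, ?_⟩
  have i1 : Integrable f P := int_bdd hf (M := M) fun ω => by rw [abs_of_nonneg (h0 ω)]; exact h1 ω
  calc _ ≤ ∫ _, M ∂P := integral_mono i1 (integrable_const _) h1
    _ = M := by simp

section gk
variable {P : Measure Ω} [IsProbabilityMeasure P] {N : Ω → ℤ} {F : ℤ → ℤ → ℝ} {M : ℝ}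

lemma FN_in (hN : Measurable N) (F0 : ∀ a c, 0 ≤ F a c) (FM : ∀ a c, F a c ≤ M)
    (a : ℤ) : 0 ≤ ∫ ω', F a (N ω') ∂P ∧ ∫ ω', F a (N ω') ∂P ≤ M :=
  int_mem ((measurable_of_countable (F a)).comp hN) (fun _ => F0 _ _) (fun _ => FM _ _)

lemma UN_in (hN : Measurable N) (F0 : ∀ a c, 0 ≤ F a c) (FM : ∀ a c, F a c ≤ M)
    : 0 ≤ UN P N F ∧ UN P N F ≤ M :=
  int_mem ((measurable_of_countable (fun a => ∫ ω', F a (N ω') ∂P)).comp hN)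
    (fun _ => (FN_in hN F0 FM _).1) (fun _ => (FN_in hN F0 FM _).2)

lemma FN1_abs (hN : Measurable N) (F0 : ∀ a c, 0 ≤ F a c) (FM : ∀ a c, F a c ≤ M)
    (a : ℤ) : |FN1 P N F a| ≤ M :=
  diff_le (FN_in hN F0 FM a).1 (FN_in hN F0 FM a).2 (UN_in hN F0 FM).1 (UN_in hN F0 FM).2

lemma KN_abs (hN : Measurable N) (F0 : ∀ a c, 0 ≤ F a c) (FM : ∀ a c, F a c ≤ M)
    (a c : ℤ) : |KN P N F a c| ≤ 3 * M := by
  have h1 := diff_le (F0 a c) (FM a c) (UN_in (P := P) hN F0 FM).1 (UN_in (P := P) hN F0 FM).2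
  have h2 := FN1_abs (P := P) hN F0 FM a
  have h3 := FN1_abs (P := P) hN F0 FM c
  unfold KN
  rw [abs_le] at *
  constructor <;> linarith [h1.1, h2.1, h3.1, h1.2, h2.2, h3.2]

lemma FN1_int (hN : Measurable N) (F0 : ∀ a c, 0 ≤ F a c) (FM : ∀ a c, F a c ≤ M)
    : ∫ ω, FN1 P N F (N ω) ∂P = 0 := by
  have hm : Measurable fun ω => ∫ ω', F (N ω) (N ω') ∂P :=
    (measurable_of_countable (fun a => ∫ ω', F a (N ω') ∂P)).comp hN
  unfold FN1
  rw [integral_sub (int_bdd hm (M := M) fun ω => by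
    rw [abs_of_nonneg (FN_in hN F0 FM _).1]; exact (FN_in hN F0 FM _).2) (integrable_const _)]
  simp [UN]

lemma KN_int (hN : Measurable N) (F0 : ∀ a c, 0 ≤ F a c) (FM : ∀ a c, F a c ≤ M)
    (a : ℤ) : ∫ ω, KN P N F a (N ω) ∂P = 0 := by
  have i1 : Integrable (fun ω => F a (N ω)) P := int_bdd ((measurable_of_countable (F a)).comp hN)
    (M := M) fun ω => by rw [abs_of_nonneg (F0 _ _)]; exact FM _ _
  have i2 : Integrable (fun ω => FN1 P N F (N ω)) P :=
    int_bdd ((measurable_of_countable (FN1 P N F)).comp hN) (M := M) fun ω => FN1_abs hN F0 FM _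
  have i3 : Integrable (fun ω => F a (N ω) - FN1 P N F a) P := i1.sub (integrable_const _)
  have i4 : Integrable (fun ω => F a (N ω) - FN1 P N F a - FN1 P N F (N ω)) P := i3.sub i2
  unfold KN
  rw [integral_sub i4 (integrable_const _), integral_sub i3 i2, integral_sub i1 (integrable_const _),
    FN1_int hN F0 FM]
  simp [FN1]

lemma KN_symm (hs : ∀ a c, F a c = F c a) (a c : ℤ) : KN P N F a c = KN P N F c a := by
  unfold KN; rw [hs a c]; ring
end gk

section
variable {P : Measure Ω} [IsProbabilityMeasure P] {X Z : ℤ → Ω → ℝ} {b : ℕ → ℝ} {Cb : ℝ}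
    {G : (l : ℕ) → (Fin (2 * l + 1) → ℝ) → ℤ} {l0 : ℕ} {Ca : ℝ}
    {h : ℝ → ℝ → ℝ → ℝ} {M : ℝ}

lemma HN_nonneg (hker : IsUQKernel h) (t : ℝ) (l : ℕ) (a c : ℤ) : 0 ≤ HN h t l a c := hker.nonneg _ _ _
lemma HN_le (hM : ∀ x y t, h x y t ≤ M) (t : ℝ) (l : ℕ) (a c : ℤ) : HN h t l a c ≤ M := hM _ _ _

lemma meas_h (hker : IsUQKernel h) (t : ℝ) {α : Type*} [MeasurableSpace α] {f g : α → ℝ}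
    (hf : Measurable f) (hg : Measurable g) : Measurable fun q => h (f q) (g q) t :=
  hker.measurable.comp (hf.prodMk (hg.prodMk measurable_const))

lemma pt_approx (hker : IsUQKernel h) (hM : ∀ x y t, h x y t ≤ M) (t : ℝ) {l : ℕ} (hl : 1 ≤ l)
    (i j : ℤ) (ω ω' : Ω) :
    |h (X i ω) (X j ω') t - HN h t l (Nw Z (G l) i ω) (Nw Z (G l) j ω')| ≤
      Sg h t l (Nw Z (G l) i ω) (Nw Z (G l) j ω')
      + M * (bad X Z (G l) i).indicator (1 : Ω → ℝ) ω + M * (bad X Z (G l) j).indicator (1 : Ω → ℝ) ω' := by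
  have M0 : 0 ≤ M := (hker.nonneg 0 0 0).trans (hM 0 0 0)
  have n2 : ∀ i ω, 0 ≤ M * (bad X Z (G l) i).indicator (1 : Ω → ℝ) ω := fun i ω =>
      mul_nonneg M0 (indicator_nonneg (fun _ _ => zero_le_one) _)
  have n3 := Sg_nonneg h t l (Nw Z (G l) i ω) (Nw Z (G l) j ω')
  have n4 : |h (X i ω) (X j ω') t - HN h t l (Nw Z (G l) i ω) (Nw Z (G l) j ω')| ≤ M :=
    abs_h_sub hker hM _ _ _ _ _
  have := n2 i ω
  have := n2 j ω'
  by_cases h1 : ω ∈ bad X Z (G l) i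
  · simp only [h1, indicator_of_mem, Pi.one_apply] at *
    linarith
  by_cases h2 : ω' ∈ bad X Z (G l) j
  · simp only [h2, indicator_of_mem, Pi.one_apply] at *
    linarith
  have := h_sub_HN hker hM t hl (not_lt.1 h1) (not_lt.1 h2)
  linarith

/-- the approximation constant -/
def CA (L M Ca : ℝ) : ℝ := 500 * L + 2 * M ^ 2 * Ca + 1 + 2 * M * Ca + 2 * M

lemma bad_term (S : Std P X Z b Cb G l0 Ca) (M0 : 0 ≤ M) {l : ℕ} (hl : l0 ≤ l) (i : ℤ) :
    Integrable (fun ω => M * (bad X Z (G l) i).indicator (1 : Ω → ℝ) ω) P ∧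
    ∫ ω, M * (bad X Z (G l) i).indicator (1 : Ω → ℝ) ω ∂P ≤ M * (Ca / (l : ℝ) ^ 3) := by
  refine ⟨((integrable_const (1 : ℝ)).indicator (S.hbad l i)).const_mul _, ?_⟩
  rw [integral_const_mul, integral_indicator_one (S.hbad l i)]
  refine mul_le_mul_of_nonneg_left ((S.bad_le hl i).trans ?_) M0
  have : (1 : ℝ) ≤ l := by exact_mod_cast S.l01.trans hl
  have := S.Ca0
  gcongr
  · norm_num

lemma Std.CA_nonneg (S : Std P X Z b Cb G l0 Ca) {L : ℝ} (hL : 0 ≤ L) (M0 : 0 ≤ M) : 0 ≤ CA L M Ca := by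
  have := S.Ca0
  unfold CA; positivity

lemma Std.approxB (S : Std P X Z b Cb G l0 Ca) (hker : IsUQKernel h)
    (hM : ∀ x y t, h x y t ≤ M) {L t : ℝ} (hL : 0 ≤ L) (hv : VariationAt (P.map (X 0)) h L t)
    {l : ℕ} (hl : l0 ≤ l) {i j : ℤ} (hij : i + 2 * l < j) :
    ∫ ω, |h (X i ω) (X j ω) t - HN h t l (Nw Z (G l) i ω) (Nw Z (G l) j ω)| ∂P
      ≤ CA L M Ca / (l : ℝ) ^ 3 + CA L M Ca * b (j - i - 2 * l).toNat := by
  have hl1 : 1 ≤ l := S.l01.trans hl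
  have M0 : 0 ≤ M := (hker.nonneg 0 0 0).trans (hM 0 0 0)
  have SM := Sg_le hker hM t l
  have S0 := Sg_nonneg h t l
  have SA : ∀ a c, |Sg h t l a c| ≤ M := fun a c => by rw [abs_of_nonneg (S0 _ _)]; exact SM _ _
  obtain ⟨i1, e1⟩ := bad_term S M0 hl i
  obtain ⟨i2, e2⟩ := bad_term S M0 hl j
  have i3 : Integrable (fun ω => Sg h t l (Nw Z (G l) i ω) (Nw Z (G l) j ω)) P :=
    int_bdd (meas_ZZ (Sg h t l) (S.hN l i) (S.hN l j)) fun _ => SA _ _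
  have i4 : Integrable (fun ω => Sg h t l (Nw Z (G l) i ω) (Nw Z (G l) j ω)
    + M * (bad X Z (G l) i).indicator (1 : Ω → ℝ) ω) P := i3.add i1
  have e3 := S.decouple2 l hij (Sg h t l) SA
  have i5 : Integrable (fun q : Ω × Ω => Sg h t l (Nw Z (G l) 0 q.1) (Nw Z (G l) 0 q.2)) (P.prod P) :=
    int_bdd (meas_ZZ (Sg h t l) ((S.hN l 0).comp measurable_fst) ((S.hN l 0).comp measurable_snd))
      fun _ => SA _ _
  have e4 := S.Sg_int hker hM hL hv hl
  rw [integral_prod _ i5] at e4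
  have e5 := (abs_le.1 e3).2
  have hb := S.b0 (j - i - 2 * l).toNat
  have hlp : (0 : ℝ) < (l : ℝ) ^ 3 := by positivity
  calc _ ≤ ∫ ω, (Sg h t l (Nw Z (G l) i ω) (Nw Z (G l) j ω)
      + M * (bad X Z (G l) i).indicator (1 : Ω → ℝ) ω + M * (bad X Z (G l) j).indicator (1 : Ω → ℝ) ω) ∂P := by
        refine integral_mono ?_ (i4.add i2) fun ω => pt_approx hker hM t hl1 i j ω ω
        exact (int_bdd ((meas_h hker t (S.hX i) (S.hX j)).sub
          (meas_ZZ (HN h t l) (S.hN l i) (S.hN l j))) (M := M) fun _ => abs_h_sub hker hM _ _ _ _ _).abs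
    _ ≤ (500 * L + 2 * M ^ 2 * Ca + 1) / (l : ℝ) ^ 3 + 2 * M * b (j - i - 2 * l).toNat
        + M * (Ca / (l : ℝ) ^ 3) + M * (Ca / (l : ℝ) ^ 3) := by
        rw [integral_add i4 i2, integral_add i3 i1]
        linarith
    _ = (500 * L + 2 * M ^ 2 * Ca + 1 + 2 * M * Ca) / (l : ℝ) ^ 3 + 2 * M * b (j - i - 2 * l).toNat := by
        ring
    _ ≤ _ := by
        have := S.Ca0
        have : 0 ≤ 2 * M * Ca := by positivity
        have : 0 ≤ 2 * M ^ 2 * Ca := by positivity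
        unfold CA
        exact add_le_add (div_le_div_of_nonneg_right (by linarith) hlp.le)
          (mul_le_mul_of_nonneg_right (by linarith) hb)

lemma Std.approxA (S : Std P X Z b Cb G l0 Ca) (hker : IsUQKernel h)
    (hM : ∀ x y t, h x y t ≤ M) {L t : ℝ} (hL : 0 ≤ L) (hv : VariationAt (P.map (X 0)) h L t)
    {l : ℕ} (hl : l0 ≤ l) :
    ∫ q : Ω × Ω, |h (X 0 q.1) (X 0 q.2) t - HN h t l (Nw Z (G l) 0 q.1) (Nw Z (G l) 0 q.2)| ∂(P.prod P)
      ≤ CA L M Ca / (l : ℝ) ^ 3 := by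
  have hl1 : 1 ≤ l := S.l01.trans hl
  have M0 : 0 ≤ M := (hker.nonneg 0 0 0).trans (hM 0 0 0)
  have SM := Sg_le hker hM t l
  have S0 := Sg_nonneg h t l
  have SA : ∀ a c, |Sg h t l a c| ≤ M := fun a c => by rw [abs_of_nonneg (S0 _ _)]; exact SM _ _
  obtain ⟨i1, e1⟩ := bad_term S M0 hl 0
  have j1 : Integrable (fun q : Ω × Ω => M * (bad X Z (G l) 0).indicator (1 : Ω → ℝ) q.1) (P.prod P) :=
    i1.comp_fst P
  have j2 : Integrable (fun q : Ω × Ω => M * (bad X Z (G l) 0).indicator (1 : Ω → ℝ) q.2) (P.prod P) :=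
    i1.comp_snd P
  have i5 : Integrable (fun q : Ω × Ω => Sg h t l (Nw Z (G l) 0 q.1) (Nw Z (G l) 0 q.2)) (P.prod P) :=
    int_bdd (meas_ZZ (Sg h t l) ((S.hN l 0).comp measurable_fst) ((S.hN l 0).comp measurable_snd))
      fun _ => SA _ _
  have i4 : Integrable (fun q : Ω × Ω => Sg h t l (Nw Z (G l) 0 q.1) (Nw Z (G l) 0 q.2)
    + M * (bad X Z (G l) 0).indicator (1 : Ω → ℝ) q.1) (P.prod P) := i5.add j1
  have e4 := S.Sg_int hker hM hL hv hl
  have f1 : ∫ q : Ω × Ω, M * (bad X Z (G l) 0).indicator (1 : Ω → ℝ) q.1 ∂(P.prod P)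
      = ∫ ω, M * (bad X Z (G l) 0).indicator (1 : Ω → ℝ) ω ∂P := by
    rw [integral_prod _ j1]; simp
  have f2 : ∫ q : Ω × Ω, M * (bad X Z (G l) 0).indicator (1 : Ω → ℝ) q.2 ∂(P.prod P)
      = ∫ ω, M * (bad X Z (G l) 0).indicator (1 : Ω → ℝ) ω ∂P := by
    rw [integral_prod _ j2]; simp
  have hlp : (0 : ℝ) < (l : ℝ) ^ 3 := by positivity
  calc _ ≤ ∫ q : Ω × Ω, (Sg h t l (Nw Z (G l) 0 q.1) (Nw Z (G l) 0 q.2)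
      + M * (bad X Z (G l) 0).indicator (1 : Ω → ℝ) q.1
      + M * (bad X Z (G l) 0).indicator (1 : Ω → ℝ) q.2) ∂(P.prod P) := by
        refine integral_mono ?_ (i4.add j2) fun q => pt_approx hker hM t hl1 0 0 q.1 q.2
        exact (int_bdd ((meas_h hker t ((S.hX 0).comp measurable_fst) ((S.hX 0).comp measurable_snd)).sub
          (meas_ZZ (HN h t l) ((S.hN l 0).comp measurable_fst) ((S.hN l 0).comp measurable_snd)))
            (M := M) fun _ => abs_h_sub hker hM _ _ _ _ _).abs
    _ ≤ (500 * L + 2 * M ^ 2 * Ca + 1) / (l : ℝ) ^ 3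
        + M * (Ca / (l : ℝ) ^ 3) + M * (Ca / (l : ℝ) ^ 3) := by
        rw [integral_add i4 j2, integral_add i5 j1, f1, f2]
        linarith
    _ = (500 * L + 2 * M ^ 2 * Ca + 1 + 2 * M * Ca) / (l : ℝ) ^ 3 := by
        ring
    _ ≤ _ := by
        unfold CA
        exact div_le_div_of_nonneg_right (by linarith) hlp.le

end
end UQuantile

namespace UQuantile

variable {Ω : Type*} [MeasurableSpace Ω]

/-- Functions well approximated by window functionals. -/
structure GoodFn (P : Measure Ω) (X Z : ℤ → Ω → ℝ) (G : (l : ℕ) → (Fin (2 * l + 1) → ℝ) → ℤ) (l0 : ℕ)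
    (g : ℝ → ℝ) (B C : ℝ) : Prop where
  meas : Measurable g
  B0 : 0 ≤ B
  C0 : 0 ≤ C
  bd : ∀ x, |g x| ≤ B
  mean : ∫ ω, g (X 0 ω) ∂P = 0
  app : ∀ l ≥ l0, ∃ gl : ℤ → ℝ, (∀ a, |gl a| ≤ B) ∧
    ∫ ω, |g (X 0 ω) - gl (Nw Z (G l) 0 ω)| ∂P ≤ C / (l : ℝ) ^ 3

section
variable {P : Measure Ω} [IsProbabilityMeasure P] {X Z : ℤ → Ω → ℝ} {b : ℕ → ℝ} {Cb : ℝ}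
    {G : (l : ℕ) → (Fin (2 * l + 1) → ℝ) → ℤ} {l0 : ℕ} {Ca : ℝ}
    {h : ℝ → ℝ → ℝ → ℝ} {M : ℝ}

lemma GoodFn.sub {g g' : ℝ → ℝ} {B C B' C' : ℝ} (S : Std P X Z b Cb G l0 Ca)
    (hg : GoodFn P X Z G l0 g B C)
    (hg' : GoodFn P X Z G l0 g' B' C') :
    GoodFn P X Z G l0 (fun x => g x - g' x) (B + B') (C + C') := by
  have i1 : Integrable (fun ω => g (X 0 ω)) P := int_bdd (hg.meas.comp (S.hX 0)) fun _ => hg.bd _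
  have i2 : Integrable (fun ω => g' (X 0 ω)) P := int_bdd (hg'.meas.comp (S.hX 0)) fun _ => hg'.bd _
  refine ⟨hg.meas.sub hg'.meas, add_nonneg hg.B0 hg'.B0, add_nonneg hg.C0 hg'.C0, fun x => ?_, ?_, ?_⟩
  · exact (abs_sub _ _).trans (add_le_add (hg.bd x) (hg'.bd x))
  · rw [integral_sub i1 i2, hg.mean, hg'.mean, sub_zero]
  · intro l hl
    obtain ⟨gl, h1, h2⟩ := hg.app l hl
    obtain ⟨gl', h1', h2'⟩ := hg'.app l hl
    have j1 : Integrable (fun ω => gl (Nw Z (G l) 0 ω)) P :=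
      int_bdd ((measurable_of_countable gl).comp (S.hN l 0)) fun _ => h1 _
    have j2 : Integrable (fun ω => gl' (Nw Z (G l) 0 ω)) P :=
      int_bdd ((measurable_of_countable gl').comp (S.hN l 0)) fun _ => h1' _
    refine ⟨fun a => gl a - gl' a, fun a => (abs_sub _ _).trans (add_le_add (h1 a) (h1' a)), ?_⟩
    calc _ ≤ ∫ ω, (|g (X 0 ω) - gl (Nw Z (G l) 0 ω)| + |g' (X 0 ω) - gl' (Nw Z (G l) 0 ω)|) ∂P := by
          refine integral_mono ((i1.sub i2).sub (j1.sub j2)).abs ((i1.sub j1).abs.add (i2.sub j2).abs)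
            fun ω => ?_
          refine le_trans (le_of_eq ?_) (abs_sub _ _)
          congr 1
          ring
      _ ≤ _ := by
          have k1 : Integrable (fun ω => |g (X 0 ω) - gl (Nw Z (G l) 0 ω)|) P := (i1.sub j1).abs
          have k2 : Integrable (fun ω => |g' (X 0 ω) - gl' (Nw Z (G l) 0 ω)|) P := (i2.sub j2).abs
          rw [integral_add k1 k2, add_div]
          exact add_le_add h2 h2'

lemma Std.inner_eq (S : Std P X Z b Cb G l0 Ca) (hker : IsUQKernel h) (x t : ℝ) :
    ∫ y, h x y t ∂(P.map (X 0)) = ∫ ω', h x (X 0 ω') t ∂P := by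
  rw [integral_map (S.hX 0).aemeasurable]
  exact (meas_h hker t measurable_const measurable_id).aestronglyMeasurable

lemma Std.meas_inner (S : Std P X Z b Cb G l0 Ca) (hker : IsUQKernel h) (t : ℝ) :
    Measurable fun x => ∫ y, h x y t ∂(P.map (X 0)) := by
  have hp := S.isProb
  have : StronglyMeasurable (fun q : ℝ × ℝ => h q.1 q.2 t) :=
    (meas_h hker t measurable_fst measurable_snd).stronglyMeasurable
  exact (StronglyMeasurable.integral_prod_right (f := fun x y => h x y t) this).measurable

lemma Std.U_eq (S : Std P X Z b Cb G l0 Ca) (hker : IsUQKernel h) (t : ℝ) :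
    Udist (P.map (X 0)) h t = ∫ ω, ∫ ω', h (X 0 ω) (X 0 ω') t ∂P ∂P := by
  unfold Udist
  rw [integral_map (S.hX 0).aemeasurable (S.meas_inner hker t).aestronglyMeasurable]
  simp only [S.inner_eq hker]

lemma Std.inner_in (S : Std P X Z b Cb G l0 Ca) (hker : IsUQKernel h)
    (hM : ∀ x y t, h x y t ≤ M) (x t : ℝ) :
    0 ≤ ∫ y, h x y t ∂(P.map (X 0)) ∧ ∫ y, h x y t ∂(P.map (X 0)) ≤ M := by
  have hp := S.isProb
  exact int_mem (meas_h hker t measurable_const measurable_id) (fun _ => hker.nonneg _ _ _)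
    (fun _ => hM _ _ _)

lemma Std.U_in (S : Std P X Z b Cb G l0 Ca) (hker : IsUQKernel h)
    (hM : ∀ x y t, h x y t ≤ M) (t : ℝ) :
    0 ≤ Udist (P.map (X 0)) h t ∧ Udist (P.map (X 0)) h t ≤ M := by
  have hp := S.isProb
  exact int_mem (S.meas_inner hker t) (fun x => (S.inner_in hker hM x t).1)
    (fun x => (S.inner_in hker hM x t).2)

lemma Std.h1_abs (S : Std P X Z b Cb G l0 Ca) (hker : IsUQKernel h)
    (hM : ∀ x y t, h x y t ≤ M) (x t : ℝ) : |h1 (P.map (X 0)) h x t| ≤ M :=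
  diff_le (S.inner_in hker hM x t).1 (S.inner_in hker hM x t).2 (S.U_in hker hM t).1 (S.U_in hker hM t).2

lemma Std.h1_meas (S : Std P X Z b Cb G l0 Ca) (hker : IsUQKernel h) (t : ℝ) :
    Measurable fun x => h1 (P.map (X 0)) h x t := (S.meas_inner hker t).sub_const _

lemma Std.h2_abs (S : Std P X Z b Cb G l0 Ca) (hker : IsUQKernel h)
    (hM : ∀ x y t, h x y t ≤ M) (x y t : ℝ) : |h2 (P.map (X 0)) h x y t| ≤ 3 * M := by
  have k1 := diff_le (hker.nonneg x y t) (hM x y t) (S.U_in hker hM t).1 (S.U_in hker hM t).2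
  have k2 := S.h1_abs hker hM x t
  have k3 := S.h1_abs hker hM y t
  unfold h2
  rw [abs_le] at *
  constructor <;> linarith [k1.1, k2.1, k3.1, k1.2, k2.2, k3.2]

lemma Std.int_inner (S : Std P X Z b Cb G l0 Ca) (hker : IsUQKernel h)
    (hM : ∀ x y t, h x y t ≤ M) (t : ℝ) :
    Integrable (fun ω => ∫ y, h (X 0 ω) y t ∂(P.map (X 0))) P :=
  int_bdd ((S.meas_inner hker t).comp (S.hX 0)) (M := M) fun ω => by
    rw [abs_of_nonneg (S.inner_in hker hM _ t).1]; exact (S.inner_in hker hM _ t).2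

lemma Std.h1_mean (S : Std P X Z b Cb G l0 Ca) (hker : IsUQKernel h)
    (hM : ∀ x y t, h x y t ≤ M) (t : ℝ) : ∫ ω, h1 (P.map (X 0)) h (X 0 ω) t ∂P = 0 := by
  unfold h1
  rw [integral_sub (S.int_inner hker hM t) (integrable_const _), S.U_eq hker]
  simp [S.inner_eq hker]

/-- the three approximation bounds -/
lemma Std.approx1 (S : Std P X Z b Cb G l0 Ca) (hker : IsUQKernel h)
    (hM : ∀ x y t, h x y t ≤ M) {L t : ℝ} (hL : 0 ≤ L) (hv : VariationAt (P.map (X 0)) h L t)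
    {l : ℕ} (hl : l0 ≤ l) :
    |Udist (P.map (X 0)) h t - UN P (Nw Z (G l) 0) (HN h t l)| ≤ CA L M Ca / (l : ℝ) ^ 3 ∧
    ∫ ω, |h1 (P.map (X 0)) h (X 0 ω) t - FN1 P (Nw Z (G l) 0) (HN h t l) (Nw Z (G l) 0 ω)| ∂P
      ≤ 2 * CA L M Ca / (l : ℝ) ^ 3 := by
  have A := S.approxA hker hM hL hv hl
  set D : Ω × Ω → ℝ := fun q => h (X 0 q.1) (X 0 q.2) t - HN h t l (Nw Z (G l) 0 q.1) (Nw Z (G l) 0 q.2)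
    with hD
  have iD : Integrable D (P.prod P) :=
    int_bdd ((meas_h hker t ((S.hX 0).comp measurable_fst) ((S.hX 0).comp measurable_snd)).sub
          (meas_ZZ (HN h t l) ((S.hN l 0).comp measurable_fst) ((S.hN l 0).comp measurable_snd)))
            (M := M) fun _ => abs_h_sub hker hM _ _ _ _ _
  have A' : ∫ ω, ∫ ω', |D (ω, ω')| ∂P ∂P ≤ CA L M Ca / (l : ℝ) ^ 3 := by
    rw [← integral_prod _ iD.abs]; exact A
  have FI := FN_in (P := P) (S.hN l 0) (HN_nonneg hker t l) (HN_le hM t l)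
  have j1 : Integrable (fun ω => ∫ ω', HN h t l (Nw Z (G l) 0 ω) (Nw Z (G l) 0 ω') ∂P) P :=
    int_bdd ((measurable_of_countable (fun a => ∫ ω', HN h t l a (Nw Z (G l) 0 ω') ∂P)).comp (S.hN l 0))
      (M := M) fun ω => by rw [abs_of_nonneg (FI _).1]; exact (FI _).2
  have inn : ∀ ω, (∫ y, h (X 0 ω) y t ∂(P.map (X 0))) - ∫ ω', HN h t l (Nw Z (G l) 0 ω) (Nw Z (G l) 0 ω') ∂P
      = ∫ ω', D (ω, ω') ∂P := by
    intro ω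
    rw [S.inner_eq hker, ← integral_sub]
    · exact int_bdd (meas_h hker t measurable_const (S.hX 0)) (M := M) fun ω' => by
        rw [abs_of_nonneg (hker.nonneg _ _ _)]; exact hM _ _ _
    · exact int_bdd (meas_ZZ (HN h t l) measurable_const (S.hN l 0)) (M := M) fun ω' => by
        rw [abs_of_nonneg (HN_nonneg hker _ _ _ _)]; exact HN_le hM _ _ _ _
  have c1 : |Udist (P.map (X 0)) h t - UN P (Nw Z (G l) 0) (HN h t l)| ≤ CA L M Ca / (l : ℝ) ^ 3 := by
    have : Udist (P.map (X 0)) h t - UN P (Nw Z (G l) 0) (HN h t l) = ∫ ω, ∫ ω', D (ω, ω') ∂P ∂P := by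
      rw [S.U_eq hker, UN]
      simp only [← S.inner_eq hker]
      rw [← integral_sub (S.int_inner hker hM t) j1]
      simp only [inn]
    rw [this, ← integral_prod _ iD]
    exact (abs_integral_le_integral_abs).trans A
  refine ⟨c1, ?_⟩
  have j2 : Integrable (fun ω => ∫ ω', |D (ω, ω')| ∂P) P := iD.abs.integral_prod_left
  calc _ ≤ ∫ ω, ((∫ ω', |D (ω, ω')| ∂P) + CA L M Ca / (l : ℝ) ^ 3) ∂P := by
        refine integral_mono ?_ (j2.add (integrable_const _)) fun ω => ?_
        · exact (((S.int_inner hker hM t).sub (integrable_const _)).sub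
            (j1.sub (integrable_const _))).abs
        · show |h1 (P.map (X 0)) h (X 0 ω) t - FN1 P (Nw Z (G l) 0) (HN h t l) (Nw Z (G l) 0 ω)| ≤
            (∫ ω', |D (ω, ω')| ∂P) + CA L M Ca / (l : ℝ) ^ 3
          have e : h1 (P.map (X 0)) h (X 0 ω) t - FN1 P (Nw Z (G l) 0) (HN h t l) (Nw Z (G l) 0 ω)
            = (∫ ω', D (ω, ω') ∂P) - (Udist (P.map (X 0)) h t - UN P (Nw Z (G l) 0) (HN h t l)) := by
            rw [← inn ω]; unfold h1 FN1; ring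
          rw [e]
          exact (abs_sub _ _).trans (add_le_add abs_integral_le_integral_abs c1)
    _ ≤ _ := by
        rw [integral_add j2 (integrable_const _), integral_const]
        simp only [probReal_univ, smul_eq_mul, one_mul]
        rw [two_mul, add_div]
        linarith

lemma Std.h1_good (S : Std P X Z b Cb G l0 Ca) (hker : IsUQKernel h)
    (hM : ∀ x y t, h x y t ≤ M) {L t : ℝ} (hL : 0 ≤ L) (hv : VariationAt (P.map (X 0)) h L t) :
    GoodFn P X Z G l0 (fun x => h1 (P.map (X 0)) h x t) M (2 * CA L M Ca) := by
  have M0 : 0 ≤ M := (hker.nonneg 0 0 0).trans (hM 0 0 0)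
  refine ⟨S.h1_meas hker t, M0, by have := S.CA_nonneg hL M0; positivity,
    fun x => S.h1_abs hker hM x t, S.h1_mean hker hM t, fun l hl =>
    ⟨FN1 P (Nw Z (G l) 0) (HN h t l), fun a => ?_, (S.approx1 hker hM hL hv hl).2⟩⟩
  exact FN1_abs (S.hN l 0) (HN_nonneg hker t l) (HN_le hM t l) a

lemma Std.h2_approx (S : Std P X Z b Cb G l0 Ca) (hker : IsUQKernel h)
    (hM : ∀ x y t, h x y t ≤ M) {L t : ℝ} (hL : 0 ≤ L) (hv : VariationAt (P.map (X 0)) h L t)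
    {l : ℕ} (hl : l0 ≤ l) {i j : ℤ} (hij : i + 2 * l < j) :
    ∫ ω, |h2 (P.map (X 0)) h (X i ω) (X j ω) t
        - KN P (Nw Z (G l) 0) (HN h t l) (Nw Z (G l) i ω) (Nw Z (G l) j ω)| ∂P
      ≤ 6 * CA L M Ca / (l : ℝ) ^ 3 + CA L M Ca * b (j - i - 2 * l).toNat := by
  have B := S.approxB hker hM hL hv hl hij
  obtain ⟨c1, c2⟩ := S.approx1 hker hM hL hv hl
  set F1 := FN1 P (Nw Z (G l) 0) (HN h t l) with hF1
  set d1 : ℤ → Ω → ℝ := fun i ω => h1 (P.map (X 0)) h (X i ω) t - F1 (Nw Z (G l) i ω) with hd1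
  have F1a := FN1_abs (P := P) (S.hN l 0) (HN_nonneg hker t l) (HN_le hM t l)
  have id1 : ∀ i, Integrable (d1 i) P := fun i =>
    (int_bdd ((S.h1_meas hker t).comp (S.hX i)) fun ω => S.h1_abs hker hM _ t).sub
      (int_bdd ((measurable_of_countable F1).comp (S.hN l i)) fun ω => F1a _)
  have e1 : ∀ i, ∫ ω, |d1 i ω| ∂P ≤ 2 * CA L M Ca / (l : ℝ) ^ 3 := by
    intro i
    refine le_trans (le_of_eq ?_) c2
    refine stat_XN1 S.hX S.hZ S.hs (S.hG l) i (F := fun x a => |h1 (P.map (X 0)) h x t - F1 a|) ?_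
    exact (((S.h1_meas hker t).comp measurable_fst).sub
      ((measurable_of_countable F1).comp measurable_snd)).abs
  set D : Ω → ℝ := fun ω => h (X i ω) (X j ω) t - HN h t l (Nw Z (G l) i ω) (Nw Z (G l) j ω) with hD
  have iD : Integrable D P := int_bdd ((meas_h hker t (S.hX i) (S.hX j)).sub
          (meas_ZZ (HN h t l) (S.hN l i) (S.hN l j))) (M := M) fun _ => abs_h_sub hker hM _ _ _ _ _
  set u := Udist (P.map (X 0)) h t - UN P (Nw Z (G l) 0) (HN h t l) with hu
  have e : ∀ ω, h2 (P.map (X 0)) h (X i ω) (X j ω) t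
        - KN P (Nw Z (G l) 0) (HN h t l) (Nw Z (G l) i ω) (Nw Z (G l) j ω)
        = D ω - d1 i ω - d1 j ω - u := by
    intro ω; simp only [hD, hd1, hu, h2, KN, hF1]; ring
  simp only [e]
  calc _ ≤ ∫ ω, (|D ω| + |d1 i ω| + |d1 j ω| + |u|) ∂P := by
        refine integral_mono (((iD.sub (id1 i)).sub (id1 j)).sub (integrable_const _)).abs
          (((iD.abs.add (id1 i).abs).add (id1 j).abs).add (integrable_const _)) fun ω => ?_
        refine (abs_sub _ _).trans (add_le_add ((abs_sub _ _).trans (add_le_add (abs_sub _ _) le_rfl)) le_rfl)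
    _ = (∫ ω, |D ω| ∂P) + (∫ ω, |d1 i ω| ∂P) + (∫ ω, |d1 j ω| ∂P) + |u| := by
        have k1 : Integrable (fun ω => |D ω| + |d1 i ω|) P := iD.abs.add (id1 i).abs
        have k2 : Integrable (fun ω => |D ω| + |d1 i ω| + |d1 j ω|) P := k1.add (id1 j).abs
        rw [integral_add k2 (integrable_const _), integral_add k1 (id1 j).abs,
          integral_add iD.abs (id1 i).abs]
        simp
    _ ≤ _ := by
        have := e1 i
        have := e1 j
        have : 6 * CA L M Ca / (l : ℝ) ^ 3 = CA L M Ca / (l : ℝ) ^ 3 + 2 * CA L M Ca / (l : ℝ) ^ 3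
          + 2 * CA L M Ca / (l : ℝ) ^ 3 + CA L M Ca / (l : ℝ) ^ 3 := by ring
        linarith

end
end UQuantile

namespace UQuantile

variable {Ω : Type*} [MeasurableSpace Ω]

/-- autocovariance -/
def cv (P : Measure Ω) (X : ℤ → Ω → ℝ) (g : ℝ → ℝ) (r : ℤ) : ℝ := ∫ ω, g (X 0 ω) * g (X r ω) ∂P

/-- covariance decay constant -/
def G0 (Cb : ℝ) (l0 : ℕ) (B C : ℝ) : ℝ := 108 * B * C + 18 * B ^ 2 * Cb + 9 * B ^ 2 * (l0 : ℝ) ^ 2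

/-- decay weights -/
def dw (r : ℤ) : ℝ := 1 / ((r.natAbs : ℝ) + 1) ^ 2

lemma dw_pos (r : ℤ) : 0 < dw r := by unfold dw; positivity

lemma summable_dw : Summable dw := by
  have h : Summable fun n : ℕ => 1 / ((n : ℝ) + 1) ^ 2 := by
    have := (summable_nat_add_iff 1).2 (Real.summable_one_div_nat_pow.2 (by norm_num : 1 < 2))
    simpa using this
  refine Summable.of_nat_of_neg ?_ ?_
  · simpa [dw] using h
  · simpa [dw] using h

section
variable {P : Measure Ω} [IsProbabilityMeasure P] {X Z : ℤ → Ω → ℝ} {b : ℕ → ℝ} {Cb : ℝ}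
    {G : (l : ℕ) → (Fin (2 * l + 1) → ℝ) → ℤ} {l0 : ℕ} {Ca : ℝ}
    {g : ℝ → ℝ} {B C : ℝ}

lemma G0_nonneg (S : Std P X Z b Cb G l0 Ca) (hg : GoodFn P X Z G l0 g B C) : 0 ≤ G0 Cb l0 B C := by
  have := hg.B0; have := hg.C0; have := S.Cb0
  unfold G0; positivity

lemma GoodFn.meas_X (S : Std P X Z b Cb G l0 Ca) (hg : GoodFn P X Z G l0 g B C) (i : ℤ) :
    Measurable fun ω => g (X i ω) := hg.meas.comp (S.hX i)

lemma GoodFn.int_X (S : Std P X Z b Cb G l0 Ca) (hg : GoodFn P X Z G l0 g B C) (i : ℤ) :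
    Integrable (fun ω => g (X i ω)) P := int_bdd (hg.meas_X S i) fun _ => hg.bd _

lemma GoodFn.int_XX (S : Std P X Z b Cb G l0 Ca) (hg : GoodFn P X Z G l0 g B C) (i j : ℤ) :
    Integrable (fun ω => g (X i ω) * g (X j ω)) P :=
  int_bdd ((hg.meas_X S i).mul (hg.meas_X S j)) (M := B * B) fun _ => by
    rw [abs_mul]; exact mul_le_mul (hg.bd _) (hg.bd _) (abs_nonneg _) hg.B0

lemma cv_stat (S : Std P X Z b Cb G l0 Ca) (hg : GoodFn P X Z G l0 g B C) (i j : ℤ) :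
    ∫ ω, g (X i ω) * g (X j ω) ∂P = cv P X g (j - i) := by
  have := stat_X2 S.hX S.hZ S.hs 0 (j - i) i (F := fun x y => g x * g y)
    ((hg.meas.comp measurable_fst).mul (hg.meas.comp measurable_snd))
  simpa [cv] using this

lemma cv_neg (S : Std P X Z b Cb G l0 Ca) (hg : GoodFn P X Z G l0 g B C) (r : ℤ) :
    cv P X g (-r) = cv P X g r := by
  have h1 := cv_stat S hg r 0
  rw [zero_sub] at h1
  rw [← h1, cv]
  simp only [mul_comm]

lemma cv_triv (hg : GoodFn P X Z G l0 g B C) (r : ℤ) :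
    |cv P X g r| ≤ B ^ 2 := abs_int_le fun ω => by
    rw [abs_mul, sq]; exact mul_le_mul (hg.bd _) (hg.bd _) (abs_nonneg _) hg.B0

lemma GoodFn.app' (S : Std P X Z b Cb G l0 Ca) (hg : GoodFn P X Z G l0 g B C) {l : ℕ} (hl : l0 ≤ l) :
    ∃ gl : ℤ → ℝ, (∀ a, |gl a| ≤ B) ∧
      (∀ i, ∫ ω, |g (X i ω) - gl (Nw Z (G l) i ω)| ∂P ≤ C / (l : ℝ) ^ 3) := by
  obtain ⟨gl, h1, h2⟩ := hg.app l hl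
  refine ⟨gl, h1, fun i => le_trans (le_of_eq ?_) h2⟩
  exact stat_XN1 S.hX S.hZ S.hs (S.hG l) i (F := fun x a => |g x - gl a|)
    ((hg.meas.comp measurable_fst).sub ((measurable_of_countable gl).comp measurable_snd)).abs

lemma cv_mid (S : Std P X Z b Cb G l0 Ca) (hg : GoodFn P X Z G l0 g B C) {l k : ℕ} (hl : l0 ≤ l)
    (hk : 2 * l < k) :
    |cv P X g k| ≤ 3 * B * C / (l : ℝ) ^ 3 + 2 * B ^ 2 * b (k - 2 * l) := by
  obtain ⟨gl, gB, gA⟩ := hg.app' S hl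
  have B0 := hg.B0
  have mgl : ∀ i, Measurable fun ω => gl (Nw Z (G l) i ω) := fun i =>
    (measurable_of_countable gl).comp (S.hN l i)
  have igl : ∀ i, Integrable (fun ω => gl (Nw Z (G l) i ω)) P := fun i => int_bdd (mgl i) fun _ => gB _
  have BB : ∀ a c, |gl a * gl c| ≤ B ^ 2 := fun a c => by
    rw [abs_mul, sq]; exact mul_le_mul (gB _) (gB _) (abs_nonneg _) hg.B0
  have i2 : Integrable (fun ω => gl (Nw Z (G l) 0 ω) * gl (Nw Z (G l) k ω)) P :=
    int_bdd ((mgl 0).mul (mgl k)) fun _ => BB _ _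
  have d0 : ∀ i : ℤ, Integrable (fun ω => |g (X i ω) - gl (Nw Z (G l) i ω)|) P := fun i =>
    ((hg.int_X S i).sub (igl i)).abs
  have e1 : |cv P X g k - ∫ ω, gl (Nw Z (G l) 0 ω) * gl (Nw Z (G l) k ω) ∂P| ≤ 2 * B * C / (l : ℝ) ^ 3 := by
    unfold cv
    rw [← integral_sub (hg.int_XX S 0 k) i2]
    refine abs_integral_le_integral_abs.trans ?_
    calc _ ≤ ∫ ω, (B * |g (X 0 ω) - gl (Nw Z (G l) 0 ω)| + B * |g (X k ω) - gl (Nw Z (G l) k ω)|) ∂P := by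
          refine integral_mono ((hg.int_XX S 0 k).sub i2).abs
            (((d0 0).const_mul _).add ((d0 k).const_mul _)) fun ω => ?_
          show |g (X 0 ω) * g (X k ω) - gl (Nw Z (G l) 0 ω) * gl (Nw Z (G l) k ω)| ≤
            B * |g (X 0 ω) - gl (Nw Z (G l) 0 ω)| + B * |g (X k ω) - gl (Nw Z (G l) k ω)|
          have : g (X 0 ω) * g (X k ω) - gl (Nw Z (G l) 0 ω) * gl (Nw Z (G l) k ω)
            = g (X k ω) * (g (X 0 ω) - gl (Nw Z (G l) 0 ω))
              + gl (Nw Z (G l) 0 ω) * (g (X k ω) - gl (Nw Z (G l) k ω)) := by ring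
          rw [this]
          refine (abs_add_le _ _).trans ?_
          rw [abs_mul, abs_mul]
          exact add_le_add (mul_le_mul_of_nonneg_right (hg.bd _) (abs_nonneg _))
            (mul_le_mul_of_nonneg_right (gB _) (abs_nonneg _))
      _ ≤ _ := by
          rw [integral_add ((d0 0).const_mul _) ((d0 k).const_mul _), integral_const_mul, integral_const_mul]
          have h1 := mul_le_mul_of_nonneg_left (gA 0) B0
          have h2 := mul_le_mul_of_nonneg_left (gA k) B0
          calc _ ≤ _ := add_le_add h1 h2
            _ = _ := by ring
  have e2 := S.decouple2 l (i := 0) (j := k) (by omega) (fun a c => gl a * gl c) BB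
  have ek : ((k : ℤ) - 0 - 2 * l).toNat = k - 2 * l := by omega
  rw [ek] at e2
  have e3 : |∫ ω, ∫ ω', gl (Nw Z (G l) 0 ω) * gl (Nw Z (G l) 0 ω') ∂P ∂P| ≤ B * C / (l : ℝ) ^ 3 := by
    simp only [integral_const_mul, integral_mul_const]
    rw [abs_mul]
    have h1 : |∫ ω, gl (Nw Z (G l) 0 ω) ∂P| ≤ C / (l : ℝ) ^ 3 := by
      have : ∫ ω, gl (Nw Z (G l) 0 ω) ∂P = - ∫ ω, (g (X 0 ω) - gl (Nw Z (G l) 0 ω)) ∂P := by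
        rw [integral_sub (hg.int_X S 0) (igl 0), hg.mean]; ring
      rw [this, abs_neg]
      exact abs_integral_le_integral_abs.trans (gA 0)
    have h2 : |∫ ω, gl (Nw Z (G l) 0 ω) ∂P| ≤ B := abs_int_le fun _ => gB _
    calc _ ≤ B * (C / (l : ℝ) ^ 3) := mul_le_mul h2 h1 (abs_nonneg _) B0
      _ = _ := by ring
  have e4 : 3 * B * C / (l : ℝ) ^ 3 = 2 * B * C / (l : ℝ) ^ 3 + B * C / (l : ℝ) ^ 3 := by ring
  rw [e4]
  rw [abs_le] at *
  constructor <;> linarith [e1.1, e1.2, e2.1, e2.2, e3.1, e3.2]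

lemma cv_nat (S : Std P X Z b Cb G l0 Ca) (hg : GoodFn P X Z G l0 g B C) (k : ℕ) :
    |cv P X g k| ≤ G0 Cb l0 B C / ((k : ℝ) + 1) ^ 2 := by
  have B0 := hg.B0
  have C0 := hg.C0
  have Cb0 := S.Cb0
  have hkp : (0 : ℝ) < ((k : ℝ) + 1) ^ 2 := by positivity
  have a1 : 0 ≤ 108 * B * C := by positivity
  have a2 : 0 ≤ 18 * B ^ 2 * Cb := by positivity
  have a3 : 0 ≤ 9 * B ^ 2 * (l0 : ℝ) ^ 2 := by positivity
  by_cases hk : k < 3 * l0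
  · rw [le_div_iff₀ hkp]
    have h1 := cv_triv hg k
    have h2 : ((k : ℝ) + 1) ^ 2 ≤ (3 * l0) ^ 2 := by
      have : (k : ℝ) + 1 ≤ 3 * l0 := by exact_mod_cast hk
      gcongr
    calc _ ≤ B ^ 2 * (3 * (l0 : ℝ)) ^ 2 := mul_le_mul h1 h2 hkp.le (by positivity)
      _ ≤ _ := by unfold G0; nlinarith
  · have hl0 := S.l01
    set l := k / 3 with hl
    have hll : l0 ≤ l := by omega
    have hl1 : 1 ≤ l := by omega
    have h1 := cv_mid S hg hll (k := k) (by omega)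
    have h2 := S.bC (k - 2 * l)
    have hlr : (1 : ℝ) ≤ l := by exact_mod_cast hl1
    have q1 : 1 / (l : ℝ) ^ 3 ≤ 36 / ((k : ℝ) + 1) ^ 2 := by
      rw [div_le_div_iff₀ (by positivity) hkp, one_mul]
      have : (k : ℝ) + 1 ≤ 6 * l := by
        have : k + 1 ≤ 6 * l := by omega
        exact_mod_cast this
      calc ((k : ℝ) + 1) ^ 2 ≤ (6 * l) ^ 2 := by gcongr
        _ = 36 * (l : ℝ) ^ 2 := by ring
        _ ≤ 36 * (l : ℝ) ^ 3 := by
          have : (l : ℝ) ^ 2 ≤ (l : ℝ) ^ 3 := pow_le_pow_right₀ hlr (by norm_num)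
          linarith
    have q2 : Cb / (((k - 2 * l : ℕ) : ℝ) + 1) ^ 2 ≤ 9 * Cb / ((k : ℝ) + 1) ^ 2 := by
      rw [div_le_div_iff₀ (by positivity) hkp]
      have : (k : ℝ) + 1 ≤ 3 * (((k - 2 * l : ℕ) : ℝ) + 1) := by
        have : k + 1 ≤ 3 * ((k - 2 * l) + 1) := by omega
        exact_mod_cast this
      calc Cb * ((k : ℝ) + 1) ^ 2 ≤ Cb * (3 * (((k - 2 * l : ℕ) : ℝ) + 1)) ^ 2 := by gcongr
        _ = _ := by ring
    calc _ ≤ _ := h1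
      _ = 3 * B * C * (1 / (l : ℝ) ^ 3) + 2 * B ^ 2 * b (k - 2 * l) := by ring
      _ ≤ 3 * B * C * (36 / ((k : ℝ) + 1) ^ 2) + 2 * B ^ 2 * (9 * Cb / ((k : ℝ) + 1) ^ 2) := by
          refine add_le_add (mul_le_mul_of_nonneg_left q1 (by positivity))
            (mul_le_mul_of_nonneg_left (h2.trans q2) (by positivity))
      _ = (108 * B * C + 18 * B ^ 2 * Cb) / ((k : ℝ) + 1) ^ 2 := by ring
      _ ≤ _ := by unfold G0; exact div_le_div_of_nonneg_right (by linarith) hkp.le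

lemma cv_le (S : Std P X Z b Cb G l0 Ca) (hg : GoodFn P X Z G l0 g B C) (r : ℤ) :
    |cv P X g r| ≤ G0 Cb l0 B C * dw r := by
  have h := cv_nat S hg r.natAbs
  have e : cv P X g r = cv P X g r.natAbs := by
    rcases Int.natAbs_eq r with h | h
    · rw [← h]
    · conv_lhs => rw [h]
      rw [cv_neg S hg]
  rw [e]
  refine h.trans (le_of_eq ?_)
  unfold dw; ring

lemma cv_summable (S : Std P X Z b Cb G l0 Ca) (hg : GoodFn P X Z G l0 g B C) :
    Summable (cv P X g) :=
  Summable.of_norm_bounded (summable_dw.mul_left _) (fun r => cv_le S hg r)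

/-- partial sums over index sets -/
def SI (X : ℤ → Ω → ℝ) (g : ℝ → ℝ) (I : Finset ℤ) (ω : Ω) : ℝ := ∑ i ∈ I, g (X i ω)

lemma SI_meas (S : Std P X Z b Cb G l0 Ca) (hg : GoodFn P X Z G l0 g B C) (I : Finset ℤ) :
    Measurable (SI X g I) := Finset.measurable_sum _ fun i _ => hg.meas_X S i

lemma SI_abs (hg : GoodFn P X Z G l0 g B C) (I : Finset ℤ) (ω : Ω) : |SI X g I ω| ≤ I.card * B := by
  refine (Finset.abs_sum_le_sum_abs _ _).trans ?_
  calc _ ≤ ∑ i ∈ I, B := Finset.sum_le_sum fun i _ => hg.bd _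
    _ = _ := by simp

lemma SI_sq (S : Std P X Z b Cb G l0 Ca) (hg : GoodFn P X Z G l0 g B C) (I : Finset ℤ) :
    ∫ ω, SI X g I ω ^ 2 ∂P = ∑ i ∈ I, ∑ j ∈ I, cv P X g (j - i) := by
  have : ∀ ω, SI X g I ω ^ 2 = ∑ i ∈ I, ∑ j ∈ I, g (X i ω) * g (X j ω) := fun ω => by
    rw [sq, SI, Finset.sum_mul_sum]
  simp only [this]
  rw [integral_finsetSum _ fun i _ => integrable_finsetSum _ fun j _ => hg.int_XX S i j]
  refine Finset.sum_congr rfl fun i _ => ?_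
  rw [integral_finsetSum _ fun j _ => hg.int_XX S i j]
  exact Finset.sum_congr rfl fun j _ => cv_stat S hg i j

lemma sum_shift_le {c d : ℤ → ℝ} (hd : Summable d) (hcd : ∀ r, |c r| ≤ d r) (I : Finset ℤ) (i : ℤ) :
    |∑ j ∈ I, c (j - i)| ≤ ∑' r, d r := by
  refine (Finset.abs_sum_le_sum_abs _ _).trans ?_
  have d0 : ∀ r, 0 ≤ d r := fun r => (abs_nonneg _).trans (hcd r)
  calc _ ≤ ∑ j ∈ I, d (j - i) := Finset.sum_le_sum fun j _ => hcd _
    _ = ∑ r ∈ I.map (Equiv.subRight i).toEmbedding, d r := by simp [Finset.sum_map]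
    _ ≤ _ := hd.sum_le_tsum _ fun r _ => d0 r

lemma SI_sq_le' (S : Std P X Z b Cb G l0 Ca) (hg : GoodFn P X Z G l0 g B C) {d : ℤ → ℝ}
    (hd : Summable d) (hcd : ∀ r, |cv P X g r| ≤ d r) (I : Finset ℤ) :
    ∫ ω, SI X g I ω ^ 2 ∂P ≤ I.card * ∑' r, d r := by
  rw [SI_sq S hg]
  calc _ ≤ ∑ i ∈ I, ∑' r, d r := Finset.sum_le_sum fun i _ =>
        (le_abs_self _).trans (sum_shift_le hd hcd I i)
    _ = _ := by simp

lemma SI_sq_le (S : Std P X Z b Cb G l0 Ca) (hg : GoodFn P X Z G l0 g B C) (I : Finset ℤ) :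
    ∫ ω, SI X g I ω ^ 2 ∂P ≤ I.card * (G0 Cb l0 B C * ∑' r, dw r) := by
  have := SI_sq_le' S hg (summable_dw.mul_left (G0 Cb l0 B C)) (cv_le S hg) I
  rwa [tsum_mul_left] at this

lemma SI_shift (S : Std P X Z b Cb G l0 Ca) (hg : GoodFn P X Z G l0 g B C) (a : ℤ) (n : ℕ) :
    ∫ ω, SI X g (Finset.Ico a (a + n)) ω ^ 2 ∂P = ∫ ω, SI X g (Finset.Ico 0 n) ω ^ 2 ∂P := by
  rw [SI_sq S hg, SI_sq S hg]
  have e : Finset.Ico a (a + n) = (Finset.Ico (0 : ℤ) n).map (addLeftEmbedding a) := by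
    rw [Finset.map_add_left_Ico]; simp
  simp only [e, Finset.sum_map, addLeftEmbedding_apply, add_sub_add_left_eq_sub]

lemma var_lim (c : ℤ → ℝ) (hc : Summable c) :
    Tendsto (fun n : ℕ => (∑ i ∈ Finset.Ico (0 : ℤ) n, ∑ j ∈ Finset.Ico (0 : ℤ) n, c (j - i)) / n) atTop
      (𝓝 (∑' r, c r)) := by
  have key : ∀ n : ℕ, (∑ i ∈ Finset.Ico (0 : ℤ) n, ∑ j ∈ Finset.Ico (0 : ℤ) n, c (j - i)) / n
      = ∑' r : ℤ, (((Finset.Ico (0 : ℤ) n).filter fun i => i + r ∈ Finset.Ico (0 : ℤ) n).card / n : ℝ) * c r := by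
    intro n
    have h1 : ∀ i : ℤ, ∑ j ∈ Finset.Ico (0 : ℤ) n, c (j - i)
        = ∑' r : ℤ, if i + r ∈ Finset.Ico (0 : ℤ) n then c r else 0 := by
      intro i
      rw [← (Equiv.subRight i).tsum_eq]
      rw [tsum_eq_sum (s := Finset.Ico (0 : ℤ) n)]
      · refine Finset.sum_congr rfl fun j hj => ?_
        simp only [Equiv.subRight_apply, add_sub_cancel]
        rw [if_pos hj]
      · intro j hj
        simp only [Equiv.subRight_apply, add_sub_cancel]
        rw [if_neg hj]
    have hs : ∀ i : ℤ, Summable fun r : ℤ => if i + r ∈ Finset.Ico (0 : ℤ) n then c r else 0 := fun i =>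
      Summable.of_norm_bounded hc.norm fun r => by
        split_ifs
        · exact le_rfl
        · simp
    simp only [h1]
    rw [← Summable.tsum_finsetSum fun i _ => hs i, ← tsum_div_const]
    refine tsum_congr fun r => ?_
    rw [← Finset.sum_filter, Finset.sum_const, nsmul_eq_mul]
    ring
  simp only [key]
  refine tendsto_tsum_of_dominated_convergence (bound := fun r => |c r|) hc.abs ?_ ?_
  · intro r
    have : Tendsto (fun n : ℕ => (((Finset.Ico (0 : ℤ) n).filter
        fun i => i + r ∈ Finset.Ico (0 : ℤ) n).card / n : ℝ)) atTop (𝓝 1) := by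
      have hlim : Tendsto (fun n : ℕ => 1 - (r.natAbs : ℝ) / n) atTop (𝓝 (1 - 0)) :=
        tendsto_const_nhds.sub (tendsto_const_div_atTop_nhds_zero_nat _)
      rw [sub_zero] at hlim
      refine tendsto_of_tendsto_of_tendsto_of_le_of_le' hlim tendsto_const_nhds ?_ ?_
      · filter_upwards [eventually_gt_atTop 0] with n hn
        have hn' : (0 : ℝ) < n := by exact_mod_cast hn
        rw [le_div_iff₀ hn', sub_mul, div_mul_cancel₀ _ hn'.ne', one_mul, sub_le_iff_le_add]
        have : (Finset.Ico (0 : ℤ) n).card ≤ ((Finset.Ico (0 : ℤ) n).filter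
          fun i => i + r ∈ Finset.Ico (0 : ℤ) n).card + r.natAbs := by
          have hsub : (Finset.Ico (max 0 (-r)) (min n (n - r))) ⊆ ((Finset.Ico (0 : ℤ) n).filter
            fun i => i + r ∈ Finset.Ico (0 : ℤ) n) := by
            intro i hi
            simp only [Finset.mem_Ico, Finset.mem_filter, max_le_iff, lt_min_iff] at *
            omega
          have := Finset.card_le_card hsub
          rw [Int.card_Ico] at *
          omega
        simp only [Int.card_Ico, sub_zero, Int.toNat_natCast] at this
        exact_mod_cast this
      · filter_upwards [eventually_gt_atTop 0] with n hn
        have hn' : (0 : ℝ) < n := by exact_mod_cast hn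
        rw [div_le_one hn']
        have := Finset.card_filter_le (Finset.Ico (0 : ℤ) n) fun i => i + r ∈ Finset.Ico (0 : ℤ) n
        simp only [Int.card_Ico, sub_zero, Int.toNat_natCast] at this
        exact_mod_cast this
    simpa using this.mul_const (c r)
  · filter_upwards [eventually_gt_atTop 0] with n hn r
    have hn' : (0 : ℝ) < n := by exact_mod_cast hn
    rw [norm_mul, Real.norm_eq_abs, Real.norm_eq_abs]
    refine mul_le_of_le_one_left (abs_nonneg _) ?_
    rw [abs_of_nonneg (by positivity), div_le_one hn']
    have := Finset.card_filter_le (Finset.Ico (0 : ℤ) n) fun i => i + r ∈ Finset.Ico (0 : ℤ) n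
    simp only [Int.card_Ico, sub_zero, Int.toNat_natCast] at this
    exact_mod_cast this

lemma SI_var_lim (S : Std P X Z b Cb G l0 Ca) (hg : GoodFn P X Z G l0 g B C) :
    Tendsto (fun n : ℕ => (∫ ω, SI X g (Finset.Ico 0 n) ω ^ 2 ∂P) / n) atTop
      (𝓝 (∑' r, cv P X g r)) := by
  have := var_lim _ (cv_summable S hg)
  simpa only [SI_sq S hg] using this

lemma tsum_cv_nonneg (S : Std P X Z b Cb G l0 Ca) (hg : GoodFn P X Z G l0 g B C) :
    0 ≤ ∑' r, cv P X g r :=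
  ge_of_tendsto' (SI_var_lim S hg) fun n => div_nonneg (integral_nonneg fun _ => sq_nonneg _) (by positivity)

end
end UQuantile

namespace UQuantile

variable {Ω : Type*} [MeasurableSpace Ω]

section
variable {P : Measure Ω} [IsProbabilityMeasure P] {X Z : ℤ → Ω → ℝ} {b : ℕ → ℝ} {Cb : ℝ}
    {G : (l : ℕ) → (Fin (2 * l + 1) → ℝ) → ℤ} {l0 : ℕ} {Ca : ℝ}
    {h : ℝ → ℝ → ℝ → ℝ} {M : ℝ}

lemma Std.inner_mono (S : Std P X Z b Cb G l0 Ca) (hker : IsUQKernel h)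
    (hM : ∀ x y t, h x y t ≤ M) (x : ℝ) {s t : ℝ} (hst : s ≤ t) :
    ∫ y, h x y s ∂(P.map (X 0)) ≤ ∫ y, h x y t ∂(P.map (X 0)) := by
  have hp := S.isProb
  refine integral_mono ?_ ?_ fun y => hker.mono x y hst
  · exact int_bdd (meas_h hker s measurable_const measurable_id) (M := M) fun y => by
      rw [abs_of_nonneg (hker.nonneg _ _ _)]; exact hM _ _ _
  · exact int_bdd (meas_h hker t measurable_const measurable_id) (M := M) fun y => by
      rw [abs_of_nonneg (hker.nonneg _ _ _)]; exact hM _ _ _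

lemma Std.U_inner (S : Std P X Z b Cb G l0 Ca) (hker : IsUQKernel h) (t : ℝ) :
    Udist (P.map (X 0)) h t = ∫ ω, ∫ y, h (X 0 ω) y t ∂(P.map (X 0)) ∂P := by
  rw [S.U_eq hker]; simp only [S.inner_eq hker]

lemma Std.U_mono (S : Std P X Z b Cb G l0 Ca) (hker : IsUQKernel h)
    (hM : ∀ x y t, h x y t ≤ M) {s t : ℝ} (hst : s ≤ t) :
    Udist (P.map (X 0)) h s ≤ Udist (P.map (X 0)) h t := by
  rw [S.U_inner hker, S.U_inner hker]
  exact integral_mono (S.int_inner hker hM s) (S.int_inner hker hM t)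
    fun ω => S.inner_mono hker hM _ hst

lemma Std.inner_incr (S : Std P X Z b Cb G l0 Ca) (hker : IsUQKernel h)
    (hM : ∀ x y t, h x y t ≤ M) {s t : ℝ} (hst : s ≤ t) :
    ∫ ω, |(∫ y, h (X 0 ω) y t ∂(P.map (X 0))) - ∫ y, h (X 0 ω) y s ∂(P.map (X 0))| ∂P
      ≤ |Udist (P.map (X 0)) h t - Udist (P.map (X 0)) h s| := by
  have : ∀ ω, |(∫ y, h (X 0 ω) y t ∂(P.map (X 0))) - ∫ y, h (X 0 ω) y s ∂(P.map (X 0))|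
      = (∫ y, h (X 0 ω) y t ∂(P.map (X 0))) - ∫ y, h (X 0 ω) y s ∂(P.map (X 0)) := fun ω =>
    abs_of_nonneg (sub_nonneg.2 (S.inner_mono hker hM _ hst))
  simp only [this]
  rw [integral_sub (S.int_inner hker hM t) (S.int_inner hker hM s), ← S.U_inner hker, ← S.U_inner hker]
  exact le_abs_self _

lemma Std.h1_incr (S : Std P X Z b Cb G l0 Ca) (hker : IsUQKernel h)
    (hM : ∀ x y t, h x y t ≤ M) (s t : ℝ) :
    ∫ ω, |h1 (P.map (X 0)) h (X 0 ω) t - h1 (P.map (X 0)) h (X 0 ω) s| ∂P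
      ≤ 2 * |Udist (P.map (X 0)) h t - Udist (P.map (X 0)) h s| := by
  have key : ∫ ω, |(∫ y, h (X 0 ω) y t ∂(P.map (X 0))) - ∫ y, h (X 0 ω) y s ∂(P.map (X 0))| ∂P
      ≤ |Udist (P.map (X 0)) h t - Udist (P.map (X 0)) h s| := by
    rcases le_total s t with hst | hst
    · exact S.inner_incr hker hM hst
    · have := S.inner_incr hker hM hst
      rw [abs_sub_comm (Udist _ _ t)]
      simpa only [abs_sub_comm] using this
  have i1 : Integrable (fun ω => |(∫ y, h (X 0 ω) y t ∂(P.map (X 0)))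
      - ∫ y, h (X 0 ω) y s ∂(P.map (X 0))|) P :=
    ((S.int_inner hker hM t).sub (S.int_inner hker hM s)).abs
  calc _ ≤ ∫ ω, (|(∫ y, h (X 0 ω) y t ∂(P.map (X 0))) - ∫ y, h (X 0 ω) y s ∂(P.map (X 0))|
        + |Udist (P.map (X 0)) h t - Udist (P.map (X 0)) h s|) ∂P := by
        refine integral_mono ?_ (i1.add (integrable_const _)) fun ω => ?_
        · exact (((S.int_inner hker hM t).sub (integrable_const _)).sub
            ((S.int_inner hker hM s).sub (integrable_const _))).abs
        · refine le_trans (le_of_eq ?_) (abs_sub _ _)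
          congr 1
          unfold h1; ring
    _ ≤ _ := by
        rw [integral_add i1 (integrable_const _), integral_const]
        simp only [probReal_univ, smul_eq_mul, one_mul]
        linarith

lemma Std.h1_incr_var (S : Std P X Z b Cb G l0 Ca) (hker : IsUQKernel h)
    (hM : ∀ x y t, h x y t ≤ M) {L t0 : ℝ} (hL : 0 ≤ L) (t : ℕ → ℝ)
    (hv : ∀ n, VariationAt (P.map (X 0)) h L (t n)) (hv0 : VariationAt (P.map (X 0)) h L t0)
    (hU : Tendsto (fun n => Udist (P.map (X 0)) h (t n)) atTop (𝓝 (Udist (P.map (X 0)) h t0))) :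
    Tendsto (fun n : ℕ => (∫ ω, SI X (fun x => h1 (P.map (X 0)) h x (t n) - h1 (P.map (X 0)) h x t0)
      (Finset.Icc 1 (n : ℤ)) ω ^ 2 ∂P) / n) atTop (𝓝 0) := by
  have hg := fun n => GoodFn.sub S (S.h1_good hker hM hL (hv n)) (S.h1_good hker hM hL hv0)
  set A := G0 Cb l0 (M + M) (2 * CA L M Ca + 2 * CA L M Ca) with hA
  have A0 : 0 ≤ A := G0_nonneg S (hg 0)
  have M0 : 0 ≤ M := (hker.nonneg 0 0 0).trans (hM 0 0 0)
  set e : ℕ → ℝ := fun n => (M + M) * (2 * |Udist (P.map (X 0)) h (t n) - Udist (P.map (X 0)) h t0|) with he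
  have e0 : ∀ n, 0 ≤ e n := fun n => by positivity
  have elim : Tendsto e atTop (𝓝 0) := by
    have : Tendsto (fun n => |Udist (P.map (X 0)) h (t n) - Udist (P.map (X 0)) h t0|) atTop (𝓝 0) := by
      simpa using (hU.sub_const (Udist (P.map (X 0)) h t0)).abs
    simpa using (this.const_mul 2).const_mul (M + M)
  have c2 : ∀ n r, |cv P X (fun x => h1 (P.map (X 0)) h x (t n) - h1 (P.map (X 0)) h x t0) r| ≤ e n := by
    intro n r
    refine abs_integral_le_integral_abs.trans ?_
    calc _ ≤ ∫ ω, (M + M) * |h1 (P.map (X 0)) h (X 0 ω) (t n) - h1 (P.map (X 0)) h (X 0 ω) t0| ∂P := by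
          refine integral_mono ((hg n).int_XX S 0 r).abs ((((hg n).int_X S 0).abs).const_mul _) fun ω => ?_
          dsimp only
          rw [abs_mul, mul_comm]
          exact mul_le_mul_of_nonneg_right ((hg n).bd _) (abs_nonneg _)
      _ ≤ _ := by
          rw [integral_const_mul]
          exact mul_le_mul_of_nonneg_left (S.h1_incr hker hM _ _) (by positivity)
  have sd : ∀ n, Summable fun r : ℤ => min (A * dw r) (e n) := fun n =>
    Summable.of_nonneg_of_le (fun r => le_min (mul_nonneg A0 (dw_pos r).le) (e0 n))
      (fun r => min_le_left _ _) (summable_dw.mul_left A)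
  have hlim : Tendsto (fun n => ∑' r : ℤ, min (A * dw r) (e n)) atTop (𝓝 (∑' r : ℤ, (0 : ℝ))) := by
    refine tendsto_tsum_of_dominated_convergence (bound := fun r => A * dw r) (summable_dw.mul_left A) ?_ ?_
    · intro r
      have := (tendsto_const_nhds (x := A * dw r) (f := atTop (α := ℕ))).min elim
      rwa [min_eq_right (mul_nonneg A0 (dw_pos r).le)] at this
    · refine Eventually.of_forall fun n r => ?_
      rw [Real.norm_eq_abs, abs_of_nonneg (le_min (mul_nonneg A0 (dw_pos r).le) (e0 n))]
      exact min_le_left _ _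
  rw [tsum_zero] at hlim
  refine squeeze_zero (fun n => div_nonneg (integral_nonneg fun _ => sq_nonneg _) (by positivity)) (fun n => ?_) hlim
  have := SI_sq_le' S (hg n) (sd n) (fun r => le_min (cv_le S (hg n) r) (c2 n r)) (Finset.Icc 1 (n : ℤ))
  have s0 : 0 ≤ ∑' r : ℤ, min (A * dw r) (e n) :=
    tsum_nonneg fun r => le_min (mul_nonneg A0 (dw_pos r).le) (e0 n)
  simp only [Int.card_Icc, add_sub_cancel_right, Int.toNat_natCast] at this
  refine div_le_of_le_mul₀ (by positivity) s0 ?_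
  rw [mul_comm]; exact this

end
end UQuantile

namespace UQuantile

variable {Ω : Type*} [MeasurableSpace Ω]

/-- `exp (i x)` -/
def ee (x : ℝ) : ℂ := Complex.exp (x * Complex.I)

lemma ee_norm (x : ℝ) : ‖ee x‖ = 1 := Complex.norm_exp_ofReal_mul_I x

lemma ee_add (x y : ℝ) : ee (x + y) = ee x * ee y := by
  unfold ee; rw [← Complex.exp_add]; push_cast; ring_nf

lemma ee_cont : Continuous ee := by unfold ee; fun_prop

lemma ee_eq (x : ℝ) : ee x = (Real.cos x : ℂ) + (Real.sin x : ℂ) * Complex.I := by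
  unfold ee; rw [Complex.exp_mul_I]; push_cast; rfl

lemma ee_lip (x y : ℝ) : ‖ee x - ee y‖ ≤ |x - y| := by
  have h1 : ee x - ee y = ee y * (ee (x - y) - 1) := by
    rw [mul_sub, ← ee_add]; simp
  rw [h1, norm_mul, ee_norm, one_mul]
  have := Real.norm_exp_I_mul_ofReal_sub_one_le (x := x - y)
  unfold ee
  rw [mul_comm]
  simpa using this

section
variable {P : Measure Ω} [IsProbabilityMeasure P] {X Z : ℤ → Ω → ℝ} {b : ℕ → ℝ} {Cb : ℝ}
    {G : (l : ℕ) → (Fin (2 * l + 1) → ℝ) → ℤ} {l0 : ℕ} {Ca : ℝ}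
    {g : ℝ → ℝ} {B C : ℝ}

lemma ee_int {f : Ω → ℝ} (hf : Measurable f) : Integrable (fun ω => ee (f ω)) P :=
  Integrable.of_bound (ee_cont.measurable.comp hf).aestronglyMeasurable 1
    (Eventually.of_forall fun ω => (ee_norm _).le)

lemma ee_integral {f : Ω → ℝ} (hf : Measurable f) :
    ∫ ω, ee (f ω) ∂P = ((∫ ω, Real.cos (f ω) ∂P : ℝ) : ℂ) + ((∫ ω, Real.sin (f ω) ∂P : ℝ) : ℂ) * Complex.I := by
  have i1 : Integrable (fun ω => ((Real.cos (f ω) : ℝ) : ℂ)) P :=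
    (int_bdd (Real.measurable_cos.comp hf) (M := 1) fun _ => Real.abs_cos_le_one _).ofReal
  have i2 : Integrable (fun ω => ((Real.sin (f ω) : ℝ) : ℂ)) P :=
    (int_bdd (Real.measurable_sin.comp hf) (M := 1) fun _ => Real.abs_sin_le_one _).ofReal
  simp only [ee_eq]
  rw [integral_add i1 (i2.mul_const _), integral_mul_const, integral_complex_ofReal, integral_complex_ofReal]

lemma ee_integral_le (f : Ω → ℝ) : ‖∫ ω, ee (f ω) ∂P‖ ≤ 1 := by
  have := norm_integral_le_of_norm_le_const (μ := P) (f := fun ω => ee (f ω)) (C := 1)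
    (Eventually.of_forall fun ω => (ee_norm _).le)
  simpa using this

lemma ee_integral_lip {f k : Ω → ℝ} (hf : Measurable f) (hk : Measurable k)
    (hi : Integrable (fun ω => |f ω - k ω|) P) :
    ‖(∫ ω, ee (f ω) ∂P) - ∫ ω, ee (k ω) ∂P‖ ≤ ∫ ω, |f ω - k ω| ∂P := by
  rw [← integral_sub (ee_int hf) (ee_int hk)]
  exact norm_integral_le_of_norm_le hi (Eventually.of_forall fun ω => ee_lip _ _)

/-- sums of window functionals -/
def SN (Z : ℤ → Ω → ℝ) {l : ℕ} (G : (Fin (2 * l + 1) → ℝ) → ℤ) (y : ℤ → ℝ) (I : Finset ℤ) (ω : Ω) : ℝ :=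
  ∑ i ∈ I, y (Nw Z G i ω)

lemma SN_meas (S : Std P X Z b Cb G l0 Ca) (l : ℕ) (y : ℤ → ℝ) (I : Finset ℤ) :
    Measurable (SN Z (G l) y I) :=
  Finset.measurable_sum _ fun i _ => (measurable_of_countable y).comp (S.hN l i)

lemma norm_cplx (a c a' c' e : ℝ) (h1 : |a - a'| ≤ e) (h2 : |c - c'| ≤ e) :
    ‖((a : ℂ) + (c : ℂ) * Complex.I) - ((a' : ℂ) + (c' : ℂ) * Complex.I)‖ ≤ 2 * e := by
  have : ((a : ℂ) + (c : ℂ) * Complex.I) - ((a' : ℂ) + (c' : ℂ) * Complex.I)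
    = ((a - a' : ℝ) : ℂ) + ((c - c' : ℝ) : ℂ) * Complex.I := by push_cast; ring
  rw [this]
  refine (norm_add_le _ _).trans ?_
  rw [norm_mul, Complex.norm_I, mul_one, Complex.norm_real, Complex.norm_real]
  simp only [Real.norm_eq_abs]
  linarith

lemma decouple_sets (S : Std P X Z b Cb G l0 Ca) (l : ℕ) (y : ℤ → ℝ) (θ : ℝ) (I1 I2 : Finset ℤ) (c : ℤ)
    (q : ℕ) (h1 : ∀ i ∈ I1, i + l ≤ c) (h2 : ∀ i ∈ I2, c + q ≤ i - l) :
    ‖(∫ ω, ee (θ * (SN Z (G l) y I1 ω + SN Z (G l) y I2 ω)) ∂P)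
      - (∫ ω, ee (θ * SN Z (G l) y I1 ω) ∂P) * (∫ ω, ee (θ * SN Z (G l) y I2 ω) ∂P)‖ ≤ 4 * b q := by
  have m1 := (SN_meas S l y I1).const_mul θ
  have m2 := (SN_meas S l y I2).const_mul θ
  have m3 : Measurable fun ω => θ * (SN Z (G l) y I1 ω + SN Z (G l) y I2 ω) :=
    ((SN_meas S l y I1).add (SN_meas S l y I2)).const_mul θ
  have key : ∀ φ : ℝ → ℝ, (∀ x, |φ x| ≤ 1) →
      |(∫ ω, φ (θ * (SN Z (G l) y I1 ω + SN Z (G l) y I2 ω)) ∂P)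
        - ∫ ω, ∫ ω', φ (θ * (SN Z (G l) y I1 ω + SN Z (G l) y I2 ω')) ∂P ∂P| ≤ 2 * b q := by
    intro φ hφ
    have := decouple S.hX S.hZ S.hs S.hβ (S.hG l) (ι := I1 ⊕ I2) (Sum.elim (fun i => (i : ℤ)) (fun i => (i : ℤ)))
      (fun i => i.isLeft = true) c q
      (by rintro (i | i) hi
          · exact h1 i i.2
          · simp at hi)
      (by rintro (i | i) hi
          · simp at hi
          · exact h2 i i.2)
      (fun x => φ (θ * ∑ i, y (x i))) (M := 1) (fun x => hφ _)
    simp only [Fintype.sum_sum_type, Sum.elim_inl, Sum.elim_inr, Sum.isLeft_inl, Sum.isLeft_inr,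
      if_true, Bool.false_eq_true, if_false, mul_one] at this
    have e : ∀ (I : Finset ℤ) ω, ∑ i : I, y (Nw Z (G l) i ω) = SN Z (G l) y I ω := fun I ω =>
      Finset.sum_coe_sort I (fun i => y (Nw Z (G l) i ω))
    simpa only [e] using this
  have e2 : (∫ ω, ee (θ * SN Z (G l) y I1 ω) ∂P) * (∫ ω, ee (θ * SN Z (G l) y I2 ω) ∂P)
      = ((∫ ω, ∫ ω', Real.cos (θ * (SN Z (G l) y I1 ω + SN Z (G l) y I2 ω')) ∂P ∂P : ℝ) : ℂ)
        + ((∫ ω, ∫ ω', Real.sin (θ * (SN Z (G l) y I1 ω + SN Z (G l) y I2 ω')) ∂P ∂P : ℝ) : ℂ) * Complex.I := by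
    have mc : Measurable fun ω => Real.cos (θ * SN Z (G l) y I1 ω) := Real.measurable_cos.comp m1
    have ms : Measurable fun ω => Real.sin (θ * SN Z (G l) y I1 ω) := Real.measurable_sin.comp m1
    have ic1 : Integrable (fun ω => Real.cos (θ * SN Z (G l) y I1 ω)) P :=
      int_bdd mc (M := 1) fun _ => Real.abs_cos_le_one _
    have is1 : Integrable (fun ω => Real.sin (θ * SN Z (G l) y I1 ω)) P :=
      int_bdd ms (M := 1) fun _ => Real.abs_sin_le_one _
    have ic2 : Integrable (fun ω => Real.cos (θ * SN Z (G l) y I2 ω)) P :=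
      int_bdd (Real.measurable_cos.comp m2) (M := 1) fun _ => Real.abs_cos_le_one _
    have is2 : Integrable (fun ω => Real.sin (θ * SN Z (G l) y I2 ω)) P :=
      int_bdd (Real.measurable_sin.comp m2) (M := 1) fun _ => Real.abs_sin_le_one _
    simp only [mul_add, Real.cos_add, Real.sin_add]
    have f1 : ∀ ω, ∫ ω', (Real.cos (θ * SN Z (G l) y I1 ω) * Real.cos (θ * SN Z (G l) y I2 ω')
        - Real.sin (θ * SN Z (G l) y I1 ω) * Real.sin (θ * SN Z (G l) y I2 ω')) ∂P
        = Real.cos (θ * SN Z (G l) y I1 ω) * (∫ ω', Real.cos (θ * SN Z (G l) y I2 ω') ∂P)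
        - Real.sin (θ * SN Z (G l) y I1 ω) * (∫ ω', Real.sin (θ * SN Z (G l) y I2 ω') ∂P) := fun ω => by
      rw [integral_sub (ic2.const_mul _) (is2.const_mul _), integral_const_mul, integral_const_mul]
    have f2 : ∀ ω, ∫ ω', (Real.sin (θ * SN Z (G l) y I1 ω) * Real.cos (θ * SN Z (G l) y I2 ω')
        + Real.cos (θ * SN Z (G l) y I1 ω) * Real.sin (θ * SN Z (G l) y I2 ω')) ∂P
        = Real.sin (θ * SN Z (G l) y I1 ω) * (∫ ω', Real.cos (θ * SN Z (G l) y I2 ω') ∂P)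
        + Real.cos (θ * SN Z (G l) y I1 ω) * (∫ ω', Real.sin (θ * SN Z (G l) y I2 ω') ∂P) := fun ω => by
      rw [integral_add (ic2.const_mul _) (is2.const_mul _), integral_const_mul, integral_const_mul]
    simp only [f1, f2]
    rw [integral_sub (ic1.mul_const _) (is1.mul_const _), integral_add (is1.mul_const _) (ic1.mul_const _)]
    simp only [integral_mul_const]
    rw [ee_integral m1, ee_integral m2]
    push_cast
    linear_combination (((∫ ω, Real.sin (θ * SN Z (G l) y I1 ω) ∂P : ℝ) : ℂ)
      * ((∫ ω, Real.sin (θ * SN Z (G l) y I2 ω) ∂P : ℝ) : ℂ)) * Complex.I_sq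
  rw [e2, ee_integral m3]
  have := norm_cplx _ _ _ _ _ (key Real.cos Real.abs_cos_le_one) (key Real.sin Real.abs_sin_le_one)
  linarith

lemma stat_SN (S : Std P X Z b Cb G l0 Ca) (l : ℕ) (y : ℤ → ℝ) (θ : ℝ) (a : ℤ) (Q : ℕ) :
    ∫ ω, ee (θ * SN Z (G l) y (Finset.Ico a (a + Q)) ω) ∂P
      = ∫ ω, ee (θ * SN Z (G l) y (Finset.Ico 0 (Q : ℤ)) ω) ∂P := by
  rw [ee_integral ((SN_meas S l y _).const_mul θ), ee_integral ((SN_meas S l y _).const_mul θ)]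
  have e : Finset.Ico a (a + Q) = (Finset.Ico (0 : ℤ) Q).map (addLeftEmbedding a) := by
    rw [Finset.map_add_left_Ico]; simp
  have key : ∀ φ : ℝ → ℝ, ∫ ω, φ (θ * SN Z (G l) y (Finset.Ico a (a + Q)) ω) ∂P
      = ∫ ω, φ (θ * SN Z (G l) y (Finset.Ico 0 (Q : ℤ)) ω) ∂P := by
    intro φ
    have := stat_N S.hX S.hZ S.hs (S.hG l) (fun i : Finset.Ico (0 : ℤ) Q => (i : ℤ)) a
      (fun x => φ (θ * ∑ i, y (x i)))
    have e1 : ∀ ω, ∑ i : Finset.Ico (0 : ℤ) Q, y (Nw Z (G l) i ω)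
        = SN Z (G l) y (Finset.Ico 0 (Q : ℤ)) ω := fun ω =>
      Finset.sum_coe_sort (Finset.Ico (0 : ℤ) Q) (fun i => y (Nw Z (G l) i ω))
    have e2 : ∀ ω, ∑ i : Finset.Ico (0 : ℤ) Q, y (Nw Z (G l) (i + a) ω)
        = SN Z (G l) y (Finset.Ico a (a + Q)) ω := fun ω => by
      rw [SN, e, Finset.sum_map]
      simp only [addLeftEmbedding_apply, add_comm a]
      exact Finset.sum_coe_sort (Finset.Ico (0 : ℤ) Q) (fun i => y (Nw Z (G l) (i + a) ω))
    simpa only [e1, e2] using this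
  rw [key Real.cos, key Real.sin]

/-- start of the `j`-th block -/
def bst (Q q : ℕ) (j : ℕ) : ℤ := 1 + (j : ℤ) * ((Q : ℤ) + q)

/-- union of the first `m` blocks -/
def blks (Q q : ℕ) : ℕ → Finset ℤ
  | 0 => ∅
  | m + 1 => blks Q q m ∪ Finset.Ico (bst Q q m) (bst Q q m + Q)

lemma blks_mem {Q q m : ℕ} {i : ℤ} (hi : i ∈ blks Q q m) : 1 ≤ i ∧ i + q < bst Q q m := by
  induction m with
  | zero => simp [blks] at hi
  | succ m ih =>
    simp only [blks, Finset.mem_union, Finset.mem_Ico] at hi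
    have e : bst Q q (m + 1) = bst Q q m + (Q + q) := by unfold bst; push_cast; ring
    have e0 : 1 ≤ bst Q q m := by 
      have : (0 : ℤ) ≤ (m : ℤ) * ((Q : ℤ) + q) := by positivity
      unfold bst; linarith
    rw [e]
    rcases hi with hi | hi
    · have := ih hi
      omega
    · omega

lemma blks_disj (Q q m : ℕ) : Disjoint (blks Q q m) (Finset.Ico (bst Q q m) (bst Q q m + Q)) := by
  rw [Finset.disjoint_left]
  intro i hi hi'
  have := blks_mem hi
  simp only [Finset.mem_Ico] at hi'
  omega

lemma blks_card (Q q m : ℕ) : (blks Q q m).card = m * Q := by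
  induction m with
  | zero => simp [blks]
  | succ m ih =>
    rw [blks, Finset.card_union_of_disjoint (blks_disj Q q m), ih]
    simp; ring

lemma norm_pow_sub {a c : ℂ} (ha : ‖a‖ ≤ 1) (hc : ‖c‖ ≤ 1) (k : ℕ) : ‖a ^ k - c ^ k‖ ≤ k * ‖a - c‖ := by
  induction k with
  | zero => simp
  | succ k ih =>
    have e : a ^ (k + 1) - c ^ (k + 1) = a ^ k * (a - c) + (a ^ k - c ^ k) * c := by ring
    rw [e]
    refine (norm_add_le _ _).trans ?_
    rw [norm_mul, norm_mul, norm_pow]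
    have h1 : ‖a‖ ^ k ≤ 1 := pow_le_one₀ (norm_nonneg _) ha
    have h2 : ‖a‖ ^ k * ‖a - c‖ ≤ 1 * ‖a - c‖ := mul_le_mul_of_nonneg_right h1 (norm_nonneg _)
    have h3 : ‖a ^ k - c ^ k‖ * ‖c‖ ≤ ‖a ^ k - c ^ k‖ * 1 := mul_le_mul_of_nonneg_left hc (norm_nonneg _)
    push_cast
    linarith

lemma blocks_decouple (S : Std P X Z b Cb G l0 Ca) (l : ℕ) (y : ℤ → ℝ) (θ : ℝ) (Q q : ℕ)
    (hq : 2 * l ≤ q) (k : ℕ) :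
    ‖(∫ ω, ee (θ * SN Z (G l) y (blks Q q k) ω) ∂P)
      - (∫ ω, ee (θ * SN Z (G l) y (Finset.Ico 0 (Q : ℤ)) ω) ∂P) ^ k‖ ≤ k * (4 * b (q - 2 * l)) := by
  induction k with
  | zero => simp [blks, SN, ee]
  | succ k ih =>
    set φ := ∫ ω, ee (θ * SN Z (G l) y (Finset.Ico 0 (Q : ℤ)) ω) ∂P with hφ
    have h1 := decouple_sets (P := P) S l y θ (blks Q q k) (Finset.Ico (bst Q q k) (bst Q q k + Q))
      (bst Q q k - q + l) (q - 2 * l) (fun i hi => by have := blks_mem hi; omega)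
      (fun i hi => by simp only [Finset.mem_Ico] at hi; omega)
    rw [stat_SN S l y θ (bst Q q k) Q, ← hφ] at h1
    have e1 : ∀ ω, SN Z (G l) y (blks Q q (k + 1)) ω = SN Z (G l) y (blks Q q k) ω
        + SN Z (G l) y (Finset.Ico (bst Q q k) (bst Q q k + Q)) ω := fun ω => by
      rw [SN, blks, Finset.sum_union (blks_disj Q q k)]; rfl
    simp only [e1]
    set T := ∫ ω, ee (θ * SN Z (G l) y (blks Q q k) ω) ∂P
    have h2 : ‖T * φ - φ ^ k * φ‖ ≤ k * (4 * b (q - 2 * l)) := by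
      rw [← sub_mul, norm_mul]
      have : ‖φ‖ ≤ 1 := ee_integral_le _
      calc _ ≤ ‖T - φ ^ k‖ * 1 := mul_le_mul_of_nonneg_left this (norm_nonneg _)
        _ ≤ _ := by rw [mul_one]; exact ih
    have := norm_sub_le_norm_sub_add_norm_sub (∫ ω, ee (θ * (SN Z (G l) y (blks Q q k) ω
        + SN Z (G l) y (Finset.Ico (bst Q q k) (bst Q q k + Q)) ω)) ∂P) (T * φ) (φ ^ k * φ)
    rw [pow_succ]
    push_cast
    linarith

end
end UQuantile

namespace UQuantile

variable {Ω : Type*} [MeasurableSpace Ω]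

section
variable {P : Measure Ω} [IsProbabilityMeasure P] {X Z : ℤ → Ω → ℝ} {b : ℕ → ℝ} {Cb : ℝ}
    {G : (l : ℕ) → (Fin (2 * l + 1) → ℝ) → ℤ} {l0 : ℕ} {Ca : ℝ}
    {g : ℝ → ℝ} {B C : ℝ}

lemma L1_le_L2 {f : Ω → ℝ} (hf : Measurable f) {M : ℝ} (hM : ∀ x, |f x| ≤ M) :
    ∫ ω, |f ω| ∂P ≤ Real.sqrt (∫ ω, f ω ^ 2 ∂P) := by
  apply Real.le_sqrt_of_sq_le
  have i1 : Integrable (fun ω => |f ω|) P := int_bdd hf.abs (M := M) fun x => by rw [abs_abs]; exact hM x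
  have i2 : Integrable (fun ω => f ω ^ 2) P := int_bdd (hf.pow_const 2) (M := M ^ 2) fun x => by
    rw [abs_pow]; exact pow_le_pow_left₀ (abs_nonneg _) (hM x) 2
  set m := ∫ ω, |f ω| ∂P
  have h0 : 0 ≤ ∫ ω, (|f ω| - m) ^ 2 ∂P := integral_nonneg fun _ => sq_nonneg _
  have e : ∀ ω, (|f ω| - m) ^ 2 = f ω ^ 2 - (2 * m * |f ω| - m ^ 2) := fun ω => by
    rw [sub_sq, sq_abs]; ring
  simp only [e] at h0
  have i3 : Integrable (fun ω => 2 * m * |f ω|) P := i1.const_mul _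
  have i4 : Integrable (fun ω => 2 * m * |f ω| - m ^ 2) P := i3.sub (integrable_const _)
  rw [integral_sub i2 i4, integral_sub i3 (integrable_const _), integral_const_mul] at h0
  simp only [integral_const, probReal_univ, one_smul] at h0
  have : 2 * m * (∫ ω, |f ω| ∂P) = 2 * m * m := rfl
  nlinarith

/-- variance constant -/
def Gam (Cb : ℝ) (l0 : ℕ) (B C : ℝ) : ℝ := G0 Cb l0 B C * ∑' r, dw r

lemma Gam_nonneg (S : Std P X Z b Cb G l0 Ca) (hg : GoodFn P X Z G l0 g B C) : 0 ≤ Gam Cb l0 B C :=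
  mul_nonneg (G0_nonneg S hg) (tsum_nonneg fun r => (dw_pos r).le)

lemma ee_sub_blocks (S : Std P X Z b Cb G l0 Ca) (hg : GoodFn P X Z G l0 g B C) (θ : ℝ)
    (I J : Finset ℤ) (hJ : J ⊆ I) :
    ‖(∫ ω, ee (θ * SI X g I ω) ∂P) - ∫ ω, ee (θ * SI X g J ω) ∂P‖
      ≤ |θ| * Real.sqrt (((I \ J).card : ℝ) * Gam Cb l0 B C) := by
  have e : ∀ ω, |θ * SI X g I ω - θ * SI X g J ω| = |θ| * |SI X g (I \ J) ω| := fun ω => by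
    rw [← mul_sub, abs_mul]
    congr 2
    unfold SI
    rw [← Finset.sum_sdiff hJ]; ring
  have i0 : Integrable (fun ω => |SI X g (I \ J) ω|) P :=
    int_bdd (SI_meas S hg _).abs (M := (I \ J).card * B) fun ω => by rw [abs_abs]; exact SI_abs hg _ _
  have i1 : Integrable (fun ω => |θ * SI X g I ω - θ * SI X g J ω|) P := by
    simp only [e]; exact i0.const_mul _
  refine (ee_integral_lip ((SI_meas S hg I).const_mul θ) ((SI_meas S hg J).const_mul θ) i1).trans ?_
  simp only [e]
  rw [integral_const_mul]
  refine mul_le_mul_of_nonneg_left ?_ (abs_nonneg _)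
  refine (L1_le_L2 (SI_meas S hg _) (SI_abs hg (I \ J))).trans ?_
  exact Real.sqrt_le_sqrt (SI_sq_le S hg _)

lemma ee_replace (S : Std P X Z b Cb G l0 Ca) (hg : GoodFn P X Z G l0 g B C) (θ : ℝ) {l : ℕ}
    {gl : ℤ → ℝ} (h1 : ∀ a, |gl a| ≤ B)
    (h2 : ∀ i, ∫ ω, |g (X i ω) - gl (Nw Z (G l) i ω)| ∂P ≤ C / (l : ℝ) ^ 3) (I : Finset ℤ) :
    ‖(∫ ω, ee (θ * SI X g I ω) ∂P) - ∫ ω, ee (θ * SN Z (G l) gl I ω) ∂P‖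
      ≤ |θ| * (I.card * (C / (l : ℝ) ^ 3)) := by
  have e : ∀ ω, |θ * SI X g I ω - θ * SN Z (G l) gl I ω| = |θ| * |SI X g I ω - SN Z (G l) gl I ω| :=
    fun ω => by rw [← mul_sub, abs_mul]
  have mi : ∀ i, Measurable fun ω => g (X i ω) - gl (Nw Z (G l) i ω) := fun i =>
    (hg.meas_X S i).sub ((measurable_of_countable gl).comp (S.hN l i))
  have ii : ∀ i, Integrable (fun ω => |g (X i ω) - gl (Nw Z (G l) i ω)|) P := fun i =>
    int_bdd (mi i).abs (M := B + B) fun ω => by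
      rw [abs_abs]; exact (abs_sub _ _).trans (add_le_add (hg.bd _) (h1 _))
  have i2 : Integrable (fun ω => ∑ i ∈ I, |g (X i ω) - gl (Nw Z (G l) i ω)|) P :=
    integrable_finsetSum _ fun i _ => ii i
  have hle : ∀ ω, |SI X g I ω - SN Z (G l) gl I ω| ≤ ∑ i ∈ I, |g (X i ω) - gl (Nw Z (G l) i ω)| := fun ω => by
    unfold SI SN
    rw [← Finset.sum_sub_distrib]
    exact Finset.abs_sum_le_sum_abs _ _
  have i0 : Integrable (fun ω => |SI X g I ω - SN Z (G l) gl I ω|) P :=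
    i2.mono' ((SI_meas S hg I).sub (SN_meas S l gl I)).abs.aestronglyMeasurable
      (Eventually.of_forall fun ω => by rw [Real.norm_eq_abs, abs_abs]; exact hle ω)
  have i1 : Integrable (fun ω => |θ * SI X g I ω - θ * SN Z (G l) gl I ω|) P := by
    simp only [e]; exact i0.const_mul _
  refine (ee_integral_lip ((SI_meas S hg I).const_mul θ) ((SN_meas S l gl I).const_mul θ) i1).trans ?_
  simp only [e]
  rw [integral_const_mul]
  refine mul_le_mul_of_nonneg_left ?_ (abs_nonneg _)
  refine (integral_mono i0 i2 hle).trans ?_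
  rw [integral_finsetSum _ fun i _ => ii i]
  calc _ ≤ ∑ i ∈ I, C / (l : ℝ) ^ 3 := Finset.sum_le_sum fun i _ => h2 i
    _ = _ := by simp

lemma clt_bound (S : Std P X Z b Cb G l0 Ca) (hg : GoodFn P X Z G l0 g B C) (θ : ℝ) {l Q q k n : ℕ}
    (hl : l0 ≤ l) (hq : 2 * l ≤ q) (hn : k * (Q + q) ≤ n) :
    ‖(∫ ω, ee (θ * SI X g (Finset.Icc 1 (n : ℤ)) ω) ∂P)
        - (∫ ω, ee (θ * SI X g (Finset.Ico 0 (Q : ℤ)) ω) ∂P) ^ k‖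
      ≤ |θ| * Real.sqrt (((n : ℝ) - k * Q) * Gam Cb l0 B C) + 2 * (|θ| * (n * (C / (l : ℝ) ^ 3)))
        + k * (4 * b (q - 2 * l)) := by
  obtain ⟨gl, h1, h2⟩ := hg.app' S hl
  have hsub : blks Q q k ⊆ Finset.Icc 1 (n : ℤ) := by
    intro i hi
    have := blks_mem hi
    rw [Finset.mem_Icc]
    refine ⟨this.1, ?_⟩
    have h3 : ((k * (Q + q) : ℕ) : ℤ) ≤ n := by exact_mod_cast hn
    push_cast at h3
    unfold bst at this
    omega
  have hkQ : k * Q ≤ n := le_trans (Nat.mul_le_mul_left k (Nat.le_add_right Q q)) hn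
  have hkQ' : (k : ℝ) * Q ≤ n := by exact_mod_cast hkQ
  have hc : ((Finset.Icc 1 (n : ℤ) \ blks Q q k).card : ℝ) = (n : ℝ) - k * Q := by
    rw [Finset.card_sdiff_of_subset hsub, blks_card]
    simp [Nat.cast_sub hkQ]
  have A := ee_sub_blocks S hg θ _ _ hsub
  rw [hc] at A
  have B1 := ee_replace S hg θ h1 h2 (blks Q q k)
  have B2 := ee_replace S hg θ h1 h2 (Finset.Ico 0 (Q : ℤ))
  have D := blocks_decouple S l gl θ Q q hq k
  have E := (norm_pow_sub (ee_integral_le (P := P) fun ω => θ * SI X g (Finset.Ico 0 (Q : ℤ)) ω)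
    (ee_integral_le (P := P) fun ω => θ * SN Z (G l) gl (Finset.Ico 0 (Q : ℤ)) ω) k)
  have hC : 0 ≤ C / (l : ℝ) ^ 3 := div_nonneg hg.C0 (by positivity)
  have hm : |θ| * ((k : ℝ) * Q * (C / (l : ℝ) ^ 3)) ≤ |θ| * (n * (C / (l : ℝ) ^ 3)) :=
    mul_le_mul_of_nonneg_left (mul_le_mul_of_nonneg_right hkQ' hC) (abs_nonneg _)
  rw [blks_card] at B1
  push_cast at B1
  have hcQ : ((Finset.Ico 0 (Q : ℤ)).card : ℝ) = Q := by simp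
  rw [hcQ] at B2
  have B3 := E.trans (mul_le_mul_of_nonneg_left B2 (Nat.cast_nonneg k))
  set a1 := ∫ ω, ee (θ * SI X g (Finset.Icc 1 (n : ℤ)) ω) ∂P
  set a2 := ∫ ω, ee (θ * SI X g (blks Q q k) ω) ∂P
  set a3 := ∫ ω, ee (θ * SN Z (G l) gl (blks Q q k) ω) ∂P
  set a4 := (∫ ω, ee (θ * SN Z (G l) gl (Finset.Ico 0 (Q : ℤ)) ω) ∂P) ^ k
  set a5 := (∫ ω, ee (θ * SI X g (Finset.Ico 0 (Q : ℤ)) ω) ∂P) ^ k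
  have t1 := norm_sub_le_norm_sub_add_norm_sub a1 a2 a5
  have t2 := norm_sub_le_norm_sub_add_norm_sub a2 a3 a5
  have t3 := norm_sub_le_norm_sub_add_norm_sub a3 a4 a5
  rw [norm_sub_rev] at B3
  have r : (k : ℝ) * (|θ| * (Q * (C / (l : ℝ) ^ 3))) = |θ| * ((k : ℝ) * Q * (C / (l : ℝ) ^ 3)) := by ring
  linarith

lemma ee_taylor (x : ℝ) (hx : |x| ≤ 1) : ‖ee x - (1 + x * Complex.I - ((x ^ 2 / 2 : ℝ) : ℂ))‖ ≤ |x| * x ^ 2 := by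
  have := Complex.exp_bound (x := x * Complex.I) (by simpa using hx) (n := 3) (by norm_num)
  simp only [Finset.sum_range_succ, Finset.sum_range_zero] at this
  have e : (0 + ((x : ℂ) * Complex.I) ^ 0 / ((0 : ℕ).factorial : ℂ) + ((x : ℂ) * Complex.I) ^ 1 / ((1 : ℕ).factorial : ℂ)
      + ((x : ℂ) * Complex.I) ^ 2 / ((2 : ℕ).factorial : ℂ)) = 1 + x * Complex.I - ((x ^ 2 / 2 : ℝ) : ℂ) := by
    simp [mul_pow, Nat.factorial]; ring
  rw [e] at this
  unfold ee
  refine this.trans ?_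
  have : ‖(x : ℂ) * Complex.I‖ = |x| := by simp
  rw [this, ← sq_abs x]
  have h0 := abs_nonneg x
  have : |x| ^ 3 * (((Nat.succ 3 : ℕ) : ℝ) * (((3 : ℕ).factorial : ℕ) * ((3 : ℕ) : ℝ))⁻¹) ≤ |x| ^ 3 * 1 := by
    refine mul_le_mul_of_nonneg_left ?_ (by positivity)
    norm_num [Nat.factorial]
  calc _ ≤ _ := this
    _ = _ := by ring

lemma char_block (S : Std P X Z b Cb G l0 Ca) (hg : GoodFn P X Z G l0 g B C) (θ : ℝ) (Q k : ℕ)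
    (hs : |θ| * (Q * B) ≤ 1) (V : ℝ) (hV : ∫ ω, SI X g (Finset.Ico 0 (Q : ℤ)) ω ^ 2 ∂P = V)
    (hV1 : θ ^ 2 * V / 2 ≤ 1) :
    ‖(∫ ω, ee (θ * SI X g (Finset.Ico 0 (Q : ℤ)) ω) ∂P) ^ k
      - ((Real.exp (-(k * (θ ^ 2 * V / 2))) : ℝ) : ℂ)‖
      ≤ k * (|θ| * (Q * B) * (θ ^ 2 * V) + (θ ^ 2 * V / 2) ^ 2) := by
  set T := SI X g (Finset.Ico 0 (Q : ℤ)) with hT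
  have mT : Measurable T := SI_meas S hg _
  have bT : ∀ ω, |T ω| ≤ Q * B := fun ω => by simpa using SI_abs hg (Finset.Ico 0 (Q : ℤ)) ω
  have hV0 : 0 ≤ V := hV ▸ integral_nonneg fun _ => sq_nonneg _
  have iT : Integrable T P := int_bdd mT bT
  have iT2 : Integrable (fun ω => T ω ^ 2) P := int_bdd (mT.pow_const 2) (M := (Q * B) ^ 2) fun x => by
    rw [abs_pow]; exact pow_le_pow_left₀ (abs_nonneg _) (bT x) 2
  have mean : ∫ ω, T ω ∂P = 0 := by
    rw [hT]
    unfold SI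
    rw [integral_finsetSum _ fun i _ => hg.int_X S i]
    refine Finset.sum_eq_zero fun i _ => ?_
    rw [← hg.mean]
    exact stat_X1 S.hX S.hZ S.hs i hg.meas
  set w := -(θ ^ 2 * V / 2) with hw
  have hw0 : w ≤ 0 := by rw [hw]; have : 0 ≤ θ ^ 2 * V / 2 := by positivity
                         linarith
  have j1 : Integrable (fun ω => ((θ * T ω : ℝ) : ℂ) * Complex.I) P := ((iT.const_mul θ).ofReal).mul_const _
  have j2 : Integrable (fun ω => (((θ * T ω) ^ 2 / 2 : ℝ) : ℂ)) P := by
    have : Integrable (fun ω => (θ * T ω) ^ 2 / 2) P := by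
      have := iT2.const_mul (θ ^ 2 / 2)
      refine this.congr (Eventually.of_forall fun ω => ?_)
      simp only; ring
    exact this.ofReal
  have j3 : Integrable (fun ω => (1 : ℂ) + ((θ * T ω : ℝ) : ℂ) * Complex.I) P := (integrable_const _).add j1
  have j4 : Integrable (fun ω => (1 : ℂ) + ((θ * T ω : ℝ) : ℂ) * Complex.I - (((θ * T ω) ^ 2 / 2 : ℝ) : ℂ)) P :=
    j3.sub j2
  have eI : ∫ ω, ((1 : ℂ) + ((θ * T ω : ℝ) : ℂ) * Complex.I - (((θ * T ω) ^ 2 / 2 : ℝ) : ℂ)) ∂P = 1 + (w : ℂ) := by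
    rw [integral_sub j3 j2, integral_add (integrable_const _) j1, integral_mul_const,
      integral_complex_ofReal, integral_complex_ofReal, integral_const_mul, mean]
    have : ∫ ω, (θ * T ω) ^ 2 / 2 ∂P = θ ^ 2 / 2 * V := by
      rw [← hV, ← integral_const_mul]
      congr 1; ext ω; ring
    rw [this, hw]
    simp
    ring
  have h1 : ‖(∫ ω, ee (θ * T ω) ∂P) - (1 + (w : ℂ))‖ ≤ |θ| * (Q * B) * (θ ^ 2 * V) := by
    rw [← eI, ← integral_sub (ee_int (mT.const_mul θ)) j4]
    have hi : Integrable (fun ω => |θ| * (Q * B) * (θ ^ 2 * T ω ^ 2)) P := (iT2.const_mul _).const_mul _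
    have := norm_integral_le_of_norm_le (μ := P) hi
      (f := fun ω => ee (θ * T ω) - ((1 : ℂ) + ((θ * T ω : ℝ) : ℂ) * Complex.I - (((θ * T ω) ^ 2 / 2 : ℝ) : ℂ)))
      (Eventually.of_forall fun ω => by
        have hb : |θ * T ω| ≤ |θ| * (Q * B) := by
          rw [abs_mul]; exact mul_le_mul_of_nonneg_left (bT ω) (abs_nonneg _)
        refine (ee_taylor (θ * T ω) (hb.trans hs)).trans ?_
        rw [mul_pow]
        exact mul_le_mul_of_nonneg_right hb (by positivity))
    refine this.trans (le_of_eq ?_)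
    rw [integral_const_mul, integral_const_mul, hV]
  have h2 : ‖((Real.exp w : ℝ) : ℂ) - (1 + (w : ℂ))‖ ≤ (θ ^ 2 * V / 2) ^ 2 := by
    have := Real.abs_exp_sub_one_sub_id_le (x := w) (by rw [abs_of_nonpos hw0]; linarith)
    have e : ((Real.exp w : ℝ) : ℂ) - (1 + (w : ℂ)) = ((Real.exp w - 1 - w : ℝ) : ℂ) := by push_cast; ring
    rw [e, Complex.norm_real, Real.norm_eq_abs]
    rw [hw, neg_sq] at this
    exact this
  have h3 : ‖((Real.exp w : ℝ) : ℂ)‖ ≤ 1 := by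
    rw [Complex.norm_real, Real.norm_eq_abs, abs_of_pos (Real.exp_pos _)]
    exact Real.exp_le_one_iff.2 hw0
  have e : ((Real.exp (-(k * (θ ^ 2 * V / 2))) : ℝ) : ℂ) = ((Real.exp w : ℝ) : ℂ) ^ k := by
    rw [← Complex.ofReal_pow, ← Real.exp_nat_mul, hw]; congr 2; ring
  rw [e]
  refine (norm_pow_sub (ee_integral_le _) h3 k).trans ?_
  refine mul_le_mul_of_nonneg_left ?_ (Nat.cast_nonneg _)
  have := norm_sub_le_norm_sub_add_norm_sub (∫ ω, ee (θ * T ω) ∂P) (1 + (w : ℂ)) ((Real.exp w : ℝ) : ℂ)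
  rw [norm_sub_rev (1 + (w : ℂ))] at this
  linarith

end
end UQuantile

namespace UQuantile

variable {Ω : Type*} [MeasurableSpace Ω]

/-- the basic scale `⌈n^{1/20}⌉` -/
def ms (n : ℕ) : ℕ := ⌈(n : ℝ) ^ ((1 : ℝ) / 20)⌉₊

lemma ms_lower (n : ℕ) : (n : ℝ) ≤ (ms n : ℝ) ^ 20 := by
  have h : (n : ℝ) ^ ((1 : ℝ) / 20) ≤ ms n := Nat.le_ceil _
  have h0 : (0 : ℝ) ≤ (n : ℝ) ^ ((1 : ℝ) / 20) := by positivity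
  calc (n : ℝ) = ((n : ℝ) ^ ((1 : ℝ) / 20)) ^ 20 := by
        rw [← Real.rpow_natCast, ← Real.rpow_mul (Nat.cast_nonneg n)]; norm_num
    _ ≤ _ := pow_le_pow_left₀ h0 h 20

lemma ms_upper {n : ℕ} (hn : 1 ≤ n) : (ms n : ℝ) ^ 20 ≤ 2 ^ 20 * n := by
  have h1 : (1 : ℝ) ≤ (n : ℝ) ^ ((1 : ℝ) / 20) := Real.one_le_rpow (by exact_mod_cast hn) (by norm_num)
  have h0 : (0 : ℝ) ≤ (n : ℝ) ^ ((1 : ℝ) / 20) := by positivity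
  have h : (ms n : ℝ) ≤ 2 * (n : ℝ) ^ ((1 : ℝ) / 20) := by
    have := (Nat.ceil_lt_add_one h0).le
    unfold ms; linarith
  calc (ms n : ℝ) ^ 20 ≤ (2 * (n : ℝ) ^ ((1 : ℝ) / 20)) ^ 20 := pow_le_pow_left₀ (Nat.cast_nonneg _) h 20
    _ = 2 ^ 20 * ((n : ℝ) ^ ((1 : ℝ) / 20)) ^ 20 := by rw [mul_pow]
    _ = _ := by congr 1; rw [← Real.rpow_natCast, ← Real.rpow_mul (Nat.cast_nonneg n)]; norm_num

lemma ms_tendsto : Tendsto ms atTop atTop := by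
  refine tendsto_nat_ceil_atTop.comp ?_
  exact (tendsto_rpow_atTop (by norm_num : (0 : ℝ) < 1 / 20)).comp tendsto_natCast_atTop_atTop

lemma ms_tendstoR : Tendsto (fun n => (ms n : ℝ)) atTop atTop := tendsto_natCast_atTop_atTop.comp ms_tendsto

/-- number of blocks -/
def kk (n : ℕ) : ℕ := n / (ms n ^ 9 + ms n ^ 8)

lemma kk_mul (n : ℕ) : kk n * (ms n ^ 9 + ms n ^ 8) ≤ n := Nat.div_mul_le_self _ _

lemma kk_gap {n : ℕ} (hm : 1 ≤ ms n) (hn : 1 ≤ n) :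
    ((n : ℝ) - kk n * (ms n ^ 9 : ℕ)) ≤ n * ((1 + 2 ^ 21) / ms n) := by
  have hpos : 0 < ms n ^ 9 + ms n ^ 8 := by positivity
  have h1 : n < (kk n + 1) * (ms n ^ 9 + ms n ^ 8) := by
    have := Nat.lt_div_mul_add (a := n) hpos
    unfold kk; linarith
  have h1' : (n : ℝ) ≤ (kk n + 1) * ((ms n : ℝ) ^ 9 + (ms n : ℝ) ^ 8) := by exact_mod_cast h1.le
  have h2 : (kk n : ℝ) * ((ms n : ℝ) ^ 9 + (ms n : ℝ) ^ 8) ≤ n := by exact_mod_cast kk_mul n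
  have hm' : (1 : ℝ) ≤ ms n := by exact_mod_cast hm
  have h3 := ms_upper hn
  push_cast
  set x : ℝ := (ms n : ℝ) with hx
  have hk : (0 : ℝ) ≤ kk n := Nat.cast_nonneg _
  set k : ℝ := (kk n : ℝ)
  rw [← mul_div_assoc, le_div_iff₀ (by linarith)]
  -- (n - k x^9) x ≤ n (1+2^21)
  have a1 : k * x ^ 8 * x ≤ n := by nlinarith [pow_nonneg (by linarith : 0 ≤ x) 8]
  have a2 : x ^ 10 ≤ x ^ 20 := pow_le_pow_right₀ hm' (by norm_num)
  have a3 : x ^ 9 ≤ x ^ 10 := pow_le_pow_right₀ hm' (by norm_num)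
  have a4 : ((n : ℝ) - k * x ^ 9) * x ≤ (k * x ^ 8 + x ^ 9 + x ^ 8) * x :=
    mul_le_mul_of_nonneg_right (by linarith) (by linarith)
  have a5 : (k * x ^ 8 + x ^ 9 + x ^ 8) * x = k * x ^ 8 * x + x ^ 10 + x ^ 9 := by ring
  linarith

lemma kk_le {n : ℕ} (hm : 1 ≤ ms n) : (kk n : ℝ) ≤ (ms n : ℝ) ^ 11 := by
  have h2 : (kk n : ℝ) * ((ms n : ℝ) ^ 9 + (ms n : ℝ) ^ 8) ≤ n := by exact_mod_cast kk_mul n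
  have hm' : (1 : ℝ) ≤ ms n := by exact_mod_cast hm
  have h3 := ms_lower n
  set x : ℝ := (ms n : ℝ) with hx
  have h4 : (kk n : ℝ) * x ^ 9 ≤ x ^ 11 * x ^ 9 := by
    have : 0 ≤ (kk n : ℝ) * x ^ 8 := by positivity
    calc _ ≤ (kk n : ℝ) * (x ^ 9 + x ^ 8) := by linarith
      _ ≤ x ^ 20 := by linarith
      _ = _ := by ring
  exact le_of_mul_le_mul_right h4 (by positivity)

lemma sqrt_le_ms (n : ℕ) : Real.sqrt n ≤ (ms n : ℝ) ^ 10 := by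
  apply Real.sqrt_le_iff.2 ⟨by positivity, ?_⟩
  calc _ ≤ _ := ms_lower n
    _ = _ := by ring

lemma ms_le_sqrt {n : ℕ} (hn : 1 ≤ n) : (ms n : ℝ) ^ 10 ≤ 2 ^ 10 * Real.sqrt n := by
  have h : Real.sqrt (((ms n : ℝ) ^ 10) ^ 2) ≤ Real.sqrt ((2 ^ 10) ^ 2 * n) := by
    apply Real.sqrt_le_sqrt
    calc _ = (ms n : ℝ) ^ 20 := by ring
      _ ≤ 2 ^ 20 * n := ms_upper hn
      _ = _ := by ring
  rwa [Real.sqrt_sq (by positivity), Real.sqrt_mul (by positivity), Real.sqrt_sq (by positivity)] at h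

section
variable {P : Measure Ω} [IsProbabilityMeasure P] {X Z : ℤ → Ω → ℝ} {b : ℕ → ℝ} {Cb : ℝ}
    {G : (l : ℕ) → (Fin (2 * l + 1) → ℝ) → ℤ} {l0 : ℕ} {Ca : ℝ}
    {g : ℝ → ℝ} {B C : ℝ}

lemma b_scale (S : Std P X Z b Cb G l0 Ca) {m : ℕ} (hm : 2 ≤ m) :
    b (m ^ 8 - 2 * m ^ 4) ≤ 4 * Cb / (m : ℝ) ^ 16 := by
  have h4 : 2 ^ 4 ≤ m ^ 4 := Nat.pow_le_pow_left hm 4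
  have h8 : m ^ 8 = m ^ 4 * m ^ 4 := by ring
  have hle : 2 * m ^ 4 ≤ m ^ 8 := by rw [h8]; exact Nat.mul_le_mul_right _ (by omega)
  refine (S.bC _).trans ?_
  rw [Nat.cast_sub hle]
  push_cast
  have hx : (2 : ℝ) ≤ m := by exact_mod_cast hm
  set x : ℝ := (m : ℝ)
  have hx4 : (16 : ℝ) ≤ x ^ 4 := by
    calc (16 : ℝ) = 2 ^ 4 := by norm_num
      _ ≤ _ := pow_le_pow_left₀ (by norm_num) hx 4
  have e8 : x ^ 8 = x ^ 4 * x ^ 4 := by ring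
  have h1 : x ^ 8 / 2 ≤ x ^ 8 - 2 * x ^ 4 + 1 := by rw [e8]; nlinarith
  have h2 : (x ^ 8 / 2) ^ 2 ≤ (x ^ 8 - 2 * x ^ 4 + 1) ^ 2 := pow_le_pow_left₀ (by positivity) h1 2
  calc Cb / (x ^ 8 - 2 * x ^ 4 + 1) ^ 2 ≤ Cb / (x ^ 8 / 2) ^ 2 :=
        div_le_div_of_nonneg_left S.Cb0 (by positivity) h2
    _ = _ := by field_simp; norm_num

lemma char_lim1 (S : Std P X Z b Cb G l0 Ca) (hg : GoodFn P X Z G l0 g B C) (s : ℝ) :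
    Tendsto (fun n : ℕ => (∫ ω, ee (s / Real.sqrt n * SI X g (Finset.Icc 1 (n : ℤ)) ω) ∂P)
        - (∫ ω, ee (s / Real.sqrt n * SI X g (Finset.Ico 0 ((ms n ^ 9 : ℕ) : ℤ)) ω) ∂P) ^ kk n) atTop (𝓝 0) := by
  have hΓ := Gam_nonneg S hg
  have inv0 : Tendsto (fun n => ((ms n : ℝ))⁻¹) atTop (𝓝 0) := tendsto_inv_atTop_zero.comp ms_tendstoR
  have lim : Tendsto (fun n => |s| * Real.sqrt (((1 + 2 ^ 21) * ((ms n : ℝ))⁻¹) * Gam Cb l0 B C)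
      + 2 * |s| * C * ((ms n : ℝ))⁻¹ + 16 * Cb * ((ms n : ℝ))⁻¹) atTop (𝓝 0) := by
    have h1 : Tendsto (fun n => |s| * Real.sqrt (((1 + 2 ^ 21) * ((ms n : ℝ))⁻¹) * Gam Cb l0 B C)) atTop
        (𝓝 (|s| * Real.sqrt (((1 + 2 ^ 21) * 0) * Gam Cb l0 B C))) :=
      (Real.continuous_sqrt.continuousAt.tendsto.comp ((inv0.const_mul _).mul_const _)).const_mul _
    have h2 := (h1.add (inv0.const_mul (2 * |s| * C))).add (inv0.const_mul (16 * Cb))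
    simpa using h2
  refine squeeze_zero_norm' ?_ lim
  filter_upwards [eventually_ge_atTop 1, ms_tendsto.eventually_ge_atTop 2,
    ms_tendsto.eventually_ge_atTop l0] with n hn hm hl
  have hm1 : 1 ≤ ms n := by omega
  have h4 : 2 ^ 4 ≤ ms n ^ 4 := Nat.pow_le_pow_left hm 4
  have h8 : ms n ^ 8 = ms n ^ 4 * ms n ^ 4 := by ring
  have hle : 2 * ms n ^ 4 ≤ ms n ^ 8 := by rw [h8]; exact Nat.mul_le_mul_right _ (by omega)
  have hl' : l0 ≤ ms n ^ 4 := hl.trans (Nat.le_self_pow (by norm_num) _)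
  refine (clt_bound S hg (s / Real.sqrt n) hl' hle (kk_mul n)).trans ?_
  have hx : (1 : ℝ) ≤ ms n := by exact_mod_cast hm1
  have hn' : (1 : ℝ) ≤ n := by exact_mod_cast hn
  have hsn : 0 < Real.sqrt n := Real.sqrt_pos.2 (by linarith)
  have hθ : |s / Real.sqrt n| = |s| / Real.sqrt n := by rw [abs_div, abs_of_pos hsn]
  rw [hθ]
  refine add_le_add (add_le_add ?_ ?_) ?_
  · rw [div_mul_eq_mul_div, mul_div_assoc, ← Real.sqrt_div' _ (by linarith : (0 : ℝ) ≤ n)]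
    refine mul_le_mul_of_nonneg_left (Real.sqrt_le_sqrt ?_) (abs_nonneg _)
    rw [div_le_iff₀ (by linarith)]
    calc _ ≤ n * ((1 + 2 ^ 21) / ms n) * Gam Cb l0 B C :=
          mul_le_mul_of_nonneg_right (kk_gap hm1 hn) hΓ
      _ = _ := by ring
  · have e : |s| / Real.sqrt n * (n * (C / ((ms n ^ 4 : ℕ) : ℝ) ^ 3))
        = |s| * C * (Real.sqrt n * (((ms n : ℝ) ^ 12)⁻¹)) := by
      have := Real.mul_self_sqrt (by linarith : (0 : ℝ) ≤ n)
      push_cast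
      rw [← pow_mul]
      have e2 : (n : ℝ) / Real.sqrt n = Real.sqrt n := Real.div_sqrt
      calc _ = |s| * C * ((n / Real.sqrt n) * (((ms n : ℝ) ^ 12)⁻¹)) := by ring
        _ = _ := by rw [e2]
    rw [e]
    have h3 : Real.sqrt n * (((ms n : ℝ) ^ 12)⁻¹) ≤ ((ms n : ℝ))⁻¹ := by
      rw [← div_eq_mul_inv, div_le_iff₀ (by positivity)]
      calc _ ≤ (ms n : ℝ) ^ 10 := sqrt_le_ms n
        _ ≤ (ms n : ℝ) ^ 11 := pow_le_pow_right₀ hx (by norm_num)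
        _ = _ := by field_simp
    have := mul_le_mul_of_nonneg_left h3 (mul_nonneg (abs_nonneg s) hg.C0)
    linarith
  · have h3 := b_scale S hm
    have hk := kk_le hm1
    have hCb := S.Cb0
    calc _ ≤ (ms n : ℝ) ^ 11 * (4 * (4 * Cb / (ms n : ℝ) ^ 16)) :=
          mul_le_mul hk (by linarith) (mul_nonneg (by norm_num) (S.b0 _)) (by positivity)
      _ = 16 * Cb * (((ms n : ℝ)) ^ 5)⁻¹ := by field_simp; ring
      _ ≤ _ := by
        refine mul_le_mul_of_nonneg_left ?_ (by positivity)
        exact inv_anti₀ (by positivity) (le_self_pow₀ hx (by norm_num))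

lemma char_lim2 (S : Std P X Z b Cb G l0 Ca) (hg : GoodFn P X Z G l0 g B C) (s : ℝ) :
    Tendsto (fun n : ℕ => (∫ ω, ee (s / Real.sqrt n * SI X g (Finset.Ico 0 ((ms n ^ 9 : ℕ) : ℤ)) ω) ∂P) ^ kk n)
      atTop (𝓝 ((Real.exp (-((∑' r, cv P X g r) * s ^ 2 / 2)) : ℝ) : ℂ)) := by
  have hΓ := Gam_nonneg S hg
  have hB := hg.B0
  have inv0 : Tendsto (fun n => ((ms n : ℝ))⁻¹) atTop (𝓝 0) := tendsto_inv_atTop_zero.comp ms_tendstoR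
  set V : ℕ → ℝ := fun n => ∫ ω, SI X g (Finset.Ico 0 ((ms n ^ 9 : ℕ) : ℤ)) ω ^ 2 ∂P with hV
  have hV0 : ∀ n, 0 ≤ V n := fun n => integral_nonneg fun _ => sq_nonneg _
  have hVle : ∀ n, V n ≤ (ms n : ℝ) ^ 9 * Gam Cb l0 B C := fun n => by
    have := SI_sq_le S hg (Finset.Ico 0 ((ms n ^ 9 : ℕ) : ℤ))
    have hc : ((Finset.Ico 0 ((ms n ^ 9 : ℕ) : ℤ)).card : ℝ) = (ms n : ℝ) ^ 9 := by
      rw [Int.card_Ico, sub_zero, Int.toNat_natCast]; push_cast; rfl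
    rw [hc] at this
    exact this
  have hQ : Tendsto (fun n => ms n ^ 9) atTop atTop :=
    tendsto_atTop_mono (fun n => Nat.le_self_pow (by norm_num) _) ms_tendsto
  have hVl : Tendsto (fun n => V n / ((ms n ^ 9 : ℕ) : ℝ)) atTop (𝓝 (∑' r, cv P X g r)) :=
    (SI_var_lim S hg).comp hQ
  have hkq : Tendsto (fun n : ℕ => (kk n * (ms n ^ 9 : ℕ) : ℝ) / n) atTop (𝓝 1) := by
    have lim : Tendsto (fun n => 1 - (1 + 2 ^ 21) * ((ms n : ℝ))⁻¹) atTop (𝓝 1) := by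
      simpa using (inv0.const_mul (1 + 2 ^ 21 : ℝ)).const_sub 1
    refine tendsto_of_tendsto_of_tendsto_of_le_of_le' lim tendsto_const_nhds ?_ ?_
    · filter_upwards [eventually_ge_atTop 1, ms_tendsto.eventually_ge_atTop 2] with n hn hm
      have := kk_gap (by omega : 1 ≤ ms n) hn
      have hn' : (0 : ℝ) < n := by exact_mod_cast hn
      rw [le_div_iff₀ hn']
      have e : (1 - (1 + 2 ^ 21) * ((ms n : ℝ))⁻¹) * n = n - n * ((1 + 2 ^ 21) / ms n) := by ring
      rw [e]; linarith
    · filter_upwards [eventually_ge_atTop 1] with n hn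
      have hn' : (0 : ℝ) < n := by exact_mod_cast hn
      rw [div_le_one hn']
      have : kk n * (ms n ^ 9) ≤ n := le_trans (Nat.mul_le_mul_left _ (Nat.le_add_right _ _)) (kk_mul n)
      exact_mod_cast this
  have hexp : Tendsto (fun n : ℕ => ((Real.exp (-(kk n * ((s / Real.sqrt n) ^ 2 * V n / 2))) : ℝ) : ℂ)) atTop
      (𝓝 ((Real.exp (-((∑' r, cv P X g r) * s ^ 2 / 2)) : ℝ) : ℂ)) := by
    refine (Complex.continuous_ofReal.tendsto _).comp ((Real.continuous_exp.tendsto _).comp ?_)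
    have h1 := ((hkq.mul hVl).mul_const (-(s ^ 2 / 2)))
    have e0 : 1 * (∑' r, cv P X g r) * (-(s ^ 2 / 2)) = -((∑' r, cv P X g r) * s ^ 2 / 2) := by ring
    rw [e0] at h1
    refine h1.congr' ?_
    filter_upwards [eventually_ge_atTop 1, ms_tendsto.eventually_ge_atTop 2] with n hn hm
    have hn' : (0 : ℝ) < n := by exact_mod_cast hn
    have hx : (0 : ℝ) < ms n := by exact_mod_cast (by omega : 0 < ms n)
    rw [div_pow, Real.sq_sqrt hn'.le]
    push_cast
    field_simp
  have hdiff : Tendsto (fun n : ℕ => (∫ ω, ee (s / Real.sqrt n * SI X g (Finset.Ico 0 ((ms n ^ 9 : ℕ) : ℤ)) ω) ∂P) ^ kk n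
      - ((Real.exp (-(kk n * ((s / Real.sqrt n) ^ 2 * V n / 2))) : ℝ) : ℂ)) atTop (𝓝 0) := by
    -- bounds
    have lim : Tendsto (fun n => (|s| * B * 2 ^ 10 * ((ms n : ℝ))⁻¹) * (s ^ 2 * Gam Cb l0 B C)
        + (s ^ 2 * Gam Cb l0 B C) * (s ^ 2 * Gam Cb l0 B C * 2 ^ 20 * ((ms n : ℝ))⁻¹)) atTop (𝓝 0) := by
      have := ((inv0.const_mul (|s| * B * 2 ^ 10)).mul_const (s ^ 2 * Gam Cb l0 B C)).add
        ((inv0.const_mul (s ^ 2 * Gam Cb l0 B C * 2 ^ 20)).const_mul (s ^ 2 * Gam Cb l0 B C))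
      simpa using this
    refine squeeze_zero_norm' ?_ lim
    have ev1 : ∀ᶠ n in atTop, |s| * B * 2 ^ 10 * ((ms n : ℝ))⁻¹ ≤ 1 := by
      have := inv0.const_mul (|s| * B * 2 ^ 10)
      rw [mul_zero] at this
      exact this.eventually_le_const (by norm_num)
    have ev2 : ∀ᶠ n in atTop, s ^ 2 * Gam Cb l0 B C * 2 ^ 20 * ((ms n : ℝ))⁻¹ ≤ 1 := by
      have := inv0.const_mul (s ^ 2 * Gam Cb l0 B C * 2 ^ 20)
      rw [mul_zero] at this
      exact this.eventually_le_const (by norm_num)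
    filter_upwards [eventually_ge_atTop 1, ms_tendsto.eventually_ge_atTop 2, ev1, ev2] with n hn hm e1 e2
    have hm1 : 1 ≤ ms n := by omega
    have hx : (1 : ℝ) ≤ ms n := by exact_mod_cast hm1
    have hn' : (0 : ℝ) < n := by exact_mod_cast hn
    have hsn : 0 < Real.sqrt n := Real.sqrt_pos.2 hn'
    have hθ : |s / Real.sqrt n| = |s| / Real.sqrt n := by rw [abs_div, abs_of_pos hsn]
    have a1 : |s / Real.sqrt n| * (((ms n ^ 9 : ℕ) : ℝ) * B) ≤ |s| * B * 2 ^ 10 * ((ms n : ℝ))⁻¹ := by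
      rw [hθ]
      push_cast
      have : (ms n : ℝ) ^ 9 / Real.sqrt n ≤ 2 ^ 10 * ((ms n : ℝ))⁻¹ := by
        rw [div_le_iff₀ hsn]
        have := ms_le_sqrt hn
        calc (ms n : ℝ) ^ 9 = (ms n : ℝ) ^ 10 * ((ms n : ℝ))⁻¹ := by field_simp
          _ ≤ 2 ^ 10 * Real.sqrt n * ((ms n : ℝ))⁻¹ := mul_le_mul_of_nonneg_right this (by positivity)
          _ = _ := by ring
      calc _ = |s| * B * ((ms n : ℝ) ^ 9 / Real.sqrt n) := by ring
        _ ≤ |s| * B * (2 ^ 10 * ((ms n : ℝ))⁻¹) := mul_le_mul_of_nonneg_left this (by positivity)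
        _ = _ := by ring
    have a2 : (s / Real.sqrt n) ^ 2 * V n ≤ s ^ 2 * Gam Cb l0 B C * 2 ^ 20 * ((ms n : ℝ))⁻¹ := by
      rw [div_pow, Real.sq_sqrt hn'.le]
      have : (ms n : ℝ) ^ 9 / n ≤ 2 ^ 20 * ((ms n : ℝ))⁻¹ := by
        rw [div_le_iff₀ hn']
        have := ms_upper hn
        calc (ms n : ℝ) ^ 9 = (ms n : ℝ) ^ 10 * ((ms n : ℝ))⁻¹ := by field_simp
          _ ≤ (ms n : ℝ) ^ 20 * ((ms n : ℝ))⁻¹ :=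
            mul_le_mul_of_nonneg_right (pow_le_pow_right₀ hx (by norm_num)) (by positivity)
          _ ≤ 2 ^ 20 * n * ((ms n : ℝ))⁻¹ := mul_le_mul_of_nonneg_right this (by positivity)
          _ = _ := by ring
      calc s ^ 2 / n * V n ≤ s ^ 2 / n * ((ms n : ℝ) ^ 9 * Gam Cb l0 B C) :=
            mul_le_mul_of_nonneg_left (hVle n) (by positivity)
        _ = s ^ 2 * Gam Cb l0 B C * ((ms n : ℝ) ^ 9 / n) := by ring
        _ ≤ s ^ 2 * Gam Cb l0 B C * (2 ^ 20 * ((ms n : ℝ))⁻¹) := mul_le_mul_of_nonneg_left this (by positivity)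
        _ = _ := by ring
    have a3 : (kk n : ℝ) * ((s / Real.sqrt n) ^ 2 * V n) ≤ s ^ 2 * Gam Cb l0 B C := by
      rw [div_pow, Real.sq_sqrt hn'.le]
      have : (kk n : ℝ) * (ms n : ℝ) ^ 9 / n ≤ 1 := by
        rw [div_le_one hn']
        have : kk n * (ms n ^ 9) ≤ n := le_trans (Nat.mul_le_mul_left _ (Nat.le_add_right _ _)) (kk_mul n)
        exact_mod_cast this
      calc (kk n : ℝ) * (s ^ 2 / n * V n) ≤ kk n * (s ^ 2 / n * ((ms n : ℝ) ^ 9 * Gam Cb l0 B C)) :=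
            mul_le_mul_of_nonneg_left (mul_le_mul_of_nonneg_left (hVle n) (by positivity)) (Nat.cast_nonneg _)
        _ = s ^ 2 * Gam Cb l0 B C * ((kk n : ℝ) * (ms n : ℝ) ^ 9 / n) := by ring
        _ ≤ s ^ 2 * Gam Cb l0 B C * 1 := mul_le_mul_of_nonneg_left this (by positivity)
        _ = _ := by ring
    have w0 : 0 ≤ (s / Real.sqrt n) ^ 2 * V n := mul_nonneg (sq_nonneg _) (hV0 n)
    refine (char_block S hg (s / Real.sqrt n) (ms n ^ 9) (kk n) (a1.trans e1) (V n) rfl (by linarith)).trans ?_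
    set w := (s / Real.sqrt n) ^ 2 * V n
    set r1 := |s| * B * 2 ^ 10 * ((ms n : ℝ))⁻¹
    set r2 := s ^ 2 * Gam Cb l0 B C * 2 ^ 20 * ((ms n : ℝ))⁻¹
    set c := |s / Real.sqrt n| * (((ms n ^ 9 : ℕ) : ℝ) * B)
    have r10 : 0 ≤ r1 := by positivity
    have hkw : 0 ≤ (kk n : ℝ) * w := by positivity
    have f1 : c * ((kk n : ℝ) * w) ≤ r1 * (s ^ 2 * Gam Cb l0 B C) := mul_le_mul a1 a3 hkw r10
    have f2 : ((kk n : ℝ) * w) * w ≤ (s ^ 2 * Gam Cb l0 B C) * r2 :=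
      mul_le_mul a3 a2 w0 (by positivity)
    have f3 : 0 ≤ ((kk n : ℝ) * w) * w := mul_nonneg hkw w0
    calc (kk n : ℝ) * (c * w + (w / 2) ^ 2) = c * ((kk n : ℝ) * w) + ((kk n : ℝ) * w) * w / 4 := by ring
      _ ≤ _ := by linarith
  have := hdiff.add hexp
  simpa using this

lemma char_lim (S : Std P X Z b Cb G l0 Ca) (hg : GoodFn P X Z G l0 g B C) (s : ℝ) :
    Tendsto (fun n : ℕ => ∫ ω, ee (s / Real.sqrt n * SI X g (Finset.Icc 1 (n : ℤ)) ω) ∂P) atTop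
      (𝓝 ((Real.exp (-((∑' r, cv P X g r) * s ^ 2 / 2)) : ℝ) : ℂ)) := by
  have := (char_lim1 S hg s).add (char_lim2 S hg s)
  simpa using this

end
end UQuantile

namespace UQuantile

variable {Ω : Type*} [MeasurableSpace Ω]

section
variable {P : Measure Ω} [IsProbabilityMeasure P] {X Z : ℤ → Ω → ℝ} {b : ℕ → ℝ} {Cb : ℝ}
    {G : (l : ℕ) → (Fin (2 * l + 1) → ℝ) → ℤ} {l0 : ℕ} {Ca : ℝ}
    {g : ℝ → ℝ} {B C : ℝ}

lemma clt (S : Std P X Z b Cb G l0 Ca) (hg : GoodFn P X Z G l0 g B C) (c : ℝ) :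
    TendstoInDistribution (fun (n : ℕ) ω => c / Real.sqrt n * SI X g (Finset.Icc 1 (n : ℤ)) ω) atTop (id : ℝ → ℝ)
      (fun _ => P) (ProbabilityTheory.gaussianReal 0 (Real.toNNReal (c ^ 2 * ∑' r, cv P X g r))) := by
  have hm : ∀ n : ℕ, Measurable (fun ω => c / Real.sqrt n * SI X g (Finset.Icc 1 (n : ℤ)) ω) := fun n =>
    (SI_meas S hg _).const_mul _
  refine ⟨fun n => (hm n).aemeasurable, measurable_id.aemeasurable, ?_⟩
  refine ProbabilityMeasure.tendsto_iff_tendsto_charFun.2 fun t => ?_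
  have h1 := char_lim S hg (t * c)
  have e : charFun ((ProbabilityTheory.gaussianReal 0 (Real.toNNReal (c ^ 2 * ∑' r, cv P X g r))).map id) t
      = ((Real.exp (-((∑' r, cv P X g r) * (t * c) ^ 2 / 2)) : ℝ) : ℂ) := by
    rw [Measure.map_id, ProbabilityTheory.charFun_gaussianReal]
    rw [Real.coe_toNNReal _ (mul_nonneg (sq_nonneg _) (tsum_cv_nonneg S hg))]
    push_cast
    congr 1
    simp only [mul_zero, zero_mul, zero_sub]
    ring
  change Tendsto (fun n : ℕ => charFun (P.map (fun ω => c / Real.sqrt n * SI X g (Finset.Icc 1 (n : ℤ)) ω)) t) atTop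
    (𝓝 (charFun ((ProbabilityTheory.gaussianReal 0 (Real.toNNReal (c ^ 2 * ∑' r, cv P X g r))).map id) t))
  rw [e]
  refine h1.congr fun n => ?_
  rw [charFun_apply_real, integral_map (hm n).aemeasurable]
  · congr 1; ext ω
    unfold ee
    push_cast
    ring_nf
  · exact (by fun_prop : Continuous fun x : ℝ => Complex.exp (t * x * Complex.I)).aestronglyMeasurable

lemma conv_final {W V : ℕ → Ω → ℝ} {v : ℝ≥0}
    (hW : TendstoInDistribution W atTop (id : ℝ → ℝ) (fun _ => P) (ProbabilityTheory.gaussianReal 0 v))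
    (hV : ∀ n, AEMeasurable (V n) P)
    (hVW : ∀ ε > 0, Tendsto (fun n => P.real {ω | ε ≤ |V n ω - W n ω|}) atTop (𝓝 0))
    (f : BoundedContinuousFunction ℝ ℝ) :
    Tendsto (fun n => ∫ ω, f (V n ω) ∂P) atTop (𝓝 (∫ x, f x ∂(ProbabilityTheory.gaussianReal 0 v))) := by
  have h1 : TendstoInMeasure P (V - W) atTop 0 := by
    rw [tendstoInMeasure_iff_measureReal_norm]
    intro ε hε
    simpa using hVW ε hε
  have h2 := tendstoInDistribution_of_tendstoInMeasure_sub V id hW h1 hV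
  have h3 := h2.tendsto
  have h4 := ProbabilityMeasure.tendsto_iff_forall_integral_tendsto.1 h3 f
  simp only [ProbabilityMeasure.coe_mk, Measure.map_id] at h4
  refine h4.congr fun n => ?_
  rw [integral_map (hV n) f.continuous.aestronglyMeasurable]

end
end UQuantile

namespace UQuantile

variable {Ω : Type*} [MeasurableSpace Ω]

section
variable {P : Measure Ω} [IsProbabilityMeasure P] {X Z : ℤ → Ω → ℝ} {b : ℕ → ℝ} {Cb : ℝ}
    {G : (l : ℕ) → (Fin (2 * l + 1) → ℝ) → ℤ} {l0 : ℕ} {Ca : ℝ}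

lemma iso_int (S : Std P X Z b Cb G l0 Ca) (l : ℕ) (F : (Fin 4 → ℤ) → ℝ) (r : Fin 4)
    (hF : ∀ x, ∫ ω, F (Function.update x r (Nw Z (G l) 0 ω)) ∂P = 0) (x : Fin 4 → ℤ) (i : ℤ) :
    ∫ ω, F (Function.update x r (Nw Z (G l) i ω)) ∂P = 0 := by
  rw [← hF x]
  exact stat_XN1 S.hX S.hZ S.hs (S.hG l) i (F := fun _ n => F (Function.update x r n))
    ((measurable_of_countable (fun n => F (Function.update x r n))).comp measurable_snd)

/-- a single index isolated to the right -/
lemma iso_right (S : Std P X Z b Cb G l0 Ca) (l : ℕ) (F : (Fin 4 → ℤ) → ℝ) {M2 : ℝ} (hM2 : ∀ x, |F x| ≤ M2)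
    (r : Fin 4) (hF : ∀ x, ∫ ω, F (Function.update x r (Nw Z (G l) 0 ω)) ∂P = 0)
    (v : Fin 4 → ℤ) (d : ℕ) (hd : 2 * l ≤ d) (hv : ∀ j, j ≠ r → v j + d ≤ v r) :
    |∫ ω, F (fun i => Nw Z (G l) (v i) ω) ∂P| ≤ 2 * M2 * b (d - 2 * l) := by
  have := decouple S.hX S.hZ S.hs S.hβ (S.hG l) v (fun i => i ≠ r) (v r - d + l) (d - 2 * l)
    (fun i hi => by have := hv i hi; omega) (fun i hi => by rw [not_not] at hi; subst hi; omega) F hM2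
  have e : ∀ ω ω', (fun i => if i ≠ r then Nw Z (G l) (v i) ω else Nw Z (G l) (v i) ω')
      = Function.update (fun i => Nw Z (G l) (v i) ω) r (Nw Z (G l) (v r) ω') := fun ω ω' => by
    ext i
    by_cases hi : i = r
    · subst hi; simp
    · simp [hi]
  simp only [e, iso_int S l F r hF, integral_zero, sub_zero] at this
  exact this

/-- a single index isolated to the left -/
lemma iso_left (S : Std P X Z b Cb G l0 Ca) (l : ℕ) (F : (Fin 4 → ℤ) → ℝ) {M2 : ℝ} (hM2 : ∀ x, |F x| ≤ M2)
    (r : Fin 4) (hF : ∀ x, ∫ ω, F (Function.update x r (Nw Z (G l) 0 ω)) ∂P = 0)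
    (v : Fin 4 → ℤ) (d : ℕ) (hd : 2 * l ≤ d) (hv : ∀ j, j ≠ r → v r + d ≤ v j) :
    |∫ ω, F (fun i => Nw Z (G l) (v i) ω) ∂P| ≤ 2 * M2 * b (d - 2 * l) := by
  have := decouple S.hX S.hZ S.hs S.hβ (S.hG l) v (fun i => i = r) (v r + l) (d - 2 * l)
    (fun i hi => by subst hi; omega) (fun i hi => by have := hv i hi; omega) F hM2
  have e : ∀ ω ω', (fun i => if i = r then Nw Z (G l) (v i) ω else Nw Z (G l) (v i) ω')
      = Function.update (fun i => Nw Z (G l) (v i) ω') r (Nw Z (G l) (v r) ω) := fun ω ω' => by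
    ext i
    by_cases hi : i = r
    · subst hi; simp
    · simp [hi]
  have hm : Measurable fun q : Ω × Ω => F (fun i => if i = r then Nw Z (G l) (v i) q.1 else Nw Z (G l) (v i) q.2) := by
    refine (measurable_of_countable F).comp (measurable_pi_lambda _ fun i => ?_)
    by_cases hi : i = r
    · simp only [hi, if_true]; exact (S.hN l _).comp measurable_fst
    · simp only [hi, if_false]; exact (S.hN l _).comp measurable_snd
  have hsw : ∫ ω, ∫ ω', F (fun i => if i = r then Nw Z (G l) (v i) ω else Nw Z (G l) (v i) ω') ∂P ∂P
      = ∫ ω', ∫ ω, F (fun i => if i = r then Nw Z (G l) (v i) ω else Nw Z (G l) (v i) ω') ∂P ∂P := by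
    refine integral_integral_swap ?_
    exact int_bdd (μ := P.prod P) hm (M := M2) fun _ => hM2 _
  rw [hsw] at this
  simp only [e, iso_int S l F r hF, integral_zero, sub_zero] at this
  exact this

/-- the gap bound in a uniform form -/
lemma gap_bound (S : Std P X Z b Cb G l0 Ca) {M2 E : ℝ} (M20 : 0 ≤ M2) (l d : ℕ) (h1 : E ≤ M2)
    (h2 : 2 * l ≤ d → E ≤ 2 * M2 * b (d - 2 * l)) :
    E ≤ 2 * M2 * (1 + Cb) * (2 * (l : ℝ) + 1) ^ 2 / ((d : ℝ) + 1) ^ 2 := by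
  have hCb := S.Cb0
  have hl0 : (0 : ℝ) ≤ l := Nat.cast_nonneg l
  have hd0 : (0 : ℝ) ≤ d := Nat.cast_nonneg d
  rw [le_div_iff₀ (by positivity)]
  by_cases hd : 2 * l ≤ d
  · have hd' : 2 * (l : ℝ) ≤ d := by exact_mod_cast hd
    have hb := S.bC (d - 2 * l)
    rw [Nat.cast_sub hd] at hb
    push_cast at hb
    have e0 : (0 : ℝ) < ((d : ℝ) - 2 * l + 1) ^ 2 := by
      have : (0 : ℝ) < (d : ℝ) - 2 * l + 1 := by linarith
      positivity
    rw [le_div_iff₀ e0] at hb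
    have h3 : (d : ℝ) + 1 ≤ (2 * l + 1) * ((d : ℝ) - 2 * l + 1) := by nlinarith
    have h4 : ((d : ℝ) + 1) ^ 2 ≤ (2 * l + 1) ^ 2 * ((d : ℝ) - 2 * l + 1) ^ 2 := by
      rw [← mul_pow]; exact pow_le_pow_left₀ (by positivity) h3 2
    have hb0 := S.b0 (d - 2 * l)
    calc E * ((d : ℝ) + 1) ^ 2 ≤ (2 * M2 * b (d - 2 * l)) * ((d : ℝ) + 1) ^ 2 :=
          mul_le_mul_of_nonneg_right (h2 hd) (by positivity)
      _ ≤ (2 * M2 * b (d - 2 * l)) * ((2 * l + 1) ^ 2 * ((d : ℝ) - 2 * l + 1) ^ 2) :=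
          mul_le_mul_of_nonneg_left h4 (by positivity)
      _ = (2 * M2 * (2 * l + 1) ^ 2) * (b (d - 2 * l) * ((d : ℝ) - 2 * l + 1) ^ 2) := by ring
      _ ≤ (2 * M2 * (2 * l + 1) ^ 2) * Cb := mul_le_mul_of_nonneg_left hb (by positivity)
      _ ≤ (2 * M2 * (2 * l + 1) ^ 2) * (1 + Cb) := mul_le_mul_of_nonneg_left (by linarith) (by positivity)
      _ = _ := by ring
  · have hd' : (d : ℝ) ≤ 2 * l := by exact_mod_cast (not_le.1 hd).le
    have h4 : ((d : ℝ) + 1) ^ 2 ≤ (2 * l + 1) ^ 2 := pow_le_pow_left₀ (by positivity) (by linarith) 2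
    calc E * ((d : ℝ) + 1) ^ 2 ≤ M2 * ((d : ℝ) + 1) ^ 2 := mul_le_mul_of_nonneg_right h1 (by positivity)
      _ ≤ M2 * (2 * l + 1) ^ 2 := mul_le_mul_of_nonneg_left h4 M20
      _ ≤ (M2 * (2 * l + 1) ^ 2) * (2 * (1 + Cb)) := le_mul_of_one_le_right (by positivity) (by linarith)
      _ = _ := by ring

/-- pair weight -/
def pw (i j : ℤ) : ℝ := 1 / (((i - j).natAbs : ℝ) + 1)

lemma pw_pos (i j : ℤ) : 0 < pw i j := by unfold pw; positivity

lemma sort_bound (S : Std P X Z b Cb G l0 Ca) (l : ℕ) (F : (Fin 4 → ℤ) → ℝ) {M2 : ℝ} (hM2 : ∀ x, |F x| ≤ M2)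
    (hF : ∀ r x, ∫ ω, F (Function.update x r (Nw Z (G l) 0 ω)) ∂P = 0)
    (v : Fin 4 → ℤ) :
    |∫ ω, F (fun i => Nw Z (G l) (v i) ω) ∂P| ≤
      2 * M2 * (1 + Cb) * (2 * (l : ℝ) + 1) ^ 2 *
        ∑ σ : Equiv.Perm (Fin 4), pw (v (σ 0)) (v (σ 1)) * pw (v (σ 2)) (v (σ 3)) := by
  have M20 : 0 ≤ M2 := (abs_nonneg _).trans (hM2 0)
  have hCb := S.Cb0
  set σ := Tuple.sort v with hσ
  have hmono : Monotone (v ∘ σ) := Tuple.monotone_sort v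
  have m01 : v (σ 0) ≤ v (σ 1) := hmono (by decide)
  have m12 : v (σ 1) ≤ v (σ 2) := hmono (by decide)
  have m23 : v (σ 2) ≤ v (σ 3) := hmono (by decide)
  have triv : |∫ ω, F (fun i => Nw Z (G l) (v i) ω) ∂P| ≤ M2 := by
    have := norm_integral_le_of_norm_le_const (μ := P) (f := fun ω => F (fun i => Nw Z (G l) (v i) ω)) (C := M2)
      (Eventually.of_forall fun ω => hM2 _)
    simpa using this
  set E := |∫ ω, F (fun i => Nw Z (G l) (v i) ω) ∂P| with hE
  have E0 : 0 ≤ E := abs_nonneg _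
  have A : E ≤ 2 * M2 * (1 + Cb) * (2 * (l : ℝ) + 1) ^ 2 / (((v (σ 0) - v (σ 1)).natAbs : ℝ) + 1) ^ 2 := by
    refine gap_bound S M20 l _ triv fun hd => ?_
    refine iso_left S l F hM2 (σ 0) (hF _) v _ hd fun j hj => ?_
    obtain ⟨k, rfl⟩ := σ.surjective j
    have : k ≠ 0 := fun h => hj (by rw [h])
    have : v (σ 1) ≤ v (σ k) := hmono ((by decide : ∀ k : Fin 4, k ≠ 0 → 1 ≤ k) k this)
    omega
  have Bd : E ≤ 2 * M2 * (1 + Cb) * (2 * (l : ℝ) + 1) ^ 2 / (((v (σ 2) - v (σ 3)).natAbs : ℝ) + 1) ^ 2 := by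
    refine gap_bound S M20 l _ triv fun hd => ?_
    refine iso_right S l F hM2 (σ 3) (hF _) v _ hd fun j hj => ?_
    obtain ⟨k, rfl⟩ := σ.surjective j
    have : k ≠ 3 := fun h => hj (by rw [h])
    have : v (σ k) ≤ v (σ 2) := hmono ((by decide : ∀ k : Fin 4, k ≠ 3 → k ≤ 2) k this)
    omega
  set K := 2 * M2 * (1 + Cb) * (2 * (l : ℝ) + 1) ^ 2 with hK
  have K0 : 0 ≤ K := by positivity
  have p1 := (pw_pos (v (σ 0)) (v (σ 1))).le
  have p2 := (pw_pos (v (σ 2)) (v (σ 3))).le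
  have A' : E ≤ K * pw (v (σ 0)) (v (σ 1)) ^ 2 := by
    unfold pw; rw [div_pow, one_pow]; rw [mul_one_div]; exact A
  have B' : E ≤ K * pw (v (σ 2)) (v (σ 3)) ^ 2 := by
    unfold pw; rw [div_pow, one_pow]; rw [mul_one_div]; exact Bd
  have C' : E ≤ K * (pw (v (σ 0)) (v (σ 1)) * pw (v (σ 2)) (v (σ 3))) := by
    rcases le_total (pw (v (σ 0)) (v (σ 1))) (pw (v (σ 2)) (v (σ 3))) with hle | hle
    · refine A'.trans (mul_le_mul_of_nonneg_left ?_ K0)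
      nlinarith
    · refine B'.trans (mul_le_mul_of_nonneg_left ?_ K0)
      nlinarith
  refine C'.trans (mul_le_mul_of_nonneg_left ?_ K0)
  exact Finset.single_le_sum (f := fun σ : Equiv.Perm (Fin 4) => pw (v (σ 0)) (v (σ 1)) * pw (v (σ 2)) (v (σ 3)))
    (fun σ _ => mul_nonneg (pw_pos _ _).le (pw_pos _ _).le) (Finset.mem_univ σ)

lemma sum_pi4 (I : Finset ℤ) (f : ℤ → ℤ → ℤ → ℤ → ℝ) :
    ∑ v ∈ Fintype.piFinset (fun _ : Fin 4 => I), f (v 0) (v 1) (v 2) (v 3)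
      = ∑ i ∈ I, ∑ j ∈ I, ∑ k ∈ I, ∑ m ∈ I, f i j k m := by
  have : ∑ i ∈ I, ∑ j ∈ I, ∑ k ∈ I, ∑ m ∈ I, f i j k m
      = ∑ q ∈ I ×ˢ I ×ˢ I ×ˢ I, f q.1 q.2.1 q.2.2.1 q.2.2.2 := by
    simp only [Finset.sum_product]
  rw [this]
  refine Finset.sum_nbij' (fun v => (v 0, v 1, v 2, v 3)) (fun q => ![q.1, q.2.1, q.2.2.1, q.2.2.2]) ?_ ?_ ?_ ?_ ?_
  · intro v hv
    rw [Fintype.mem_piFinset] at hv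
    simp [hv]
  · intro q hq
    rw [Fintype.mem_piFinset]
    simp only [Finset.mem_product] at hq
    intro i
    fin_cases i
    · exact hq.1
    · exact hq.2.1
    · exact hq.2.2.1
    · exact hq.2.2.2
  · intro v _
    ext i; fin_cases i <;> rfl
  · intro q _; rfl
  · intro v _; rfl

lemma sum_perm (I : Finset ℤ) :
    ∑ v ∈ Fintype.piFinset (fun _ : Fin 4 => I), ∑ σ : Equiv.Perm (Fin 4),
        pw (v (σ 0)) (v (σ 1)) * pw (v (σ 2)) (v (σ 3))
      = 24 * (∑ i ∈ I, ∑ j ∈ I, pw i j) ^ 2 := by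
  rw [Finset.sum_comm]
  have h1 : ∀ σ : Equiv.Perm (Fin 4), ∑ v ∈ Fintype.piFinset (fun _ : Fin 4 => I),
      pw (v (σ 0)) (v (σ 1)) * pw (v (σ 2)) (v (σ 3)) = (∑ i ∈ I, ∑ j ∈ I, pw i j) ^ 2 := by
    intro σ
    have h2 : ∑ v ∈ Fintype.piFinset (fun _ : Fin 4 => I), pw (v (σ 0)) (v (σ 1)) * pw (v (σ 2)) (v (σ 3))
        = ∑ v ∈ Fintype.piFinset (fun _ : Fin 4 => I), pw (v 0) (v 1) * pw (v 2) (v 3) := by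
      refine Finset.sum_nbij' (fun v => v ∘ σ) (fun v => v ∘ σ.symm) ?_ ?_ ?_ ?_ ?_
      · intro v hv; rw [Fintype.mem_piFinset] at hv ⊢; exact fun i => hv _
      · intro v hv; rw [Fintype.mem_piFinset] at hv ⊢; exact fun i => hv _
      · intro v _; ext i; simp
      · intro v _; ext i; simp
      · intro v _; rfl
    rw [h2, sum_pi4 I (fun i j k m => pw i j * pw k m)]
    simp only [← Finset.mul_sum, ← Finset.sum_mul, sq]
  simp only [h1, Finset.sum_const, Finset.card_univ, Fintype.card_perm, Fintype.card_fin]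
  simp [Nat.factorial]

/-- ordered double sum of a grid kernel -/
def DS (Z : ℤ → Ω → ℝ) {l : ℕ} (G : (Fin (2 * l + 1) → ℝ) → ℤ) (K : ℤ → ℤ → ℝ) (I : Finset ℤ) (ω : Ω) : ℝ :=
  ∑ i ∈ I, ∑ j ∈ I, if i < j then K (Nw Z G i ω) (Nw Z G j ω) else 0

lemma DS_meas (S : Std P X Z b Cb G l0 Ca) (l : ℕ) (K : ℤ → ℤ → ℝ) (I : Finset ℤ) :
    Measurable (DS Z (G l) K I) := by
  refine Finset.measurable_sum _ fun i _ => Finset.measurable_sum _ fun j _ => ?_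
  by_cases hij : i < j
  · simp only [hij, if_true]; exact meas_ZZ K (S.hN l i) (S.hN l j)
  · simp only [hij, if_false]; exact measurable_const

lemma DS_sq (S : Std P X Z b Cb G l0 Ca) (l : ℕ) (K : ℤ → ℤ → ℝ) {M' : ℝ} (hM : ∀ a c, |K a c| ≤ M')
    (hs : ∀ a c, K a c = K c a) (h0 : ∀ a, ∫ ω, K a (Nw Z (G l) 0 ω) ∂P = 0) (I : Finset ℤ) :
    ∫ ω, DS Z (G l) K I ω ^ 2 ∂P ≤ 2 * M' ^ 2 * (1 + Cb) * (2 * (l : ℝ) + 1) ^ 2 *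
      (24 * (∑ i ∈ I, ∑ j ∈ I, pw i j) ^ 2) := by
  have M0 : 0 ≤ M' := (abs_nonneg _).trans (hM 0 0)
  set A : ℤ → ℤ → Ω → ℝ := fun i j ω => if i < j then K (Nw Z (G l) i ω) (Nw Z (G l) j ω) else 0 with hA
  have mA : ∀ i j, Measurable (A i j) := fun i j => by
    by_cases hij : i < j
    · simp only [hA, hij, if_true]; exact meas_ZZ K (S.hN l i) (S.hN l j)
    · simp only [hA, hij, if_false]; exact measurable_const
  have bA : ∀ i j ω, |A i j ω| ≤ M' := fun i j ω => by
    by_cases hij : i < j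
    · simp only [hA, hij, if_true]; exact hM _ _
    · simp only [hA, hij, if_false, abs_zero]; exact M0
  have iA : ∀ i j k m, Integrable (fun ω => A i j ω * A k m ω) P := fun i j k m =>
    int_bdd ((mA i j).mul (mA k m)) (M := M' * M') fun ω => by
      rw [abs_mul]; exact mul_le_mul (bA _ _ _) (bA _ _ _) (abs_nonneg _) M0
  have e1 : ∀ ω, DS Z (G l) K I ω ^ 2 = ∑ v ∈ Fintype.piFinset (fun _ : Fin 4 => I),
      A (v 0) (v 1) ω * A (v 2) (v 3) ω := fun ω => by
    rw [sum_pi4 I (fun i j k m => A i j ω * A k m ω)]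
    simp only [← Finset.mul_sum, ← Finset.sum_mul]
    rw [sq]; rfl
  simp only [e1]
  rw [integral_finsetSum _ fun v _ => iA _ _ _ _, ← sum_perm, Finset.mul_sum]
  refine Finset.sum_le_sum fun v _ => ?_
  set F : (Fin 4 → ℤ) → ℝ := fun x => K (x 0) (x 1) * K (x 2) (x 3) with hFd
  have hF : ∀ x, |F x| ≤ M' ^ 2 := fun x => by
    rw [hFd, sq]; simp only [abs_mul]
    exact mul_le_mul (hM _ _) (hM _ _) (abs_nonneg _) M0
  have h0' : ∀ a, ∫ ω, K (Nw Z (G l) 0 ω) a ∂P = 0 := fun a => by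
    rw [← h0 a]; congr 1; ext ω; exact hs _ _
  have hF0 : ∀ r x, ∫ ω, F (Function.update x r (Nw Z (G l) 0 ω)) ∂P = 0 := by
    intro r x
    fin_cases r
    · simp [hFd, Function.update, integral_mul_const, h0']
    · simp [hFd, Function.update, integral_mul_const, h0]
    · simp [hFd, Function.update, integral_const_mul, h0']
    · simp [hFd, Function.update, integral_const_mul, h0]
  have hb := sort_bound S l F hF hF0 v
  refine le_trans ?_ hb
  by_cases h01 : v 0 < v 1
  · by_cases h23 : v 2 < v 3
    · simp only [hA, h01, h23, if_true]
      exact le_abs_self _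
    · simp only [hA, h23, if_false, mul_zero, integral_zero]; exact abs_nonneg _
  · simp only [hA, h01, if_false, zero_mul, integral_zero]; exact abs_nonneg _

end
end UQuantile

namespace UQuantile

variable {Ω : Type*} [MeasurableSpace Ω]

section
variable {P : Measure Ω} [IsProbabilityMeasure P] {X Z : ℤ → Ω → ℝ} {b : ℕ → ℝ} {Cb : ℝ}
    {G : (l : ℕ) → (Fin (2 * l + 1) → ℝ) → ℤ} {l0 : ℕ} {Ca : ℝ} {h : ℝ → ℝ → ℝ → ℝ} {M : ℝ}

lemma harm_le {n : ℕ} (hn : 1 ≤ n) : ∑ k ∈ Finset.range n, 1 / ((k : ℝ) + 1) ≤ 21 * ms n := by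
  have h := harmonic_le_one_add_log n
  have e : ((harmonic n : ℚ) : ℝ) = ∑ k ∈ Finset.range n, 1 / ((k : ℝ) + 1) := by
    simp [harmonic]
  rw [e] at h
  have hn0 : (0 : ℝ) < n := by exact_mod_cast hn
  have hm0 : (0 : ℝ) ≤ ms n := Nat.cast_nonneg _
  have hm : (1 : ℝ) ≤ ms n := by
    have h1 := ms_lower n
    have h2 : (1 : ℝ) ≤ n := by exact_mod_cast hn
    by_contra hc
    push Not at hc
    have := pow_lt_one₀ hm0 hc (by norm_num : (20 : ℕ) ≠ 0)
    linarith
  have hl : Real.log n ≤ 20 * ms n := by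
    calc Real.log n ≤ Real.log ((ms n : ℝ) ^ 20) := Real.log_le_log hn0 (ms_lower n)
      _ = 20 * Real.log (ms n) := by rw [Real.log_pow]; norm_num
      _ ≤ 20 * ms n := by
        have := Real.log_le_sub_one_of_pos (by linarith : (0 : ℝ) < ms n)
        linarith
  linarith

lemma pw_row {n : ℕ} (i : ℤ) (hi : i ∈ Finset.Icc (1 : ℤ) n) :
    ∑ j ∈ Finset.Icc (1 : ℤ) n, pw i j ≤ 2 * ∑ k ∈ Finset.range n, 1 / ((k : ℝ) + 1) := by
  have hmaps : ∀ j ∈ Finset.Icc (1 : ℤ) n, (i - j).natAbs ∈ Finset.range n := by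
    intro j hj
    rw [Finset.mem_Icc] at *
    rw [Finset.mem_range]; omega
  rw [← Finset.sum_fiberwise_of_maps_to hmaps, Finset.mul_sum]
  refine Finset.sum_le_sum fun k _ => ?_
  have e : ∀ j ∈ (Finset.Icc (1 : ℤ) n).filter (fun j => (i - j).natAbs = k), pw i j = 1 / ((k : ℝ) + 1) := by
    intro j hj
    rw [Finset.mem_filter] at hj
    unfold pw; rw [hj.2]
  rw [Finset.sum_congr rfl e, Finset.sum_const, nsmul_eq_mul]
  refine mul_le_mul_of_nonneg_right ?_ (by positivity)
  have : ((Finset.Icc (1 : ℤ) n).filter (fun j => (i - j).natAbs = k)).card ≤ 2 := by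
    refine (Finset.card_le_card (t := {i - k, i + k}) ?_).trans Finset.card_le_two
    intro j hj
    rw [Finset.mem_filter] at hj
    simp only [Finset.mem_insert, Finset.mem_singleton]
    omega
  exact_mod_cast this

lemma pw_sum {n : ℕ} (hn : 1 ≤ n) :
    ∑ i ∈ Finset.Icc (1 : ℤ) n, ∑ j ∈ Finset.Icc (1 : ℤ) n, pw i j ≤ n * (42 * ms n) := by
  calc _ ≤ ∑ i ∈ Finset.Icc (1 : ℤ) n, (42 * ms n : ℝ) := Finset.sum_le_sum fun i hi =>
        (pw_row i hi).trans (by linarith [harm_le hn])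
    _ = _ := by simp

lemma Std.h2_meas (S : Std P X Z b Cb G l0 Ca) (hker : IsUQKernel h) (t : ℝ) (i j : ℤ) :
    Measurable fun ω => h2 (P.map (X 0)) h (X i ω) (X j ω) t := by
  unfold h2
  exact (((meas_h hker t (S.hX i) (S.hX j)).sub ((S.h1_meas hker t).comp (S.hX i))).sub
    ((S.h1_meas hker t).comp (S.hX j))).sub measurable_const

/-- unified pair bound -/
lemma Std.pair_bound (S : Std P X Z b Cb G l0 Ca) (hker : IsUQKernel h) (M0 : 0 ≤ M)
    (hM : ∀ x y t, h x y t ≤ M) {L t : ℝ} (hL : 0 ≤ L) (hv : VariationAt (P.map (X 0)) h L t)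
    {l : ℕ} (hl : l0 ≤ l) {i j : ℤ} (hij : i < j) :
    ∫ ω, |h2 (P.map (X 0)) h (X i ω) (X j ω) t
        - KN P (Nw Z (G l) 0) (HN h t l) (Nw Z (G l) i ω) (Nw Z (G l) j ω)| ∂P
      ≤ 6 * CA L M Ca / (l : ℝ) ^ 3 + (6 * M + CA L M Ca * Cb) * (2 * (l : ℝ) + 1) ^ 2 * dw (j - i) := by
  have CA0 := S.CA_nonneg hL M0
  have Cb0 := S.Cb0
  have hd0 : ((j - i).natAbs : ℝ) = (j - i : ℝ) := by
    rw [Nat.cast_natAbs, abs_of_pos (by omega)]; push_cast; ring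
  have hlp : (0 : ℝ) ≤ l := Nat.cast_nonneg l
  have hij' : (i : ℝ) < j := by exact_mod_cast hij
  by_cases hc : i + 2 * l < j
  · refine (S.h2_approx hker hM hL hv hl hc).trans (add_le_add le_rfl ?_)
    have hb := S.bC (j - i - 2 * l).toNat
    have e : ((j - i - 2 * l).toNat : ℝ) = j - i - 2 * l := by
      have : ((j - i - 2 * l).toNat : ℤ) = j - i - 2 * l := Int.toNat_of_nonneg (by omega)
      have : (((j - i - 2 * l).toNat : ℤ) : ℝ) = ((j - i - 2 * l : ℤ) : ℝ) := by rw [this]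
      push_cast at this; exact this
    rw [e] at hb
    have hc' : (i : ℝ) + 2 * l < j := by exact_mod_cast hc
    have h3 : Cb / ((j : ℝ) - i - 2 * l + 1) ^ 2 ≤ Cb * (2 * (l : ℝ) + 1) ^ 2 * dw (j - i) := by
      unfold dw
      rw [hd0, mul_one_div, div_le_div_iff₀ (by apply pow_pos; linarith) (by apply pow_pos; linarith), mul_assoc]
      refine mul_le_mul_of_nonneg_left ?_ Cb0
      rw [← mul_pow]
      refine pow_le_pow_left₀ (by linarith) ?_ 2
      nlinarith
    calc CA L M Ca * b (j - i - 2 * l).toNat ≤ CA L M Ca * (Cb * (2 * (l : ℝ) + 1) ^ 2 * dw (j - i)) :=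
          mul_le_mul_of_nonneg_left (hb.trans h3) CA0
      _ ≤ 6 * M * (2 * (l : ℝ) + 1) ^ 2 * dw (j - i) + CA L M Ca * (Cb * (2 * (l : ℝ) + 1) ^ 2 * dw (j - i)) := by
          have := (dw_pos (j - i)).le
          have : 0 ≤ 6 * M * (2 * (l : ℝ) + 1) ^ 2 * dw (j - i) := by positivity
          linarith
      _ = _ := by ring
  · have h6 : ∀ ω, |h2 (P.map (X 0)) h (X i ω) (X j ω) t
        - KN P (Nw Z (G l) 0) (HN h t l) (Nw Z (G l) i ω) (Nw Z (G l) j ω)| ≤ 6 * M := fun ω => by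
      have a1 := S.h2_abs hker hM (X i ω) (X j ω) t
      have a2 := KN_abs (P := P) (S.hN l 0) (HN_nonneg hker t l) (HN_le hM t l) (Nw Z (G l) i ω) (Nw Z (G l) j ω)
      refine (abs_sub _ _).trans ?_
      linarith
    have h7 : ∫ ω, |h2 (P.map (X 0)) h (X i ω) (X j ω) t
        - KN P (Nw Z (G l) 0) (HN h t l) (Nw Z (G l) i ω) (Nw Z (G l) j ω)| ∂P ≤ 6 * M := by
      refine (le_abs_self _).trans (abs_int_le fun ω => ?_)
      rw [abs_abs]; exact h6 ω
    refine h7.trans ?_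
    have h8 : 1 ≤ (2 * (l : ℝ) + 1) ^ 2 * dw (j - i) := by
      unfold dw
      rw [hd0, mul_one_div, one_le_div (by apply pow_pos; linarith)]
      refine pow_le_pow_left₀ (by linarith) ?_ 2
      have : (j : ℝ) ≤ i + 2 * l := by
        have : j ≤ i + 2 * l := by omega
        exact_mod_cast this
      linarith
    have h9 : 0 ≤ 6 * CA L M Ca / (l : ℝ) ^ 3 := by positivity
    calc 6 * M ≤ 6 * M + CA L M Ca * Cb := by have := mul_nonneg CA0 Cb0; linarith
      _ ≤ (6 * M + CA L M Ca * Cb) * ((2 * (l : ℝ) + 1) ^ 2 * dw (j - i)) :=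
          le_mul_of_one_le_right (by positivity) h8
      _ = (6 * M + CA L M Ca * Cb) * (2 * (l : ℝ) + 1) ^ 2 * dw (j - i) := by ring
      _ ≤ _ := by linarith

/-- ordered double sum of `h2` -/
def D2 (P : Measure Ω) (X : ℤ → Ω → ℝ) (h : ℝ → ℝ → ℝ → ℝ) (t : ℝ) (I : Finset ℤ) (ω : Ω) : ℝ :=
  ∑ i ∈ I, ∑ j ∈ I, if i < j then h2 (P.map (X 0)) h (X i ω) (X j ω) t else 0

lemma Std.D2_meas (S : Std P X Z b Cb G l0 Ca) (hker : IsUQKernel h) (t : ℝ) (I : Finset ℤ) :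
    Measurable (D2 P X h t I) := by
  refine Finset.measurable_sum _ fun i _ => Finset.measurable_sum _ fun j _ => ?_
  by_cases hij : i < j
  · simp only [hij, if_true]; exact S.h2_meas hker t i j
  · simp only [hij, if_false]; exact measurable_const

lemma dsum_abs (I : Finset ℤ) (A : ℤ → ℤ → ℝ) {B' : ℝ} (hA : ∀ i j, |A i j| ≤ B') :
    |∑ i ∈ I, ∑ j ∈ I, A i j| ≤ I.card * (I.card * B') := by
  calc _ ≤ ∑ i ∈ I, ∑ j ∈ I, |A i j| := (Finset.abs_sum_le_sum_abs _ _).trans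
        (Finset.sum_le_sum fun i _ => Finset.abs_sum_le_sum_abs _ _)
    _ ≤ ∑ i ∈ I, ∑ j ∈ I, B' := Finset.sum_le_sum fun i _ => Finset.sum_le_sum fun j _ => hA i j
    _ = _ := by simp

lemma Std.D2_DS (S : Std P X Z b Cb G l0 Ca) (hker : IsUQKernel h) (M0 : 0 ≤ M)
    (hM : ∀ x y t, h x y t ≤ M) {L t : ℝ} (hL : 0 ≤ L) (hv : VariationAt (P.map (X 0)) h L t)
    {l : ℕ} (hl : l0 ≤ l) (I : Finset ℤ) :
    ∫ ω, |D2 P X h t I ω - DS Z (G l) (KN P (Nw Z (G l) 0) (HN h t l)) I ω| ∂P ≤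
      I.card * (I.card * (6 * CA L M Ca / (l : ℝ) ^ 3)
        + (6 * M + CA L M Ca * Cb) * (2 * (l : ℝ) + 1) ^ 2 * ∑' r, dw r) := by
  have CA0 := S.CA_nonneg hL M0
  have Cb0 := S.Cb0
  set K := KN P (Nw Z (G l) 0) (HN h t l) with hK
  set E : ℤ → ℤ → Ω → ℝ := fun i j ω => if i < j then |h2 (P.map (X 0)) h (X i ω) (X j ω) t
      - K (Nw Z (G l) i ω) (Nw Z (G l) j ω)| else 0 with hE
  have a2 := KN_abs (P := P) (S.hN l 0) (HN_nonneg hker t l) (HN_le hM t l)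
  have iE : ∀ i j, Integrable (E i j) P := fun i j => by
    by_cases hij : i < j
    · simp only [hE, hij, if_true]
      refine int_bdd ((S.h2_meas hker t i j).sub (meas_ZZ K (S.hN l i) (S.hN l j))).abs (M := 6 * M) fun ω => ?_
      rw [abs_abs]
      have a1 := S.h2_abs hker hM (X i ω) (X j ω) t
      refine (abs_sub _ _).trans ?_
      linarith [a2 (Nw Z (G l) i ω) (Nw Z (G l) j ω)]
    · simp only [hE, hij, if_false]; exact integrable_zero _ _ _
  have p : ∀ ω, |D2 P X h t I ω - DS Z (G l) K I ω| ≤ ∑ i ∈ I, ∑ j ∈ I, E i j ω := fun ω => by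
    unfold D2 DS
    rw [← Finset.sum_sub_distrib]
    refine (Finset.abs_sum_le_sum_abs _ _).trans (Finset.sum_le_sum fun i _ => ?_)
    rw [← Finset.sum_sub_distrib]
    refine (Finset.abs_sum_le_sum_abs _ _).trans (Finset.sum_le_sum fun j _ => ?_)
    by_cases hij : i < j
    · simp only [hE, hij, if_true]; exact le_rfl
    · simp only [hE, hij, if_false]; simp
  have iR : Integrable (fun ω => ∑ i ∈ I, ∑ j ∈ I, E i j ω) P :=
    integrable_finsetSum _ fun i _ => integrable_finsetSum _ fun j _ => iE i j
  have iL : Integrable (fun ω => |D2 P X h t I ω - DS Z (G l) K I ω|) P :=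
    iR.mono' ((S.D2_meas hker t I).sub (DS_meas S l K I)).abs.aestronglyMeasurable
      (Eventually.of_forall fun ω => by rw [Real.norm_eq_abs, abs_abs]; exact p ω)
  refine (integral_mono iL iR p).trans ?_
  rw [integral_finsetSum _ fun i _ => integrable_finsetSum _ fun j _ => iE i j]
  set C1 := (6 * M + CA L M Ca * Cb) * (2 * (l : ℝ) + 1) ^ 2 with hC1
  have C10 : 0 ≤ C1 := by positivity
  calc _ ≤ ∑ i ∈ I, (I.card * (6 * CA L M Ca / (l : ℝ) ^ 3) + C1 * ∑' r, dw r) := ?_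
    _ = _ := by rw [Finset.sum_const, nsmul_eq_mul]
  refine Finset.sum_le_sum fun i _ => ?_
  rw [integral_finsetSum _ fun j _ => iE i j]
  calc _ ≤ ∑ j ∈ I, (6 * CA L M Ca / (l : ℝ) ^ 3 + C1 * dw (j - i)) := ?_
    _ = I.card * (6 * CA L M Ca / (l : ℝ) ^ 3) + C1 * ∑ j ∈ I, dw (j - i) := by
      rw [Finset.sum_add_distrib, Finset.mul_sum]; simp
    _ ≤ _ := by
      refine add_le_add le_rfl (mul_le_mul_of_nonneg_left ?_ C10)
      exact (le_abs_self _).trans (sum_shift_le summable_dw (fun r => by rw [abs_of_pos (dw_pos r)]) I i)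
  refine Finset.sum_le_sum fun j _ => ?_
  by_cases hij : i < j
  · simp only [hE, hij, if_true]
    exact S.pair_bound hker M0 hM hL hv hl hij
  · simp only [hE, hij, if_false, integral_zero]
    have := (dw_pos (j - i)).le
    positivity

end
end UQuantile

namespace UQuantile

variable {Ω : Type*} [MeasurableSpace Ω]

section
variable {P : Measure Ω} [IsProbabilityMeasure P] {X Z : ℤ → Ω → ℝ} {b : ℕ → ℝ} {Cb : ℝ}
    {G : (l : ℕ) → (Fin (2 * l + 1) → ℝ) → ℤ} {l0 : ℕ} {Ca : ℝ} {h : ℝ → ℝ → ℝ → ℝ} {M : ℝ}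

lemma ms_one {n : ℕ} (hn : 1 ≤ n) : (1 : ℝ) ≤ ms n := by
  have h1 := ms_lower n
  have hm0 : (0 : ℝ) ≤ ms n := Nat.cast_nonneg _
  have h2 : (1 : ℝ) ≤ n := by exact_mod_cast hn
  by_contra hc
  push Not at hc
  have := pow_lt_one₀ hm0 hc (by norm_num : (20 : ℕ) ≠ 0)
  linarith

lemma Std.D2_L1 (S : Std P X Z b Cb G l0 Ca) (hker : IsUQKernel h) (M0 : 0 ≤ M)
    (hM : ∀ x y t, h x y t ≤ M) {L t : ℝ} (hL : 0 ≤ L) (hv : VariationAt (P.map (X 0)) h L t)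
    {n : ℕ} (hn : 1 ≤ n) {l : ℕ} (hl : l0 ≤ l) :
    ∫ ω, |D2 P X h t (Finset.Icc (1 : ℤ) n) ω| ∂P ≤
      Real.sqrt (432 * M ^ 2 * (1 + Cb)) * ((2 * (l : ℝ) + 1) * (n * (42 * ms n)))
      + n * (n * (6 * CA L M Ca / (l : ℝ) ^ 3)
        + (6 * M + CA L M Ca * Cb) * (2 * (l : ℝ) + 1) ^ 2 * ∑' r, dw r) := by
  have Cb0 := S.Cb0
  set I := Finset.Icc (1 : ℤ) n with hI
  have cI : (I.card : ℝ) = n := by simp [hI]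
  set K := KN P (Nw Z (G l) 0) (HN h t l) with hK
  have a2 := KN_abs (P := P) (S.hN l 0) (HN_nonneg hker t l) (HN_le hM t l)
  have B1 := S.D2_DS hker M0 hM hL hv hl I
  have B2 := DS_sq S l K (M' := 3 * M) a2 (KN_symm (P := P) (N := Nw Z (G l) 0) (F := HN h t l) (fun a c => hker.symm _ _ _))
    (KN_int (P := P) (S.hN l 0) (HN_nonneg hker t l) (HN_le hM t l)) I
  have bDS : ∀ ω, |DS Z (G l) K I ω| ≤ I.card * (I.card * (3 * M)) := fun ω => by
    refine dsum_abs I _ fun i j => ?_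
    by_cases hij : i < j
    · simp only [hij, if_true]; exact a2 _ _
    · simp only [hij, if_false, abs_zero]; positivity
  have bD2 : ∀ ω, |D2 P X h t I ω| ≤ I.card * (I.card * (3 * M)) := fun ω => by
    refine dsum_abs I _ fun i j => ?_
    by_cases hij : i < j
    · simp only [hij, if_true]; exact S.h2_abs hker hM _ _ _
    · simp only [hij, if_false, abs_zero]; positivity
  have B3 := L1_le_L2 (P := P) (DS_meas S l K I) bDS
  have W0 : 0 ≤ ∑ i ∈ I, ∑ j ∈ I, pw i j :=
    Finset.sum_nonneg fun i _ => Finset.sum_nonneg fun j _ => (pw_pos i j).le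
  have B4 : Real.sqrt (∫ ω, DS Z (G l) K I ω ^ 2 ∂P) ≤
      Real.sqrt (432 * M ^ 2 * (1 + Cb)) * ((2 * (l : ℝ) + 1) * (n * (42 * ms n))) := by
    calc _ ≤ Real.sqrt (432 * M ^ 2 * (1 + Cb) * ((2 * (l : ℝ) + 1) * ∑ i ∈ I, ∑ j ∈ I, pw i j) ^ 2) := by
          refine Real.sqrt_le_sqrt (B2.trans (le_of_eq ?_)); ring
      _ = Real.sqrt (432 * M ^ 2 * (1 + Cb)) * ((2 * (l : ℝ) + 1) * ∑ i ∈ I, ∑ j ∈ I, pw i j) := by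
          rw [Real.sqrt_mul (by positivity), Real.sqrt_sq (by positivity)]
      _ ≤ _ := mul_le_mul_of_nonneg_left (mul_le_mul_of_nonneg_left (pw_sum hn) (by positivity)) (Real.sqrt_nonneg _)
  rw [cI] at B1
  have mD : Measurable fun ω => D2 P X h t I ω - DS Z (G l) K I ω := (S.D2_meas hker t I).sub (DS_meas S l K I)
  have i1 : Integrable (fun ω => |DS Z (G l) K I ω|) P := (int_bdd (DS_meas S l K I) bDS).abs
  have i2 : Integrable (fun ω => |D2 P X h t I ω - DS Z (G l) K I ω|) P :=
    ((int_bdd (S.D2_meas hker t I) bD2).sub (int_bdd (DS_meas S l K I) bDS)).abs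
  have i3 : Integrable (fun ω => |D2 P X h t I ω|) P := (int_bdd (S.D2_meas hker t I) bD2).abs
  have i4 : Integrable (fun ω => |DS Z (G l) K I ω| + |D2 P X h t I ω - DS Z (G l) K I ω|) P := i1.add i2
  have : ∫ ω, |D2 P X h t I ω| ∂P ≤ ∫ ω, (|DS Z (G l) K I ω| + |D2 P X h t I ω - DS Z (G l) K I ω|) ∂P :=
    integral_mono i3 i4 fun ω => by
      have := abs_add_le (DS Z (G l) K I ω) (D2 P X h t I ω - DS Z (G l) K I ω)
      rw [add_sub_cancel] at this
      exact this
  rw [integral_add i1 i2] at this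
  exact this.trans (add_le_add (B3.trans B4) B1)

lemma scal_bound {n : ℕ} (hn : 2 ≤ n) {A Bq Dq : ℝ} (A0 : 0 ≤ A) (B0 : 0 ≤ Bq) (D0 : 0 ≤ Dq) :
    Real.sqrt n * (2 / ((n : ℝ) * ((n : ℝ) - 1))) *
      (A * ((2 * ((ms n ^ 4 : ℕ) : ℝ) + 1) * (n * (42 * ms n)))
      + n * (n * (Bq / ((ms n ^ 4 : ℕ) : ℝ) ^ 3) + Dq * (2 * ((ms n ^ 4 : ℕ) : ℝ) + 1) ^ 2)) ≤
      (2 ^ 20 * A + 4 * Bq + 2 ^ 16 * Dq) / ms n := by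
  have hm := ms_one (by omega : 1 ≤ n)
  have u1 := ms_le_sqrt (by omega : 1 ≤ n)
  have u2 := sqrt_le_ms n
  have hs : Real.sqrt n ^ 2 = n := Real.sq_sqrt (Nat.cast_nonneg n)
  have hn2 : (2 : ℝ) ≤ n := by exact_mod_cast hn
  push_cast
  generalize (ms n : ℝ) = m at *
  have hs0 : 0 < Real.sqrt n := Real.sqrt_pos.2 (by linarith)
  generalize Real.sqrt n = s at *
  rw [← hs] at hn2 ⊢
  have hm4 : 2 * m ^ 4 + 1 ≤ 3 * m ^ 4 := by have := one_le_pow₀ hm (n := 4); linarith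
  have m0 : 0 < m := by linarith
  have hq : s * (2 / (s ^ 2 * (s ^ 2 - 1))) ≤ 4 / s ^ 3 := by
    rw [mul_div_assoc', div_le_div_iff₀ (by apply mul_pos; positivity; linarith) (by positivity)]
    have : 0 < s ^ 4 := by positivity
    nlinarith
  have R0 : 0 ≤ A * (3 * m ^ 4 * (s ^ 2 * (42 * m))) + s ^ 2 * (s ^ 2 * (Bq / (m ^ 4) ^ 3) + Dq * (3 * m ^ 4) ^ 2) := by positivity
  calc _ ≤ 4 / s ^ 3 * (A * (3 * m ^ 4 * (s ^ 2 * (42 * m))) + s ^ 2 * (s ^ 2 * (Bq / (m ^ 4) ^ 3) + Dq * (3 * m ^ 4) ^ 2)) := by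
        refine mul_le_mul hq ?_ (by positivity) (by positivity)
        refine add_le_add (mul_le_mul_of_nonneg_left (mul_le_mul_of_nonneg_right hm4 (by positivity)) A0) ?_
        refine mul_le_mul_of_nonneg_left (add_le_add le_rfl (mul_le_mul_of_nonneg_left ?_ D0)) (by positivity)
        exact pow_le_pow_left₀ (by positivity) hm4 2
    _ = A * (504 * (m ^ 5 / s)) + 4 * Bq * (s / m ^ 12) + Dq * (36 * (m ^ 8 / s)) := by
        field_simp
        ring
    _ ≤ A * (504 * (2 ^ 10 / m)) + 4 * Bq * (1 / m) + Dq * (36 * (2 ^ 10 / m)) := by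
        have e1 : m ^ 5 / s ≤ 2 ^ 10 / m := by
          rw [div_le_div_iff₀ hs0 m0]
          calc m ^ 5 * m = m ^ 6 := by ring
            _ ≤ m ^ 10 := pow_le_pow_right₀ hm (by norm_num)
            _ ≤ _ := u1
        have e2 : s / m ^ 12 ≤ 1 / m := by
          rw [div_le_div_iff₀ (by positivity) m0]
          calc s * m ≤ m ^ 10 * m := mul_le_mul_of_nonneg_right u2 m0.le
            _ = m ^ 11 := by ring
            _ ≤ m ^ 12 := pow_le_pow_right₀ hm (by norm_num)
            _ = _ := by ring
        have e3 : m ^ 8 / s ≤ 2 ^ 10 / m := by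
          rw [div_le_div_iff₀ hs0 m0]
          calc m ^ 8 * m = m ^ 9 := by ring
            _ ≤ m ^ 10 := pow_le_pow_right₀ hm (by norm_num)
            _ ≤ _ := u1
        have := mul_le_mul_of_nonneg_left e1 A0
        have := mul_le_mul_of_nonneg_left e2 B0
        have := mul_le_mul_of_nonneg_left e3 D0
        linarith
    _ = (504 * 2 ^ 10 * A + 4 * Bq + 36 * 2 ^ 10 * Dq) / m := by ring
    _ ≤ _ := by
        refine div_le_div_of_nonneg_right ?_ m0.le
        linarith

/-- the degenerate part is negligible -/
lemma Std.deg_lim (S : Std P X Z b Cb G l0 Ca) (hker : IsUQKernel h) (M0 : 0 ≤ M)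
    (hM : ∀ x y t, h x y t ≤ M) {L : ℝ} (hL : 0 ≤ L) (t : ℕ → ℝ)
    (hv : ∀ᶠ n in atTop, VariationAt (P.map (X 0)) h L (t n)) :
    Tendsto (fun n : ℕ => Real.sqrt n * (2 / ((n : ℝ) * ((n : ℝ) - 1))) *
      ∫ ω, |D2 P X h (t n) (Finset.Icc (1 : ℤ) n) ω| ∂P) atTop (𝓝 0) := by
  have Cb0 := S.Cb0
  have CA0 := S.CA_nonneg hL M0
  have D0 : 0 ≤ ∑' r, dw r := tsum_nonneg fun r => (dw_pos r).le
  refine squeeze_zero' (g := fun n => (2 ^ 20 * Real.sqrt (432 * M ^ 2 * (1 + Cb)) + 4 * (6 * CA L M Ca)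
    + 2 ^ 16 * ((6 * M + CA L M Ca * Cb) * ∑' r, dw r)) / ms n) ?_ ?_ (ms_tendstoR.const_div_atTop _)
  · filter_upwards [eventually_ge_atTop 2] with n hn
    have : (2 : ℝ) ≤ n := by exact_mod_cast hn
    have h1 : 0 < (n : ℝ) * ((n : ℝ) - 1) := by nlinarith
    have : 0 ≤ ∫ ω, |D2 P X h (t n) (Finset.Icc (1 : ℤ) n) ω| ∂P := integral_nonneg fun _ => abs_nonneg _
    positivity
  · filter_upwards [eventually_ge_atTop 2, hv, ms_tendsto.eventually_ge_atTop l0] with n hn hvn hl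
    have hl4 : l0 ≤ ms n ^ 4 := hl.trans (Nat.le_self_pow (by norm_num) _)
    have : (2 : ℝ) ≤ n := by exact_mod_cast hn
    have h1 : 0 < (n : ℝ) * ((n : ℝ) - 1) := by nlinarith
    refine le_trans (mul_le_mul_of_nonneg_left (S.D2_L1 hker M0 hM hL hvn (by omega : 1 ≤ n) hl4) (by positivity)) ?_
    refine le_trans (le_of_eq ?_) (scal_bound hn (Real.sqrt_nonneg _) (by positivity : 0 ≤ 6 * CA L M Ca)
      (by positivity : 0 ≤ (6 * M + CA L M Ca * Cb) * ∑' r, dw r))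
    ring

end
end UQuantile

namespace UQuantile

variable {Ω : Type*} [MeasurableSpace Ω]

section
variable {P : Measure Ω} [IsProbabilityMeasure P] {X Z : ℤ → Ω → ℝ} {b : ℕ → ℝ} {Cb : ℝ}
    {G : (l : ℕ) → (Fin (2 * l + 1) → ℝ) → ℤ} {l0 : ℕ} {Ca : ℝ} {h : ℝ → ℝ → ℝ → ℝ} {M : ℝ}

lemma sum_Ioc_eq (n : ℕ) (f : ℤ → ℤ → ℝ) :
    ∑ i ∈ Finset.Icc (1 : ℤ) (n : ℤ), ∑ j ∈ Finset.Ioc i (n : ℤ), f i j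
      = ∑ i ∈ Finset.Icc (1 : ℤ) (n : ℤ), ∑ j ∈ Finset.Icc (1 : ℤ) (n : ℤ), if i < j then f i j else 0 := by
  refine Finset.sum_congr rfl fun i hi => ?_
  rw [← Finset.sum_filter]
  refine Finset.sum_congr ?_ fun _ _ => rfl
  ext j
  rw [Finset.mem_Icc] at hi
  simp only [Finset.mem_Ioc, Finset.mem_filter, Finset.mem_Icc]
  omega

lemma sum_lt_pair (I : Finset ℤ) (a : ℤ → ℝ) :
    ∑ i ∈ I, ∑ j ∈ I, (if i < j then a i + a j else 0) = (I.card - 1) * ∑ i ∈ I, a i := by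
  have e1 : ∑ i ∈ I, ∑ j ∈ I, (if i < j then a j else 0) = ∑ i ∈ I, ∑ j ∈ I, (if j < i then a i else 0) :=
    Finset.sum_comm
  have e2 : ∑ i ∈ I, ∑ j ∈ I, (if i < j then a i + a j else 0)
      = ∑ i ∈ I, ∑ j ∈ I, (if i < j then a i else 0) + ∑ i ∈ I, ∑ j ∈ I, (if i < j then a j else 0) := by
    rw [← Finset.sum_add_distrib]
    refine Finset.sum_congr rfl fun i _ => ?_
    rw [← Finset.sum_add_distrib]
    refine Finset.sum_congr rfl fun j _ => ?_
    split_ifs <;> simp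
  rw [e2, e1, ← Finset.sum_add_distrib, Finset.mul_sum]
  refine Finset.sum_congr rfl fun i hi => ?_
  rw [← Finset.sum_add_distrib]
  have e3 : ∀ j ∈ I, ((if i < j then a i else 0) + (if j < i then a i else 0)) = a i - (if i = j then a i else 0) := by
    intro j _
    rcases lt_trichotomy i j with hij | hij | hij
    · simp [hij, hij.not_gt, hij.ne]
    · simp [hij]
    · simp [hij, hij.not_gt, hij.ne']
  rw [Finset.sum_congr rfl e3, Finset.sum_sub_distrib, Finset.sum_ite_eq]
  simp [hi]
  ring

/-- Hoeffding decomposition -/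
lemma hoeffding {n : ℕ} (hn : 2 ≤ n) (t : ℝ) (ω : Ω) :
    Ustat X h n t ω - Udist (P.map (X 0)) h t
      = 2 / n * SI X (fun x => h1 (P.map (X 0)) h x t) (Finset.Icc 1 (n : ℤ)) ω
        + 2 / ((n : ℝ) * ((n : ℝ) - 1)) * D2 P X h t (Finset.Icc 1 (n : ℤ)) ω := by
  have hn2 : (2 : ℝ) ≤ n := by exact_mod_cast hn
  unfold Ustat D2
  rw [sum_Ioc_eq n (fun i j => h (X i ω) (X j ω) t)]
  set I := Finset.Icc (1 : ℤ) n with hI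
  have cI : (I.card : ℝ) = n := by simp [hI]
  set a : ℤ → ℝ := fun i => h1 (P.map (X 0)) h (X i ω) t + Udist (P.map (X 0)) h t / 2 with ha
  have e1 : ∑ i ∈ I, ∑ j ∈ I, (if i < j then h (X i ω) (X j ω) t else 0)
      = ∑ i ∈ I, ∑ j ∈ I, (if i < j then h2 (P.map (X 0)) h (X i ω) (X j ω) t else 0)
        + ∑ i ∈ I, ∑ j ∈ I, (if i < j then a i + a j else 0) := by
    rw [← Finset.sum_add_distrib]
    refine Finset.sum_congr rfl fun i _ => ?_
    rw [← Finset.sum_add_distrib]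
    refine Finset.sum_congr rfl fun j _ => ?_
    split_ifs
    · simp only [ha, h2]; ring
    · simp
  have e2 : ∑ i ∈ I, a i = SI X (fun x => h1 (P.map (X 0)) h x t) I ω + n * (Udist (P.map (X 0)) h t / 2) := by
    simp only [ha, Finset.sum_add_distrib, SI, Finset.sum_const, nsmul_eq_mul, cI]
  rw [e1, sum_lt_pair, e2, cI]
  have : (n : ℝ) - 1 ≠ 0 := by linarith
  have : (n : ℝ) ≠ 0 := by linarith
  field_simp
  ring

lemma markov {f : Ω → ℝ} (hf : Integrable f P) {ε : ℝ} (hε : 0 < ε) :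
    P.real {ω | ε ≤ |f ω|} ≤ (∫ ω, |f ω| ∂P) / ε := by
  rw [le_div_iff₀ hε, mul_comm]
  exact mul_meas_ge_le_integral_of_nonneg (Eventually.of_forall fun _ => abs_nonneg _) hf.abs ε

/-- the linearisation error -/
def Rn (P : Measure Ω) (X : ℤ → Ω → ℝ) (h : ℝ → ℝ → ℝ → ℝ) (t0 : ℝ) (n : ℕ) (t : ℝ) (ω : Ω) : ℝ :=
  Real.sqrt n * (Ustat X h n t ω - Udist (P.map (X 0)) h t)
    - 2 / Real.sqrt n * SI X (fun x => h1 (P.map (X 0)) h x t0) (Finset.Icc 1 (n : ℤ)) ω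

lemma Std.Rn_lim (S : Std P X Z b Cb G l0 Ca) (hker : IsUQKernel h)
    (hM : ∀ x y t, h x y t ≤ M) {L t0 : ℝ} (hL : 0 ≤ L) (t : ℕ → ℝ)
    (hv : ∀ n, VariationAt (P.map (X 0)) h L (t n)) (hv0 : VariationAt (P.map (X 0)) h L t0)
    (hU : Tendsto (fun n => Udist (P.map (X 0)) h (t n)) atTop (𝓝 (Udist (P.map (X 0)) h t0)))
    {ε : ℝ} (hε : 0 < ε) :
    Tendsto (fun n : ℕ => P.real {ω | ε ≤ |Rn P X h t0 n (t n) ω|}) atTop (𝓝 0) := by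
  have M0 : 0 ≤ M := (hker.nonneg 0 0 0).trans (hM 0 0 0)
  have hg := fun n => GoodFn.sub S (S.h1_good hker hM hL (hv n)) (S.h1_good hker hM hL hv0)
  have L1 := S.h1_incr_var hker hM hL t hv hv0 hU
  have L2 := S.deg_lim hker M0 hM hL t (Eventually.of_forall hv)
  have L3 : Tendsto (fun n : ℕ => (2 * Real.sqrt ((∫ ω, SI X (fun x => h1 (P.map (X 0)) h x (t n) - h1 (P.map (X 0)) h x t0)
      (Finset.Icc 1 (n : ℤ)) ω ^ 2 ∂P) / n) + Real.sqrt n * (2 / ((n : ℝ) * ((n : ℝ) - 1))) *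
      ∫ ω, |D2 P X h (t n) (Finset.Icc (1 : ℤ) n) ω| ∂P) / ε) atTop (𝓝 0) := by
    have := ((L1.sqrt.const_mul 2).add L2).div_const ε
    simpa using this
  refine squeeze_zero' (Eventually.of_forall fun n => measureReal_nonneg) ?_ L3
  filter_upwards [eventually_ge_atTop 2] with n hn
  have hn2 : (2 : ℝ) ≤ n := by exact_mod_cast hn
  have hs0 : 0 < Real.sqrt n := Real.sqrt_pos.2 (by linarith)
  have hss : Real.sqrt n * Real.sqrt n = n := Real.mul_self_sqrt (by linarith)
  set I := Finset.Icc (1 : ℤ) n with hI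
  set d : Ω → ℝ := SI X (fun x => h1 (P.map (X 0)) h x (t n) - h1 (P.map (X 0)) h x t0) I with hd
  set q := Real.sqrt n * (2 / ((n : ℝ) * ((n : ℝ) - 1))) with hq
  have q0 : 0 ≤ q := by
    have h1 : 0 < (n : ℝ) * ((n : ℝ) - 1) := by nlinarith
    positivity
  have e : ∀ ω, Rn P X h t0 n (t n) ω = 2 / Real.sqrt n * d ω + q * D2 P X h (t n) I ω := by
    intro ω
    unfold Rn
    rw [hoeffding hn]
    have e1 : d ω = SI X (fun x => h1 (P.map (X 0)) h x (t n)) I ω - SI X (fun x => h1 (P.map (X 0)) h x t0) I ω := by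
      simp only [hd, SI, Finset.sum_sub_distrib]
    have e2 : Real.sqrt n * (2 / n) = 2 / Real.sqrt n := by
      rw [mul_div_assoc', div_eq_div_iff (by linarith) hs0.ne']
      linear_combination 2 * hss
    rw [e1, mul_add, ← mul_assoc, ← mul_assoc, e2]
    ring
  have bD2 : ∀ ω, |D2 P X h (t n) I ω| ≤ I.card * (I.card * (3 * M)) := fun ω => by
    refine dsum_abs I _ fun i j => ?_
    by_cases hij : i < j
    · simp only [hij, if_true]; exact S.h2_abs hker hM _ _ _
    · simp only [hij, if_false, abs_zero]; positivity
  have i1 : Integrable d P := int_bdd (SI_meas S (hg n) I) (SI_abs (hg n) I)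
  have i2 : Integrable (fun ω => D2 P X h (t n) I ω) P := int_bdd (S.D2_meas hker _ I) bD2
  have i3 : Integrable (fun ω => 2 / Real.sqrt n * d ω + q * D2 P X h (t n) I ω) P :=
    (i1.const_mul _).add (i2.const_mul _)
  have mk := markov i3 hε
  simp only [← e] at mk
  refine mk.trans (div_le_div_of_nonneg_right ?_ hε.le)
  simp only [e]
  have i4 : Integrable (fun ω => 2 / Real.sqrt n * |d ω| + q * |D2 P X h (t n) I ω|) P :=
    (i1.abs.const_mul _).add (i2.abs.const_mul _)
  have s1 : ∫ ω, |2 / Real.sqrt n * d ω + q * D2 P X h (t n) I ω| ∂P ≤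
      ∫ ω, (2 / Real.sqrt n * |d ω| + q * |D2 P X h (t n) I ω|) ∂P := by
    refine integral_mono i3.abs i4 fun ω => ?_
    refine (abs_add_le _ _).trans (le_of_eq ?_)
    rw [abs_mul, abs_mul, abs_of_nonneg q0, abs_of_nonneg (by positivity : 0 ≤ 2 / Real.sqrt n)]
  rw [integral_add (i1.abs.const_mul _) (i2.abs.const_mul _), integral_const_mul, integral_const_mul] at s1
  refine s1.trans (add_le_add ?_ le_rfl)
  have l1 : ∫ ω, |d ω| ∂P ≤ Real.sqrt (∫ ω, d ω ^ 2 ∂P) := L1_le_L2 (SI_meas S (hg n) I) (SI_abs (hg n) I)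
  calc 2 / Real.sqrt n * ∫ ω, |d ω| ∂P ≤ 2 / Real.sqrt n * Real.sqrt (∫ ω, d ω ^ 2 ∂P) :=
        mul_le_mul_of_nonneg_left l1 (by positivity)
    _ = _ := by rw [Real.sqrt_div (integral_nonneg fun _ => sq_nonneg _)]; ring

/-- Ghosh-type lemma -/
lemma ghosh {V W : ℕ → Ω → ℝ} {E : ℝ → ℕ → Ω → ℝ}
    (hE : ∀ y, ∀ ε > 0, Tendsto (fun n => P.real {ω | ε ≤ |E y n ω|}) atTop (𝓝 0))
    (hVW : ∀ y1 y2, ∀ᶠ n in atTop, ∀ ω, W n ω ≤ y2 + E y2 n ω → ¬ (W n ω ≤ y1 + E y1 n ω) →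
      y1 ≤ V n ω ∧ V n ω ≤ y2)
    (hT : ∀ η > 0, ∃ K, ∀ n, P.real {ω | K < |W n ω|} ≤ η)
    {ε : ℝ} (hε : 0 < ε) : Tendsto (fun n => P.real {ω | ε ≤ |V n ω - W n ω|}) atTop (𝓝 0) := by
  set δ := ε / 3 with hδ
  have δ0 : 0 < δ := by positivity
  rw [Metric.tendsto_atTop']
  intro η hη
  obtain ⟨K, hK⟩ := hT (η / 2) (by positivity)
  obtain ⟨N, hN⟩ := exists_nat_gt (K / δ)
  set J := Finset.Icc (-(N : ℤ) - 5) (N + 5) with hJ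
  have s0 : Tendsto (fun n => ∑ k ∈ J, P.real {ω | δ ≤ |E (k * δ) n ω|}) atTop (𝓝 0) := by
    have := tendsto_finsetSum J fun (k : ℤ) _ => hE (k * δ) δ δ0
    simpa using this
  have s1 : ∀ᶠ n in atTop, ∑ k ∈ J, P.real {ω | δ ≤ |E (k * δ) n ω|} < η / 2 :=
    s0.eventually_lt_const (by positivity)
  have s2 : ∀ᶠ n in atTop, ∀ k ∈ J, ∀ ω, W n ω ≤ ((k + 2 : ℤ) * δ) + E ((k + 2 : ℤ) * δ) n ω →
      ¬ (W n ω ≤ ((k - 1 : ℤ) * δ) + E ((k - 1 : ℤ) * δ) n ω) →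
      ((k - 1 : ℤ) * δ) ≤ V n ω ∧ V n ω ≤ ((k + 2 : ℤ) * δ) :=
    (Finset.eventually_all J).2 fun k _ => hVW _ _
  obtain ⟨n0, hn0⟩ := eventually_atTop.1 (s1.and s2)
  refine ⟨n0, fun n hn => ?_⟩
  obtain ⟨a1, a2⟩ := hn0 n hn.le
  rw [Real.dist_eq, sub_zero, abs_of_nonneg measureReal_nonneg]
  have sub : {ω | ε ≤ |V n ω - W n ω|} ⊆ {ω | K < |W n ω|} ∪ ⋃ k ∈ J, {ω | δ ≤ |E (k * δ) n ω|} := by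
    intro ω hω
    by_contra hc
    simp only [Set.mem_union, Set.mem_iUnion, Set.mem_setOf_eq, not_or, not_exists, not_lt, not_le] at hc hω
    obtain ⟨c1, c2⟩ := hc
    set k := ⌊W n ω / δ⌋ with hk
    have k1 : k * δ ≤ W n ω := by rw [← le_div_iff₀ δ0]; exact Int.floor_le _
    have k2 : W n ω < (k + 1) * δ := by rw [← div_lt_iff₀ δ0]; exact Int.lt_floor_add_one _
    rw [abs_le] at c1
    have kN : K < N * δ := by rwa [div_lt_iff₀ δ0] at hN
    have k3 : (k : ℝ) < N := by
      by_contra hh; push Not at hh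
      have := mul_le_mul_of_nonneg_right hh δ0.le
      linarith [c1.2]
    have k4 : -(N : ℝ) - 1 < k := by
      by_contra hh; push Not at hh
      have := mul_le_mul_of_nonneg_right hh δ0.le
      nlinarith [c1.1]
    have k3' : k < N := by exact_mod_cast k3
    have k4' : -(N : ℤ) - 1 < k := by exact_mod_cast k4
    have m : ∀ i : ℤ, -2 ≤ i → i ≤ 2 → k + i ∈ J := fun i _ _ => by rw [hJ, Finset.mem_Icc]; omega
    have f1 := c2 (k + 2) (m 2 (by norm_num) (by norm_num))
    have f2 := c2 (k - 1) (by have := m (-1) (by norm_num) (by norm_num); rwa [← sub_eq_add_neg] at this)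
    rw [abs_lt] at f1 f2
    obtain ⟨g1, g2⟩ := a2 k (by have := m 0 (by norm_num) (by norm_num); rwa [add_zero] at this) ω
      (by push_cast at f1 ⊢; linarith [f1.1]) (by push_cast at f2 ⊢; linarith [f2.2])
    push_cast at g1 g2
    have : |V n ω - W n ω| < ε := by
      rw [abs_lt]; constructor <;> linarith
    linarith
  calc P.real {ω | ε ≤ |V n ω - W n ω|} ≤ P.real ({ω | K < |W n ω|} ∪ ⋃ k ∈ J, {ω | δ ≤ |E (k * δ) n ω|}) :=
        measureReal_mono sub
    _ ≤ P.real {ω | K < |W n ω|} + P.real (⋃ k ∈ J, {ω | δ ≤ |E (k * δ) n ω|}) := measureReal_union_le _ _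
    _ ≤ η / 2 + ∑ k ∈ J, P.real {ω | δ ≤ |E (k * δ) n ω|} :=
        add_le_add (hK n) (measureReal_biUnion_finset_le _ _)
    _ < η := by linarith

end
end UQuantile

namespace UQuantile

variable {Ω : Type*} [MeasurableSpace Ω]

section
variable {P : Measure Ω} [IsProbabilityMeasure P] {X Z : ℤ → Ω → ℝ} {b : ℕ → ℝ} {Cb : ℝ}
    {G : (l : ℕ) → (Fin (2 * l + 1) → ℝ) → ℤ} {l0 : ℕ} {Ca : ℝ} {h : ℝ → ℝ → ℝ → ℝ} {M : ℝ}

lemma Ustat_mono (hker : IsUQKernel h) (n : ℕ) (ω : Ω) : Monotone fun t => Ustat X h n t ω := by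
  intro s t hst
  have c0 : 0 ≤ 2 / ((n : ℝ) * ((n : ℝ) - 1)) := by
    rcases Nat.eq_zero_or_pos n with h0 | h0
    · simp [h0]
    · have : (1 : ℝ) ≤ n := by exact_mod_cast h0
      exact div_nonneg (by norm_num) (mul_nonneg (by linarith) (by linarith))
  exact mul_le_mul_of_nonneg_left (Finset.sum_le_sum fun i _ => Finset.sum_le_sum fun j _ => hker.mono _ _ hst) c0

lemma Ustat_meas (hX : ∀ i, Measurable (X i)) (hker : IsUQKernel h) (n : ℕ) (t : ℝ) :
    Measurable fun ω => Ustat X h n t ω :=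
  (Finset.measurable_sum _ fun i _ => Finset.measurable_sum _ fun j _ => meas_h hker t (hX i) (hX j)).const_mul _

lemma UinvEmp_meas (hX : ∀ i, Measurable (X i)) (hker : IsUQKernel h) (n : ℕ) (p : ℝ) :
    Measurable (UinvEmp X h n p) := by
  have mono := fun ω => Ustat_mono (X := X) hker n ω
  have mS : ∀ t, MeasurableSet {ω | p ≤ Ustat X h n t ω} := fun t =>
    measurableSet_le measurable_const (Ustat_meas hX hker n t)
  set N : Set Ω := ⋂ k : ℕ, {ω | p ≤ Ustat X h n (k : ℝ) ω}ᶜ with hN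
  set Bq : Set Ω := ⋂ k : ℕ, {ω | p ≤ Ustat X h n (-(k : ℝ)) ω} with hB
  have mN : MeasurableSet N := MeasurableSet.iInter fun k => (mS _).compl
  have mB : MeasurableSet Bq := MeasurableSet.iInter fun k => mS _
  have vN : ∀ ω ∈ N, UinvEmp X h n p ω = 0 := by
    intro ω hω
    have : {t | p ≤ Ustat X h n t ω} = ∅ := by
      rw [Set.eq_empty_iff_forall_notMem]
      intro t ht
      obtain ⟨k, hk⟩ := exists_nat_ge t
      exact (Set.mem_iInter.1 hω k) (le_trans ht (mono ω hk))
    unfold UinvEmp; rw [this, Real.sInf_empty]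
  have vB : ∀ ω ∈ Bq, UinvEmp X h n p ω = 0 := by
    intro ω hω
    unfold UinvEmp
    refine Real.sInf_of_not_bddBelow ?_
    rintro ⟨c, hc⟩
    obtain ⟨k, hk⟩ := exists_nat_gt (-c)
    have := hc (Set.mem_iInter.1 hω k)
    linarith
  refine measurable_of_Iio fun a => ?_
  have e : UinvEmp X h n p ⁻¹' Set.Iio a = ((N ∪ Bq) ∩ {_ω | 0 < a}) ∪
      ((N ∪ Bq)ᶜ ∩ ⋃ q : {q : ℚ // (q : ℝ) < a}, {ω | p ≤ Ustat X h n ((q : ℚ) : ℝ) ω}) := by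
    ext ω
    by_cases hω : ω ∈ N ∪ Bq
    · have hv : UinvEmp X h n p ω = 0 := by
        rcases hω with h' | h'
        · exact vN ω h'
        · exact vB ω h'
      constructor
      · intro hh
        left
        refine ⟨hω, ?_⟩
        change UinvEmp X h n p ω < a at hh
        rw [hv] at hh; exact hh
      · rintro (⟨_, hh⟩ | ⟨hh, _⟩)
        · change UinvEmp X h n p ω < a
          rw [hv]; exact hh
        · exact absurd hω hh
    · have hω' := hω
      rw [Set.mem_union, not_or] at hω'
      have ne : {t | p ≤ Ustat X h n t ω}.Nonempty := by
        by_contra hh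
        refine hω'.1 (Set.mem_iInter.2 fun k hk => hh ⟨_, hk⟩)
      have bd : BddBelow {t | p ≤ Ustat X h n t ω} := by
        by_contra hh
        refine hω'.2 (Set.mem_iInter.2 fun k => ?_)
        by_contra hk
        refine hh ⟨-(k : ℝ), fun t ht => ?_⟩
        by_contra hlt
        push Not at hlt
        exact hk (le_trans ht (mono ω hlt.le))
      constructor
      · intro hh
        right
        refine ⟨hω, ?_⟩
        change sInf {t | p ≤ Ustat X h n t ω} < a at hh
        obtain ⟨t, ht, hta⟩ := (csInf_lt_iff bd ne).1 hh
        obtain ⟨q, hq1, hq2⟩ := exists_rat_btwn hta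
        exact Set.mem_iUnion.2 ⟨⟨q, hq2⟩, le_trans ht (mono ω hq1.le)⟩
      · rintro (⟨hh, _⟩ | ⟨_, hh⟩)
        · exact absurd hh hω
        · obtain ⟨q, hq⟩ := Set.mem_iUnion.1 hh
          change sInf {t | p ≤ Ustat X h n t ω} < a
          exact (csInf_lt_iff bd ne).2 ⟨_, hq, q.2⟩
  rw [e]
  exact ((mN.union mB).inter (MeasurableSet.const _)).union
    ((mN.union mB).compl.inter (MeasurableSet.iUnion fun q => mS _))

lemma VariationAt.mono {μ : Measure ℝ} {L L' t : ℝ} (hv : VariationAt μ h L t) (hL : L ≤ L') :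
    VariationAt μ h L' t := fun ε hε =>
  (hv ε hε).trans (ENNReal.ofReal_le_ofReal (mul_le_mul_of_nonneg_right hL hε.le))

lemma tight_SI {g : ℝ → ℝ} {B C : ℝ} (S : Std P X Z b Cb G l0 Ca) (hg : GoodFn P X Z G l0 g B C) (c : ℝ) {η : ℝ} (hη : 0 < η) :
    ∃ K, ∀ n : ℕ, P.real {ω | K < |c / Real.sqrt n * SI X g (Finset.Icc 1 (n : ℤ)) ω|} ≤ η := by
  set D := G0 Cb l0 B C * ∑' r, dw r with hD
  have D0 : 0 ≤ D := mul_nonneg (G0_nonneg S hg) (tsum_nonneg fun r => (dw_pos r).le)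
  have hb : ∀ n : ℕ, ∫ ω, |c / Real.sqrt n * SI X g (Finset.Icc 1 (n : ℤ)) ω| ∂P ≤ |c| * Real.sqrt D := by
    intro n
    have l1 := L1_le_L2 (P := P) (SI_meas S hg (Finset.Icc 1 (n : ℤ))) (SI_abs hg (Finset.Icc 1 (n : ℤ)))
    have l2 := SI_sq_le S hg (Finset.Icc 1 (n : ℤ))
    have cI : ((Finset.Icc 1 (n : ℤ)).card : ℝ) = n := by simp
    rw [cI] at l2
    simp only [abs_mul]
    rw [integral_const_mul]
    rcases Nat.eq_zero_or_pos n with h0 | h0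
    · rw [h0]; simp; positivity
    · have hs : 0 < Real.sqrt n := Real.sqrt_pos.2 (by exact_mod_cast h0)
      rw [abs_div, abs_of_pos hs]
      calc |c| / Real.sqrt n * ∫ ω, |SI X g (Finset.Icc 1 (n : ℤ)) ω| ∂P
          ≤ |c| / Real.sqrt n * Real.sqrt (n * D) :=
            mul_le_mul_of_nonneg_left (l1.trans (Real.sqrt_le_sqrt l2)) (by positivity)
        _ = _ := by
            rw [Real.sqrt_mul (Nat.cast_nonneg n)]
            field_simp
  set K := (|c| * Real.sqrt D + 1) / η with hK
  have K0 : 0 < K := by positivity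
  refine ⟨K, fun n => ?_⟩
  have int : Integrable (fun ω => c / Real.sqrt n * SI X g (Finset.Icc 1 (n : ℤ)) ω) P :=
    (int_bdd (SI_meas S hg _) (SI_abs hg _)).const_mul _
  calc _ ≤ P.real {ω | K ≤ |c / Real.sqrt n * SI X g (Finset.Icc 1 (n : ℤ)) ω|} :=
        measureReal_mono fun ω (hω : K < _) => hω.le
    _ ≤ _ := markov int K0
    _ ≤ η := by
        rw [div_le_iff₀ K0, hK, mul_div_cancel₀ _ hη.ne']
        linarith [hb n]

end

end UQuantile

namespace UQuantile

/-- Under Assumptions 1, 2 and 3, `√n (U_n⁻¹(p) - U⁻¹(p))` converges in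
distribution to the centered normal law with variance `σ_p²`. -/
theorem uquantile_clt
    {Ω : Type*} [MeasurableSpace Ω] (P : Measure Ω) [IsProbabilityMeasure P]
    (X Z : ℤ → Ω → ℝ) (hX : ∀ i, Measurable (X i)) (hZ : ∀ i, Measurable (Z i))
    (p : ℝ) (hp : p ∈ Set.Ioo (0 : ℝ) 1)
    (h : ℝ → ℝ → ℝ → ℝ) (hker : IsUQKernel h) (u : ℝ → ℝ)
    (hA1 : Assumption1 P X Z)
    (hA2 : Assumption2 (P.map (X 0)) h p)
    (hA3 : Assumption3 (P.map (X 0)) h p u) :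
    ∀ f : BoundedContinuousFunction ℝ ℝ,
      Tendsto
        (fun n : ℕ =>
          ∫ ω, f (Real.sqrt n * (UinvEmp X h n p ω - Uinv (P.map (X 0)) h p)) ∂P)
        atTop
        (𝓝 (∫ x, f x ∂(ProbabilityTheory.gaussianReal 0 (Real.toNNReal (lrv P X h p u))))) := by
  intro f
  obtain ⟨b, Cb, G, l0, Ca, S⟩ := exists_std hX hZ hA1
  obtain ⟨M, hM⟩ := hker.bounded
  obtain ⟨L', δ, δ0, hv'⟩ := hA2
  obtain ⟨hd, hu, ho⟩ := hA3
  set t0 := Uinv (P.map (X 0)) h p with ht0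
  set L := max L' 0 with hLd
  have hL : 0 ≤ L := le_max_right _ _
  have hv : ∀ t, |t - t0| < δ → VariationAt (P.map (X 0)) h L t := fun t ht => (hv' t ht).mono (le_max_left _ _)
  have hv0 : VariationAt (P.map (X 0)) h L t0 := hv t0 (by simpa using δ0)
  set u0 := u t0 with hu0
  have hder : HasDerivAt (Udist (P.map (X 0)) h) u0 t0 := hd.self_of_nhds
  have hUp : Udist (P.map (X 0)) h t0 = p := by
    have := (ho.bound (by norm_num : (0 : ℝ) < 1)).self_of_nhds
    simp only [sub_self, mul_zero, sub_zero, abs_zero] at this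
    rw [Real.zero_rpow (by norm_num), norm_zero, mul_zero] at this
    have := norm_le_zero_iff.1 this
    linarith
  have hg := S.h1_good hker hM hL hv0
  set g : ℝ → ℝ := fun x => h1 (P.map (X 0)) h x t0 with hgd
  set W : ℕ → Ω → ℝ := fun n ω => (-2 / u0) / Real.sqrt n * SI X g (Finset.Icc 1 (n : ℤ)) ω with hW
  set V : ℕ → Ω → ℝ := fun n ω => Real.sqrt n * (UinvEmp X h n p ω - t0) with hV
  -- variance
  have hvar : lrv P X h p u = (-2 / u0) ^ 2 * ∑' r, cv P X g r := by
    unfold lrv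
    have e : ∀ r, covShift P X g r = cv P X g r := fun r => by
      unfold covShift cv
      rw [hg.mean]; ring
    have e2 : (fun r => covShift P X g r) = fun r => cv P X g r := funext e
    rw [← ht0]
    change 4 / u0 ^ 2 * ∑' r, covShift P X g r = _
    rw [e2]
    congr 1
    ring
  rw [hvar]
  refine conv_final (W := W) (V := V) (clt S hg (-2 / u0)) (fun n => ?_) (fun ε hε => ?_) f
  · exact (((UinvEmp_meas hX hker n p).sub measurable_const).const_mul _).aemeasurable
  set tt : ℝ → ℕ → ℝ := fun y n => t0 + (Real.sqrt n)⁻¹ * y with htt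
  have hs : Tendsto (fun n : ℕ => Real.sqrt n) atTop atTop :=
    Real.tendsto_sqrt_atTop.comp tendsto_natCast_atTop_atTop
  have hsi : Tendsto (fun n : ℕ => (Real.sqrt n)⁻¹) atTop (𝓝 0) := hs.inv_tendsto_atTop
  have htl : ∀ y, Tendsto (tt y) atTop (𝓝 t0) := fun y => by
    have := (hsi.mul_const y).const_add t0
    simpa using this
  set E : ℝ → ℕ → Ω → ℝ := fun y n ω => Real.sqrt n * (Ustat X h n (tt y n) ω - p) / u0 + W n ω - y with hE
  refine ghosh (P := P) (E := E) (fun y ε hε => ?_) (fun y1 y2 => ?_) (fun η hη => tight_SI S hg _ hη) hε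
  · -- remainder
    set t' : ℕ → ℝ := fun n => if |tt y n - t0| < δ then tt y n else t0 with ht'
    have ev : ∀ᶠ n in atTop, tt y n = t' n := by
      have : ∀ᶠ n in atTop, |tt y n - t0| < δ := by
        have := (htl y).eventually (Metric.ball_mem_nhds t0 δ0)
        simpa [Real.dist_eq] using this
      filter_upwards [this] with n hn
      simp only [ht', hn, if_true]
    have hvt : ∀ n, VariationAt (P.map (X 0)) h L (t' n) := fun n => by
      simp only [ht']
      split_ifs with hh
      · exact hv _ hh
      · exact hv0
    have hUt : Tendsto (fun n => Udist (P.map (X 0)) h (t' n)) atTop (𝓝 (Udist (P.map (X 0)) h t0)) :=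
      hder.continuousAt.tendsto.comp ((htl y).congr' ev)
    have R := S.Rn_lim hker hM hL t' hvt hv0 hUt (ε := u0 * (ε / 2)) (by positivity)
    have dl : Tendsto (fun n : ℕ => Real.sqrt n * (Udist (P.map (X 0)) h (tt y n) - p) / u0 - y) atTop (𝓝 0) := by
      have h1 : HasDerivAt (fun s : ℝ => Udist (P.map (X 0)) h (t0 + s * y)) (u0 * y) 0 := by
        have hi : HasDerivAt (fun s : ℝ => t0 + s * y) y 0 := by
          simpa using ((hasDerivAt_id (0 : ℝ)).mul_const y).const_add t0
        have ho' : HasDerivAt (Udist (P.map (X 0)) h) u0 (t0 + 0 * y) := by simpa using hder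
        exact ho'.comp (0 : ℝ) hi
      rw [hasDerivAt_iff_tendsto_slope_zero] at h1
      have h2 : Tendsto (fun n : ℕ => (Real.sqrt n)⁻¹) atTop (𝓝[≠] 0) := by
        refine tendsto_nhdsWithin_iff.2 ⟨hsi, ?_⟩
        filter_upwards [eventually_gt_atTop 0] with n hn
        have : 0 < Real.sqrt n := Real.sqrt_pos.2 (by exact_mod_cast hn)
        exact (inv_pos.2 this).ne'
      have h3 := ((h1.comp h2).div_const u0).sub_const y
      have h4 : u0 * y / u0 - y = 0 := by field_simp; ring
      rw [h4] at h3
      refine h3.congr fun n => ?_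
      simp only [Function.comp, htt, inv_inv, smul_eq_mul, zero_add, zero_mul, add_zero, hUp]
    have dl2 : ∀ᶠ n : ℕ in atTop, |Real.sqrt n * (Udist (P.map (X 0)) h (tt y n) - p) / u0 - y| < ε / 2 := by
      have := dl.eventually (Metric.ball_mem_nhds (0 : ℝ) (by positivity : 0 < ε / 2))
      simpa [Real.dist_eq] using this
    refine squeeze_zero' (Eventually.of_forall fun n => measureReal_nonneg) ?_ R
    filter_upwards [ev, dl2] with n hn hdn
    rw [← hn]
    refine measureReal_mono fun ω hω => ?_
    simp only [Set.mem_setOf_eq] at hω ⊢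
    have e : E y n ω = Rn P X h t0 n (tt y n) ω / u0
        + (Real.sqrt n * (Udist (P.map (X 0)) h (tt y n) - p) / u0 - y) := by
      simp only [hE, hW, Rn]
      have := hu.ne'
      rw [← hgd]
      generalize SI X g (Finset.Icc 1 (n : ℤ)) ω = s
      generalize Ustat X h n (tt y n) ω = a
      ring
    rw [e] at hω
    have k1 := hω.trans (abs_add_le _ _)
    have k2 : ε / 2 ≤ |Rn P X h t0 n (tt y n) ω / u0| := by linarith
    rw [abs_div, abs_of_pos hu, le_div_iff₀ hu] at k2
    linarith
  · filter_upwards [eventually_gt_atTop 0] with n hn ω a1 a2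
    have hs0 : 0 < Real.sqrt n := Real.sqrt_pos.2 (by exact_mod_cast hn)
    have key : ∀ y, W n ω ≤ y + E y n ω ↔ p ≤ Ustat X h n (tt y n) ω := fun y => by
      have e : y + E y n ω = W n ω + (Real.sqrt n / u0) * (Ustat X h n (tt y n) ω - p) := by
        simp only [hE]; ring
      rw [e]
      have hc : 0 < Real.sqrt n / u0 := by positivity
      constructor
      · intro hh
        have : 0 ≤ (Real.sqrt n / u0) * (Ustat X h n (tt y n) ω - p) := by linarith
        have := nonneg_of_mul_nonneg_right this hc
        linarith
      · intro hh
        have := mul_nonneg hc.le (sub_nonneg.2 hh)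
        linarith
    rw [key] at a1 a2
    have lb : ∀ t ∈ {t | p ≤ Ustat X h n t ω}, tt y1 n ≤ t := fun t ht => by
      by_contra hlt
      push Not at hlt
      exact a2 (le_trans ht (Ustat_mono hker n ω hlt.le))
    have b1 : tt y1 n ≤ UinvEmp X h n p ω := le_csInf ⟨_, a1⟩ lb
    have b2 : UinvEmp X h n p ω ≤ tt y2 n := csInf_le ⟨_, lb⟩ a1
    have e : ∀ y, Real.sqrt n * (tt y n - t0) = y := fun y => by
      simp only [htt]; field_simp; ring
    constructor
    · rw [← e y1]; exact mul_le_mul_of_nonneg_left (by linarith) hs0.le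
    · rw [← e y2]; exact mul_le_mul_of_nonneg_left (by linarith) hs0.le

end UQuantile
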